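/- arXiv:2104.07137 — 3 statements merged into one kernel-verified Lean document; each statement's English description precedes it below -/
import Mathlib

section
/- For every complex number s with Re s > 0, the Laplace transforms ξ̂(s) = ∫₀^∞ ξ(u) e^{−su} du and ω̂(s) = ∫₀^∞ ω(u) e^{−su} du converge and satisfy 1 + ξ̂(s) = s^{−2} exp( −2γ + 2∫₀^s (1 − e^{−t}) t^{−1} dt ) = (1 + ω̂(s))², where the integral ∫₀^s is along the straight segment from 0 to s. -/
open Real MeasureTheory

noncomputable def Ein (s : ℂ) : ℂ :=
  ∫ r in (0:ℝ)..1, ((1 - Complex.exp (-(r * s))) / (r * s)) * s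

lemma Ein_eq (s : ℂ) : Ein s = ∫ r in (0:ℝ)..1, ((1 - Complex.exp (-(r * s))) / r) := by
  unfold Ein
  congr 1
  ext r
  by_cases hr : (r:ℂ) = 0
  · simp [hr]
  by_cases hs : s = 0
  · simp [hs]
  field_simp

lemma Ein_intble (s : ℂ) : IntervalIntegrable
    (fun r : ℝ => ((1 - Complex.exp (-(r * s))) / r)) volume 0 1 := by
  have hc : Continuous (dslope (fun r : ℝ => 1 - Complex.exp (-(r * s))) 0) := by
    rw [← continuousOn_univ, continuousOn_dslope Filter.univ_mem]
    refine ⟨by fun_prop, ?_⟩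
    have : HasDerivAt (fun r : ℝ => 1 - Complex.exp (-(r * s))) (-(Complex.exp (-((0:ℝ) * s)) * (-(1 * s)))) 0 := by
      exact ((((Complex.ofRealCLM.hasDerivAt).mul_const s).neg).cexp).const_sub 1
    exact this.differentiableAt
  refine (hc.intervalIntegrable 0 1).congr ?_
  intro r hr
  have hr0 : r ≠ 0 := by
    rw [Set.uIoc_of_le zero_le_one] at hr
    exact hr.1.ne'
  simp only [dslope_of_ne _ hr0, slope, vsub_eq_sub, sub_zero]
  simp
  field_simp

lemma Ein_hasDerivAt (s : ℂ) (hs : 0 < s.re) :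
    HasDerivAt Ein ((1 - Complex.exp (-s)) / s) s := by
  have h := intervalIntegral.hasDerivAt_integral_of_dominated_loc_of_deriv_le
    (F := fun (s : ℂ) (r : ℝ) => ((1 - Complex.exp (-(r * s))) / r))
    (F' := fun (s : ℂ) (r : ℝ) => Complex.exp (-s * r)) (x₀ := s) (s := {z : ℂ | 0 < z.re})
    (bound := fun _ => 1) (μ := volume) (a := 0) (b := 1)
    ((isOpen_lt continuous_const Complex.continuous_re).mem_nhds hs)
    (Filter.Eventually.of_forall fun z => (by
      have : Measurable (fun r : ℝ => ((1 - Complex.exp (-(r * z))) / r)) := by fun_prop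
      exact this.aestronglyMeasurable))
    (Ein_intble s)
    (by
      have : Continuous (fun r : ℝ => Complex.exp (-s * r)) := by fun_prop
      exact this.aestronglyMeasurable)
    (by
      refine Filter.Eventually.of_forall fun r hr z hz => ?_
      rw [Set.uIoc_of_le zero_le_one] at hr
      rw [Complex.norm_exp]
      simp at hz ⊢
      have := mul_pos hz hr.1
      linarith)
    (by simp)
    (by
      refine Filter.Eventually.of_forall fun r hr z hz => ?_
      rw [Set.uIoc_of_le zero_le_one] at hr
      have hr0 : (r:ℂ) ≠ 0 := by exact_mod_cast hr.1.ne'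
      have := (((((hasDerivAt_id z).const_mul (r:ℂ)).neg).cexp).const_sub 1).div_const (r:ℂ)
      refine this.congr_deriv ?_
      simp only [id, mul_one, Pi.neg_apply]
      rw [show -(↑r * z) = -z * r by ring]
      field_simp)
  have h2 := h.2
  have hs0 : s ≠ 0 := by rintro rfl; simp at hs
  rw [integral_exp_mul_complex (neg_ne_zero.mpr hs0)] at h2
  have hE : Ein = fun s => ∫ r in (0:ℝ)..1, ((1 - Complex.exp (-(r * s))) / r) := funext Ein_eq
  rw [hE]
  refine h2.congr_deriv ?_
  simp only [Complex.ofReal_one, Complex.ofReal_zero, mul_one, mul_zero, Complex.exp_zero]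
  field_simp
  ring

lemma Ein_real (x : ℝ) (hx : 0 < x) :
    Ein x = ((∫ t in (0:ℝ)..x, (1 - Real.exp (-t)) / t : ℝ) : ℂ) := by
  have := intervalIntegral.integral_comp_mul_right (a := 0) (b := 1) (fun t : ℝ => (1 - Real.exp (-t)) / t) hx.ne'
  rw [zero_mul, one_mul] at this
  have h2 : (∫ t in (0:ℝ)..x, (1 - Real.exp (-t)) / t : ℝ) = x * ∫ r in (0:ℝ)..1, (1 - Real.exp (-(r * x))) / (r * x) := by
    rw [this]; simp; field_simp
  rw [h2, ← intervalIntegral.integral_const_mul, ← intervalIntegral.integral_ofReal]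
  unfold Ein
  congr 1
  ext r
  push_cast
  ring

lemma gamma_int : IntegrableOn (fun t : ℝ => Real.exp (-t) * Real.log t) (Set.Ioi 0) ∧
    ∫ t in Set.Ioi (0:ℝ), Real.exp (-t) * Real.log t = - Real.eulerMascheroniConstant := by
  have h1 := Complex.hasDerivAt_GammaIntegral (s := 1) (by simp)
  have h2 : HasDerivAt Complex.GammaIntegral (-(Real.eulerMascheroniConstant:ℂ)) 1 := by
    refine Complex.hasDerivAt_Gamma_one.congr_of_eventuallyEq ?_
    filter_upwards [(isOpen_lt continuous_const Complex.continuous_re).mem_nhds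
      (show (1:ℂ) ∈ {z : ℂ | 0 < z.re} by simp)] with z hz
    exact (Complex.Gamma_eq_integral hz).symm
  have h3 := h1.unique h2
  have h4 : ((∫ t in Set.Ioi (0:ℝ), Real.exp (-t) * Real.log t : ℝ) : ℂ) = ((- Real.eulerMascheroniConstant : ℝ) : ℂ) := by
    rw [← integral_complex_ofReal]
    push_cast
    rw [← h3]
    congr 1
    ext t
    simp
    ring
  have h5 : ∫ t in Set.Ioi (0:ℝ), Real.exp (-t) * Real.log t = - Real.eulerMascheroniConstant := by
    exact_mod_cast h4
  refine ⟨?_, h5⟩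
  by_contra hni
  have := integral_undef hni
  rw [this] at h5
  have := Real.one_half_lt_eulerMascheroniConstant
  linarith

lemma real_Ein_eq (x : ℝ) (hx : 0 < x) :
    ∫ t in (0:ℝ)..x, (1 - Real.exp (-t)) / t =
      (1 - Real.exp (-x)) * Real.log x - ∫ t in (0:ℝ)..x, Real.exp (-t) * Real.log t := by
  have hc : Continuous (dslope (fun r : ℝ => 1 - Real.exp (-r)) 0) := by
    rw [← continuousOn_univ, continuousOn_dslope Filter.univ_mem]
    exact ⟨by fun_prop, by fun_prop⟩
  have hd : ∀ t : ℝ, t ≠ 0 → dslope (fun r : ℝ => 1 - Real.exp (-r)) 0 t = (1 - Real.exp (-t)) / t := by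
    intro t ht
    simp only [dslope_of_ne _ ht, slope, vsub_eq_sub, sub_zero]
    simp
    field_simp
  have hi1 : IntervalIntegrable (fun t => (1 - Real.exp (-t)) / t) volume 0 x := by
    refine (hc.intervalIntegrable 0 x).congr ?_
    intro r hr
    rw [Set.uIoc_of_le hx.le] at hr
    exact hd r hr.1.ne'
  have hi2 : IntervalIntegrable (fun t => Real.exp (-t) * Real.log t) volume 0 x := by
    rw [intervalIntegrable_iff_integrableOn_Ioc_of_le hx.le]
    exact gamma_int.1.mono_set Set.Ioc_subset_Ioi_self
  have hcont : Continuous (fun t : ℝ => (1 - Real.exp (-t)) * Real.log t) := by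
    have : (fun t : ℝ => (1 - Real.exp (-t)) * Real.log t) =
        fun t => dslope (fun r : ℝ => 1 - Real.exp (-r)) 0 t * (t * Real.log t) := by
      ext t
      by_cases ht : t = 0
      · simp [ht]
      · rw [hd t ht]; field_simp
    rw [this]
    exact hc.mul Real.continuous_mul_log
  have := intervalIntegral.integral_eq_sub_of_hasDerivAt_of_le (a := 0) (b := x)
    (f := fun t : ℝ => (1 - Real.exp (-t)) * Real.log t)
    (f' := fun t => (1 - Real.exp (-t)) / t + Real.exp (-t) * Real.log t) hx.le hcont.continuousOn
    (by
      intro t ht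
      have := ((((hasDerivAt_id t).neg).exp).const_sub 1).mul (Real.hasDerivAt_log ht.1.ne')
      refine this.congr_deriv ?_
      simp
      ring) (hi1.add hi2)
  rw [intervalIntegral.integral_add hi1 hi2] at this
  simp at this
  linarith

lemma Ein_limit : Filter.Tendsto (fun x : ℝ => (∫ t in (0:ℝ)..x, (1 - Real.exp (-t)) / t) - Real.log x)
    Filter.atTop (nhds Real.eulerMascheroniConstant) := by
  have h1 := intervalIntegral_tendsto_integral_Ioi 0 gamma_int.1 Filter.tendsto_id
  rw [gamma_int.2] at h1
  have h2 : Filter.Tendsto (fun x : ℝ => Real.exp (-x) * Real.log x) Filter.atTop (nhds 0) := by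
    have h3 := Real.tendsto_pow_mul_exp_neg_atTop_nhds_zero 1
    refine tendsto_of_tendsto_of_tendsto_of_le_of_le' tendsto_const_nhds h3 ?_ ?_
    · filter_upwards [Filter.eventually_ge_atTop 1] with x hx
      exact mul_nonneg (Real.exp_pos _).le (Real.log_nonneg hx)
    · filter_upwards [Filter.eventually_ge_atTop 1] with x hx
      rw [pow_one, mul_comm]
      exact mul_le_mul_of_nonneg_right (Real.log_le_self (by linarith)) (Real.exp_pos _).le
  have h4 := (h2.add h1).neg
  simp only [zero_add, neg_neg] at h4
  refine h4.congr' ?_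
  filter_upwards [Filter.eventually_gt_atTop 0] with x hx
  rw [real_Ein_eq x hx]
  simp
  ring

lemma K_zero (f : ℝ → ℝ) (hf0 : ∀ u : ℝ, u < 1 → f u = 0) (v : ℝ) (hv : v ≤ 1) :
    ∫ t in (1:ℝ)..v, f t = 0 := by
  rw [intervalIntegral.integral_symm, intervalIntegral.integral_of_le hv,
    integral_Ioc_eq_integral_Ioo, setIntegral_eq_zero_of_forall_eq_zero, neg_zero]
  intro x hx
  exact hf0 x hx.2

lemma int_01 (f : ℝ → ℝ) (hf0 : ∀ u : ℝ, u < 1 → f u = 0) (v : ℝ) (hv : v ≤ 1) :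
    IntervalIntegrable f volume v 1 := by
  rw [intervalIntegrable_iff_integrableOn_Ioo_of_le hv]
  refine integrableOn_zero.congr_fun ?_ measurableSet_Ioo
  intro x hx
  exact (hf0 x hx.2).symm

lemma f_basic_aux (f : ℝ → ℝ) (κ : ℕ) (h2 : κ ≤ 2)
    (hf0 : ∀ u : ℝ, u < 1 → f u = 0)
    (hf : ∀ u : ℝ, 1 ≤ u → u * f u = κ + κ * ∫ t in (1:ℝ)..(u - 1), f t) (n : ℕ) :
    ContinuousOn f (Set.Icc 1 (n+1)) ∧ ∀ u ∈ Set.Icc (1:ℝ) (n+1), 0 ≤ f u ∧ f u ≤ 2 * u := by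
  have hκ : (κ:ℝ) ≤ 2 := by exact_mod_cast h2
  have hκ0 : (0:ℝ) ≤ κ := by positivity
  induction n with
  | zero =>
    simp
    have := hf 1 le_rfl
    rw [K_zero f hf0 _ (by norm_num)] at this
    simp at this
    rw [this]
    exact ⟨hκ0, hκ⟩
  | succ n ih =>
    obtain ⟨ihc, ihb⟩ := ih
    have hn : (0:ℝ) ≤ n := by positivity
    have hi1 : IntervalIntegrable f volume 1 (n+1) :=
      ContinuousOn.intervalIntegrable_of_Icc (by linarith) ihc
    have hi : IntervalIntegrable f volume 0 (n+1) :=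
      (int_01 f hf0 0 zero_le_one).trans hi1
    have hKc := intervalIntegral.continuousOn_primitive_interval' (a := 1) hi
      (by rw [Set.uIcc_of_le (by linarith)]; exact ⟨by norm_num, by linarith⟩)
    rw [Set.uIcc_of_le (by linarith)] at hKc
    have hKb : ∀ v ∈ Set.Icc (0:ℝ) (n+1), 0 ≤ ∫ t in (1:ℝ)..v, f t ∧
        1 + ∫ t in (1:ℝ)..v, f t ≤ 1 + v^2 ∧ (1 ≤ v → ∫ t in (1:ℝ)..v, f t ≤ v^2 - 1) := by
      intro v hv
      rcases le_total v 1 with h | h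
      · rw [K_zero f hf0 v h]
        refine ⟨le_rfl, by nlinarith, fun _ => by nlinarith⟩
      · have a1 : 0 ≤ ∫ t in (1:ℝ)..v, f t :=
          intervalIntegral.integral_nonneg h fun t ht => (ihb t ⟨ht.1, ht.2.trans hv.2⟩).1
        have a2 : ∫ t in (1:ℝ)..v, f t ≤ ∫ t in (1:ℝ)..v, 2 * t := by
          refine intervalIntegral.integral_mono_on h ?_ ?_ fun t ht => (ihb t ⟨ht.1, ht.2.trans hv.2⟩).2
          · exact ContinuousOn.intervalIntegrable_of_Icc h (ihc.mono (Set.Icc_subset_Icc le_rfl hv.2))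
          · exact Continuous.intervalIntegrable (by fun_prop) _ _
        have a3 : ∫ t in (1:ℝ)..v, 2 * t = v^2 - 1 := by
          rw [intervalIntegral.integral_const_mul, integral_id]; ring
        exact ⟨a1, by linarith, fun _ => by linarith⟩
    have hfe : ∀ u ∈ Set.Icc (1:ℝ) ((n+1:ℕ)+1), f u = (κ + κ * ∫ t in (1:ℝ)..(u - 1), f t) / u := by
      intro u hu
      have := hf u hu.1
      have hu0 : u ≠ 0 := by linarith [hu.1]
      field_simp
      linarith
    have hmap : ∀ u ∈ Set.Icc (1:ℝ) ((n+1:ℕ)+1), u - 1 ∈ Set.Icc (0:ℝ) (n+1) := by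
      intro u hu
      have := hu.2
      push_cast at this
      exact ⟨by linarith [hu.1], by linarith⟩
    constructor
    · refine ContinuousOn.congr ?_ hfe
      refine ContinuousOn.div ?_ continuousOn_id (fun u hu => by simp; linarith [hu.1])
      refine continuousOn_const.add (continuousOn_const.mul ?_)
      exact hKc.comp (by fun_prop) hmap
    · intro u hu
      obtain ⟨b1, b2, b3⟩ := hKb _ (hmap u hu)
      have hu1 := hu.1
      rw [hfe u hu]
      refine ⟨by positivity, ?_⟩
      rw [div_le_iff₀ (by linarith)]
      have : (κ:ℝ) + κ * ∫ t in (1:ℝ)..(u - 1), f t ≤ 2 * (1 + ∫ t in (1:ℝ)..(u - 1), f t) := by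
        have := mul_le_mul_of_nonneg_right hκ (show 0 ≤ 1 + ∫ t in (1:ℝ)..(u - 1), f t by linarith)
        linarith
      rcases le_total (u-1) 1 with h | h
      · rw [K_zero f hf0 _ h] at this ⊢
        nlinarith
      · have := b3 h
        nlinarith

structure Good (f : ℝ → ℝ) (κ : ℕ) : Prop where
  z : ∀ u : ℝ, u < 1 → f u = 0
  eq : ∀ u : ℝ, 1 ≤ u → u * f u = κ + κ * ∫ t in (1:ℝ)..(u - 1), f t
  cont : ContinuousOn f (Set.Ici 1)
  nonneg : ∀ u, 0 ≤ f u
  le : ∀ u, 0 < u → f u ≤ 2 * u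

lemma good_of (f : ℝ → ℝ) (κ : ℕ) (h2 : κ ≤ 2)
    (hf0 : ∀ u : ℝ, u < 1 → f u = 0)
    (hf : ∀ u : ℝ, 1 ≤ u → u * f u = κ + κ * ∫ t in (1:ℝ)..(u - 1), f t) : Good f κ := by
  have H := f_basic_aux f κ h2 hf0 hf
  have hn : ∀ u : ℝ, 1 ≤ u → ∃ n : ℕ, u < n + 1 := fun u _ => by
    obtain ⟨n, hn⟩ := exists_nat_gt u
    exact ⟨n, by linarith⟩
  refine ⟨hf0, hf, ?_, ?_, ?_⟩
  · intro u hu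
    obtain ⟨n, hn⟩ := hn u hu
    refine ((H n).1 u ⟨hu, hn.le⟩).mono_of_mem_nhdsWithin ?_
    rw [← Set.Ici_inter_Iic]
    exact Filter.inter_mem self_mem_nhdsWithin (mem_nhdsWithin_of_mem_nhds (Iic_mem_nhds hn))
  · intro u
    rcases lt_or_ge u 1 with h | h
    · rw [hf0 u h]
    · obtain ⟨n, hn⟩ := hn u h
      exact ((H n).2 u ⟨h, hn.le⟩).1
  · intro u hu
    rcases lt_or_ge u 1 with h | h
    · rw [hf0 u h]; linarith
    · obtain ⟨n, hn⟩ := hn u h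
      exact ((H n).2 u ⟨h, hn.le⟩).2

lemma Good.meas {f : ℝ → ℝ} {κ : ℕ} (g : Good f κ) : Measurable f := by
  classical
  have : f = (Set.Ici (1:ℝ)).indicator f := by
    ext u
    by_cases h : u ∈ Set.Ici (1:ℝ)
    · simp [h]
    · rw [Set.indicator_of_notMem h, g.z u (by simpa using h)]
  rw [this]
  have := g.cont.measurable_piecewise (g := (0 : ℝ → ℝ)) (continuousOn_const) measurableSet_Ici
  rwa [Set.piecewise_eq_indicator] at this

lemma Good.int {f : ℝ → ℝ} {κ : ℕ} (g : Good f κ) (a : ℝ) : IntervalIntegrable f volume 1 a := by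
  rcases le_total a 1 with h | h
  · exact (int_01 f g.z a h).symm
  · exact ContinuousOn.intervalIntegrable_of_Icc h (g.cont.mono Set.Icc_subset_Ici_self)

lemma Good.Kcont {f : ℝ → ℝ} {κ : ℕ} (g : Good f κ) : Continuous (fun v => ∫ t in (1:ℝ)..v, f t) :=
  intervalIntegral.continuous_primitive (fun a b => (g.int a).symm.trans (g.int b)) 1

lemma Good.Kb {f : ℝ → ℝ} {κ : ℕ} (g : Good f κ) (v : ℝ) : 0 ≤ ∫ t in (1:ℝ)..v, f t ∧
        ∫ t in (1:ℝ)..v, f t ≤ v^2 := by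
  rcases le_total v 1 with h | h
  · rw [K_zero f g.z v h]
    exact ⟨le_rfl, sq_nonneg _⟩
  · refine ⟨intervalIntegral.integral_nonneg h fun t ht => g.nonneg t, ?_⟩
    have a2 : ∫ t in (1:ℝ)..v, f t ≤ ∫ t in (1:ℝ)..v, 2 * t := by
      refine intervalIntegral.integral_mono_on h (g.int v) ?_ fun t ht => g.le t (by linarith [ht.1])
      exact Continuous.intervalIntegrable (by fun_prop) _ _
    have a3 : ∫ t in (1:ℝ)..v, 2 * t = v^2 - 1 := by
      rw [intervalIntegral.integral_const_mul, integral_id]; ring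
    linarith

lemma bound_int (σ : ℝ) (hσ : 0 < σ) :
    IntegrableOn (fun u : ℝ => (2 + 2 * u^2) * Real.exp (-σ * u)) (Set.Ioi 0) := by
  have h0 := integrableOn_rpow_mul_exp_neg_mul_rpow (s := 0) (p := 1) (by norm_num) one_pos hσ
  have h2 := integrableOn_rpow_mul_exp_neg_mul_rpow (s := 2) (p := 1) (by norm_num) one_pos hσ
  refine ((h0.const_mul 2).add (h2.const_mul 2)).congr ?_
  refine Filter.Eventually.of_forall fun u => ?_
  simp
  ring

lemma exp_norm (s : ℂ) (u : ℝ) : ‖Complex.exp (-s * u)‖ = Real.exp (-s.re * u) := by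
  rw [Complex.norm_exp]; simp

lemma lap_int (g : ℝ → ℂ) (hg : Measurable g) (hb : ∀ u, 0 < u → ‖g u‖ ≤ 2 + 2 * u^2)
    (s : ℂ) (hs : 0 < s.re) :
    IntegrableOn (fun u : ℝ => g u * Complex.exp (-s * u)) (Set.Ioi 0) := by
  refine (bound_int s.re hs).mono' ?_ ?_
  · exact (hg.mul (by fun_prop)).aestronglyMeasurable
  · filter_upwards [ae_restrict_mem measurableSet_Ioi] with u hu
    rw [norm_mul, exp_norm]
    exact mul_le_mul_of_nonneg_right (hb u hu) (Real.exp_pos _).le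

lemma Good.norm {f : ℝ → ℝ} {κ : ℕ} (g : Good f κ) (u : ℝ) (hu : 0 < u) : ‖(f u : ℂ)‖ ≤ 2 * u := by
  rw [Complex.norm_real, Real.norm_of_nonneg (g.nonneg u)]
  exact g.le u hu

lemma Good.lap1 {f : ℝ → ℝ} {κ : ℕ} (g : Good f κ) (s : ℂ) (hs : 0 < s.re) :
    IntegrableOn (fun u : ℝ => (f u : ℂ) * Complex.exp (-s * u)) (Set.Ioi 0) := by
  refine lap_int (fun u => (f u : ℂ)) (Complex.measurable_ofReal.comp g.meas) (fun u hu => ?_) s hs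
  have := g.norm u hu
  nlinarith

lemma Good.lap_deriv {f : ℝ → ℝ} {κ : ℕ} (g : Good f κ) (s : ℂ) (hs : 0 < s.re) :
    HasDerivAt (fun s : ℂ => ∫ u in Set.Ioi (0:ℝ), (f u : ℂ) * Complex.exp (-s * u))
      (∫ u in Set.Ioi (0:ℝ), (f u : ℂ) * (Complex.exp (-s * u) * (-u))) s := by
  have hm : Measurable (fun u => (f u : ℂ)) := Complex.measurable_ofReal.comp g.meas
  refine (hasDerivAt_integral_of_dominated_loc_of_deriv_le
    (F := fun (s : ℂ) (u : ℝ) => (f u : ℂ) * Complex.exp (-s * u))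
    (F' := fun (s : ℂ) (u : ℝ) => (f u : ℂ) * (Complex.exp (-s * u) * (-u)))
    (s := {z : ℂ | s.re / 2 < z.re})
    (bound := fun u => (2 + 2 * u^2) * Real.exp (-(s.re/2) * u))
    ((isOpen_lt continuous_const Complex.continuous_re).mem_nhds (by simp; linarith))
    (Filter.Eventually.of_forall fun z => (hm.mul (by fun_prop)).aestronglyMeasurable)
    (g.lap1 s hs) (hm.mul (by fun_prop)).aestronglyMeasurable ?_
    (bound_int _ (by linarith)) ?_).2
  · filter_upwards [ae_restrict_mem measurableSet_Ioi] with u hu z hz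
    rw [Set.mem_Ioi] at hu
    replace hz : s.re / 2 < z.re := hz
    rw [norm_mul, norm_mul, exp_norm, norm_neg, Complex.norm_real u, Real.norm_of_nonneg hu.le]
    have h1 := g.norm u hu
    have h3 : Real.exp (-z.re * u) ≤ Real.exp (-(s.re/2) * u) := by
      apply Real.exp_le_exp.mpr
      nlinarith
    calc ‖(f u : ℂ)‖ * (Real.exp (-z.re * u) * u) ≤ (2 * u) * (Real.exp (-(s.re/2) * u) * u) := by
          gcongr
      _ ≤ _ := by
          have := Real.exp_pos (-(s.re/2) * u)
          nlinarith
  · refine Filter.Eventually.of_forall fun u z hz => ?_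
    have := ((((hasDerivAt_id z).neg).mul_const (u:ℂ)).cexp).const_mul (f u : ℂ)
    refine this.congr_deriv ?_
    simp

lemma Good.lap_zero {f : ℝ → ℝ} {κ : ℕ} (g : Good f κ) :
    Filter.Tendsto (fun x : ℝ => ∫ u in Set.Ioi (0:ℝ), (f u : ℂ) * Complex.exp (-(x:ℂ) * u))
      Filter.atTop (nhds 0) := by
  have hm : Measurable (fun u => (f u : ℂ)) := Complex.measurable_ofReal.comp g.meas
  have := tendsto_integral_filter_of_dominated_convergence (μ := volume.restrict (Set.Ioi (0:ℝ)))
    (F := fun (x : ℝ) (u : ℝ) => (f u : ℂ) * Complex.exp (-(x:ℂ) * u)) (l := Filter.atTop)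
    (f := fun _ => 0)
    (fun u => (2 + 2 * u^2) * Real.exp (-1 * u))
    (Filter.Eventually.of_forall fun z => (hm.mul (by fun_prop)).aestronglyMeasurable)
    (by
      filter_upwards [Filter.eventually_ge_atTop 1] with x hx
      filter_upwards [ae_restrict_mem measurableSet_Ioi] with u hu
      rw [Set.mem_Ioi] at hu
      rw [norm_mul, exp_norm]
      have h1 := g.norm u hu
      have h2 : ‖(f u : ℂ)‖ ≤ 2 + 2 * u^2 := by nlinarith
      have h3 : Real.exp (-(x:ℂ).re * u) ≤ Real.exp (-1 * u) := by
        apply Real.exp_le_exp.mpr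
        simp
        nlinarith
      gcongr)
    (bound_int 1 one_pos)
    (by
      filter_upwards [ae_restrict_mem measurableSet_Ioi] with u hu
      rw [Set.mem_Ioi] at hu
      rw [← mul_zero (f u : ℂ)]
      refine Filter.Tendsto.const_mul _ ?_
      rw [tendsto_zero_iff_norm_tendsto_zero]
      simp only [exp_norm, Complex.ofReal_re]
      refine Real.tendsto_exp_atBot.comp ?_
      simp only [neg_mul]
      exact Filter.tendsto_neg_atTop_atBot.comp (Filter.tendsto_id.atTop_mul_const hu))
  simpa using this

lemma Good.P_lap {f : ℝ → ℝ} {κ : ℕ} (g : Good f κ) (s : ℂ) (hs : 0 < s.re) :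
    s * ∫ v in Set.Ioi (0:ℝ), ((1 + ∫ t in (1:ℝ)..v, f t : ℝ) : ℂ) * Complex.exp (-s * v)
      = 1 + ∫ u in Set.Ioi (0:ℝ), (f u : ℂ) * Complex.exp (-s * u) := by
  have hs0 : s ≠ 0 := by rintro rfl; simp at hs
  set P : ℝ → ℝ := fun v => 1 + ∫ t in (1:ℝ)..v, f t with hP
  have hPc : Continuous P := continuous_const.add g.Kcont
  have hPi : IntegrableOn (fun v : ℝ => (P v : ℂ) * Complex.exp (-s * v)) (Set.Ioi 0) := by
    refine lap_int (fun u => (P u : ℂ)) (by fun_prop) (fun u hu => ?_) s hs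
    have := g.Kb u
    rw [Complex.norm_real, Real.norm_of_nonneg (by simp only [hP]; linarith)]
    simp only [hP]
    nlinarith
  have hsub : Set.Ioi (1:ℝ) ⊆ Set.Ioi 0 := Set.Ioi_subset_Ioi zero_le_one
  have hF : ∫ u in Set.Ioi (0:ℝ), (f u : ℂ) * Complex.exp (-s * u)
      = ∫ u in Set.Ioi (1:ℝ), (f u : ℂ) * Complex.exp (-s * u) := by
    rw [← integral_Ici_eq_integral_Ioi (x := (1:ℝ))]
    refine setIntegral_eq_of_subset_of_forall_sdiff_eq_zero measurableSet_Ioi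
      (Set.Ici_subset_Ioi.mpr one_pos) ?_
    intro x hx
    rw [g.z x (by simpa using hx.2)]
    simp
  have hQ := integral_Ioi_of_hasDerivAt_of_tendsto (a := 1) (m := 0)
    (f := fun v : ℝ => (P v : ℂ) * Complex.exp (-s * v))
    (f' := fun v : ℝ => (f v : ℂ) * Complex.exp (-s * v) - s * ((P v : ℂ) * Complex.exp (-s * v)))
    (by fun_prop)
    (by
      intro v hv
      rw [Set.mem_Ioi] at hv
      have hca : ContinuousAt f v := g.cont.continuousAt (Ici_mem_nhds hv)
      have h1 : HasDerivAt P (f v) v :=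
        (intervalIntegral.integral_hasDerivAt_right (g.int v)
          g.meas.stronglyMeasurable.stronglyMeasurableAtFilter hca).const_add 1
      have h2 : HasDerivAt (fun v : ℝ => Complex.exp (-s * v)) (Complex.exp (-s * v) * (-s * 1)) v :=
        ((Complex.ofRealCLM.hasDerivAt).const_mul (-s)).cexp
      refine (h1.ofReal_comp.mul h2).congr_deriv ?_
      ring)
    (((g.lap1 s hs).mono_set hsub).sub ((hPi.mono_set hsub).const_mul s))
    (by
      rw [tendsto_zero_iff_norm_tendsto_zero]
      have t0 := tendsto_rpow_mul_exp_neg_mul_atTop_nhds_zero 0 s.re hs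
      have t2 := tendsto_rpow_mul_exp_neg_mul_atTop_nhds_zero 2 s.re hs
      have t := t0.add t2
      rw [add_zero] at t
      refine squeeze_zero (fun v => norm_nonneg _) (fun v => ?_) t
      have := g.Kb v
      rw [norm_mul, exp_norm, Complex.norm_real, Real.norm_of_nonneg (by simp only [hP]; linarith)]
      rw [← add_mul]
      refine mul_le_mul_of_nonneg_right ?_ (Real.exp_pos _).le
      simp [hP]
      exact this.2)
  rw [integral_sub ((g.lap1 s hs).mono_set hsub) ((hPi.mono_set hsub).const_mul s),
    integral_const_mul] at hQ
  have hsplit : ∫ v in Set.Ioi (0:ℝ), (P v : ℂ) * Complex.exp (-s * v)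
      = (∫ v in (0:ℝ)..1, Complex.exp (-s * v)) + ∫ v in Set.Ioi (1:ℝ), (P v : ℂ) * Complex.exp (-s * v) := by
    rw [← Set.Ioc_union_Ioi_eq_Ioi (zero_le_one (α := ℝ)), setIntegral_union (Set.Ioc_disjoint_Ioi le_rfl) measurableSet_Ioi
      (hPi.mono_set Set.Ioc_subset_Ioi_self) (hPi.mono_set hsub),
      intervalIntegral.integral_of_le zero_le_one]
    congr 1
    refine setIntegral_congr_fun measurableSet_Ioc fun v hv => ?_
    simp only [hP]
    rw [K_zero f g.z v hv.2]
    simp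
  rw [hsplit, integral_exp_mul_complex (neg_ne_zero.mpr hs0), hF]
  have hP1 : P 1 = 1 := by simp [hP]
  simp only [hP1] at hQ
  simp only [Complex.ofReal_one, Complex.ofReal_zero, mul_one, mul_zero, Complex.exp_zero, one_mul] at hQ ⊢
  have e : s * ((Complex.exp (-s) - 1) / (-s)) = 1 - Complex.exp (-s) := by
    field_simp
    ring
  rw [mul_add, e]
  linear_combination -hQ

lemma Good.ode {f : ℝ → ℝ} {κ : ℕ} (g : Good f κ) (s : ℂ) (hs : 0 < s.re) :
    s * ∫ u in Set.Ioi (0:ℝ), (f u : ℂ) * (Complex.exp (-s * u) * (-u)) =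
      - κ * Complex.exp (-s) * (1 + ∫ u in Set.Ioi (0:ℝ), (f u : ℂ) * Complex.exp (-s * u)) := by
  rw [← g.P_lap s hs]
  have hF : ∫ u in Set.Ioi (0:ℝ), (f u : ℂ) * (Complex.exp (-s * u) * (-u))
      = ∫ u in Set.Ioi (1:ℝ), (f u : ℂ) * (Complex.exp (-s * u) * (-u)) := by
    rw [← integral_Ici_eq_integral_Ioi (x := (1:ℝ))]
    refine setIntegral_eq_of_subset_of_forall_sdiff_eq_zero measurableSet_Ioi
      (Set.Ici_subset_Ioi.mpr one_pos) ?_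
    intro x hx
    rw [g.z x (by simpa using hx.2)]
    simp
  have hshift : ∫ u in Set.Ioi (1:ℝ), (f u : ℂ) * (Complex.exp (-s * u) * (-u))
      = ∫ v in Set.Ioi (0:ℝ), (f (v+1) : ℂ) * (Complex.exp (-s * (v+1 : ℝ)) * (-(v+1 : ℝ))) := by
    have := (measurePreserving_add_right (volume : Measure ℝ) 1).setIntegral_preimage_emb
      (MeasurableEquiv.addRight (1:ℝ)).measurableEmbedding
      (fun u : ℝ => (f u : ℂ) * (Complex.exp (-s * u) * (-u))) (Set.Ioi 1)
    rw [← this]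
    simp
  have : ∫ v in Set.Ioi (0:ℝ), (f (v+1) : ℂ) * (Complex.exp (-s * (v+1 : ℝ)) * (-(v+1 : ℝ)))
      = (- κ * Complex.exp (-s)) * ∫ v in Set.Ioi (0:ℝ), ((1 + ∫ t in (1:ℝ)..v, f t : ℝ) : ℂ) * Complex.exp (-s * v) := by
    rw [← integral_const_mul]
    refine setIntegral_congr_fun measurableSet_Ioi fun v hv => ?_
    rw [Set.mem_Ioi] at hv
    have h := g.eq (v+1) (by linarith)
    rw [add_sub_cancel_right] at h
    have h' : ((v+1 : ℝ) : ℂ) * (f (v+1) : ℂ) = κ * ((1 + ∫ t in (1:ℝ)..v, f t : ℝ) : ℂ) := by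
      rw [← Complex.ofReal_mul, h]; push_cast; ring
    have he : Complex.exp (-s * (v+1 : ℝ)) = Complex.exp (-s) * Complex.exp (-s * v) := by
      rw [← Complex.exp_add]; congr 1; push_cast; ring
    simp only [he]
    linear_combination (-Complex.exp (-s) * Complex.exp (-s * v)) * h'
  rw [hF, hshift, this]
  ring

lemma Good.final {f : ℝ → ℝ} {κ : ℕ} (g : Good f κ) (s : ℂ) (hs : 0 < s.re) :
    (1 + ∫ u in Set.Ioi (0:ℝ), (f u : ℂ) * Complex.exp (-s * u)) * s^κ * Complex.exp (-κ * Ein s) =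
      Complex.exp (-κ * (Real.eulerMascheroniConstant : ℂ)) := by
  set H : ℂ → ℂ := fun s => (1 + ∫ u in Set.Ioi (0:ℝ), (f u : ℂ) * Complex.exp (-s * u)) * s^κ * Complex.exp (-κ * Ein s) with hH
  have hd : ∀ s : ℂ, 0 < s.re → HasDerivAt H 0 s := by
    intro s hs
    have hs0 : s ≠ 0 := by rintro rfl; simp at hs
    have h1 := (g.lap_deriv s hs).const_add 1
    have h2 := hasDerivAt_pow κ s
    have h3 := ((Ein_hasDerivAt s hs).const_mul (-(κ:ℂ))).cexp
    refine ((h1.mul h2).mul h3).congr_deriv ?_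
    have ho := g.ode s hs
    have hp : (κ:ℂ) * s^(κ-1) = κ * s^κ / s := by
      rcases Nat.eq_zero_or_pos κ with h | h
      · simp [h]
      · rw [eq_div_iff hs0, mul_assoc, ← pow_succ, Nat.sub_add_cancel h]
    simp only [hp, Pi.mul_apply]
    have ho' := eq_div_of_mul_eq hs0 ((mul_comm _ _).trans ho)
    rw [ho']
    field_simp
    ring
  have hopen : IsOpen {z : ℂ | 0 < z.re} := isOpen_lt continuous_const Complex.continuous_re
  have hconv : Convex ℝ {z : ℂ | 0 < z.re} := convex_halfSpace_re_gt 0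
  have hconst : ∀ x : ℝ, 0 < x → H x = H s := fun x hx =>
    hopen.is_const_of_deriv_eq_zero hconv.isPreconnected
      (fun z hz => (hd z hz).differentiableAt.differentiableWithinAt)
      (fun z hz => (hd z hz).deriv) (by simpa using hx) hs
  have hl1 : Filter.Tendsto (fun x : ℝ => H x) Filter.atTop (nhds (H s)) := by
    refine tendsto_const_nhds.congr' ?_
    filter_upwards [Filter.eventually_gt_atTop 0] with x hx
    exact (hconst x hx).symm
  have hl2 : Filter.Tendsto (fun x : ℝ => H x) Filter.atTop
      (nhds ((1 + 0) * Complex.exp (-κ * (Real.eulerMascheroniConstant : ℂ)))) := by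
    have a := (Complex.continuous_exp.tendsto _).comp
      (((Complex.continuous_ofReal.tendsto _).comp Ein_limit).const_mul (-(κ:ℂ)))
    refine ((g.lap_zero.const_add 1).mul a).congr' ?_
    filter_upwards [Filter.eventually_gt_atTop 0] with x hx
    simp only [hH, Function.comp]
    rw [Ein_real x hx, mul_assoc]
    congr 1
    have hx' : (x:ℂ) = Complex.exp (Real.log x) := by
      rw [← Complex.ofReal_exp, Real.exp_log hx]
    have hxk : (x:ℂ)^κ = Complex.exp (κ * Real.log x) := by
      rw [Complex.exp_nat_mul, ← hx']
    rw [hxk, ← Complex.exp_add]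
    congr 1
    push_cast
    ring
  have := tendsto_nhds_unique hl1 hl2
  rw [add_zero, one_mul] at this
  exact this

lemma Good.final' {f : ℝ → ℝ} {κ : ℕ} (g : Good f κ) (s : ℂ) (hs : 0 < s.re) :
    1 + ∫ u in Set.Ioi (0:ℝ), (f u : ℂ) * Complex.exp (-s * u) =
      (s^κ)⁻¹ * Complex.exp (-κ * (Real.eulerMascheroniConstant : ℂ) + κ * Ein s) := by
  have hs0 : s ≠ 0 := by rintro rfl; simp at hs
  have hsk : s^κ ≠ 0 := pow_ne_zero _ hs0
  rw [Complex.exp_add, ← g.final s hs]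
  have : Complex.exp (-κ * Ein s) * Complex.exp (κ * Ein s) = 1 := by
    rw [← Complex.exp_add]; simp
  rw [mul_assoc _ (Complex.exp (-κ * Ein s)), this]
  field_simp

theorem xi_laplace_transform (ξ ω : ℝ → ℝ)
    (hξ0 : ∀ u : ℝ, u < 1 → ξ u = 0)
    (hξ : ∀ u : ℝ, 1 ≤ u → u * ξ u = 2 + 2 * ∫ t in (1:ℝ)..(u - 1), ξ t)
    (hω0 : ∀ u : ℝ, u < 1 → ω u = 0)
    (hω : ∀ u : ℝ, 1 ≤ u → u * ω u = 1 + ∫ t in (1:ℝ)..(u - 1), ω t) :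
    ∀ s : ℂ, 0 < s.re →
      IntegrableOn (fun u : ℝ => (ξ u : ℂ) * Complex.exp (-s * u)) (Set.Ioi 0) ∧
      IntegrableOn (fun u : ℝ => (ω u : ℂ) * Complex.exp (-s * u)) (Set.Ioi 0) ∧
      1 + (∫ u in Set.Ioi (0:ℝ), (ξ u : ℂ) * Complex.exp (-s * u)) =
        s ^ (-2 : ℤ) *
          Complex.exp (-2 * (Real.eulerMascheroniConstant : ℂ) +
            2 * ∫ r in (0:ℝ)..1, ((1 - Complex.exp (-(r * s))) / (r * s)) * s) ∧
      s ^ (-2 : ℤ) *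
          Complex.exp (-2 * (Real.eulerMascheroniConstant : ℂ) +
            2 * ∫ r in (0:ℝ)..1, ((1 - Complex.exp (-(r * s))) / (r * s)) * s) =
        (1 + ∫ u in Set.Ioi (0:ℝ), (ω u : ℂ) * Complex.exp (-s * u)) ^ 2 := by
  intro s hs
  have gx : Good ξ 2 := good_of ξ 2 le_rfl hξ0 (by simpa using hξ)
  have gw : Good ω 1 := good_of ω 1 (by norm_num) hω0 (by simpa using hω)
  have hx := gx.final' s hs
  have hw := gw.final' s hs
  have hz : s ^ (-2 : ℤ) = (s ^ 2)⁻¹ := by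
    rw [zpow_neg]; norm_cast
  refine ⟨gx.lap1 s hs, gw.lap1 s hs, ?_, ?_⟩
  · rw [hx, hz]
    push_cast
    rfl
  · rw [hw, hz]
    change _ * Complex.exp (_ + 2 * Ein s) = _
    rw [mul_pow, ← Complex.exp_nat_mul]
    congr 1
    · simp
    · congr 1
      push_cast
      ring
end

section
/- There is an absolute constant C such that, uniformly for all real x ≥ 1 and y ≥ 2, with u = log x / log y, one has | Σ_{n ≤ x, P^-(n) > y} 1/n − 1 − (log x) ∏_{p ≤ y, p prime} (1 − 1/p) − ∫₀^u (ω(v) − e^{−γ}) dv | ≤ C / log y. -/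
open Real MeasureTheory

/-- `∏_{p ≤ y, p prime} (1 - 1/p)`. -/
noncomputable def primeProd (y : ℝ) : ℝ :=
  ∏ p ∈ (Finset.range (⌊y⌋₊ + 1)).filter Nat.Prime, (1 - 1 / (p : ℝ))

/-- `∑_{n ≤ x, P⁻(n) > y} 1/n`, where `n = 1` is included since `P⁻(1) = ∞`. -/
noncomputable def roughHarmonic (x y : ℝ) : ℝ :=
  ∑ n ∈ (Finset.Icc 1 ⌊x⌋₊).filter (fun n => n = 1 ∨ y < (n.minFac : ℝ)), (1 / (n : ℝ))


theorem int_zero (f : ℝ → ℝ) (h0 : ∀ u < 1, f u = 0) (u a : ℝ) (hu : u ≤ 1) (ha : a ≤ 1) :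
    ∫ v in a..u, f v = 0 := by
  apply intervalIntegral.integral_zero_ae
  filter_upwards [(Set.finite_singleton (1:ℝ)).countable.ae_notMem volume] with v hv hv2
  apply h0
  have : v ≤ max a u := (Set.mem_uIoc.1 hv2).elim (fun h => h.2.trans (le_max_right _ _))
    (fun h => h.2.trans (le_max_left _ _))
  exact lt_of_le_of_ne (this.trans (max_le ha hu)) hv

/-- stability lemma -/
theorem stab (D : ℝ → ℝ) (ε : ℝ) (hε : 0 ≤ ε)
    (hint : ∀ a b : ℝ, IntervalIntegrable D volume a b)
    (hrc : ∀ u : ℝ, ContinuousWithinAt D (Set.Ici u) u)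
    (h0 : ∀ u < 1, D u = 0)
    (hE : ∀ u : ℝ, 1 ≤ u →
      |u * D u - (∫ v in (0:ℝ)..u, D v) - ∫ v in (0:ℝ)..(u-1), D v| ≤ ε * u) :
    ∃ c : ℝ, ∀ u : ℝ, 0 ≤ u → |D u - c * u| ≤ 17 * ε := by
  set F : ℝ → ℝ := fun u => ∫ v in (0:ℝ)..u, D v with hF
  have hFd : ∀ u, HasDerivWithinAt F (D u) (Set.Ici u) u := by
    intro u
    apply intervalIntegral.integral_hasDerivWithinAt_right (hint 0 u) (t := Set.Ioi u)
    · exact ⟨Set.Ioc (u-1) (u+1), mem_nhdsWithin_of_mem_nhds (Ioc_mem_nhds (by linarith) (by linarith)),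
        (hint (u-1) (u+1)).aestronglyMeasurable⟩
    · exact (hrc u).mono Set.Ioi_subset_Ici_self
  have hFc : Continuous F := intervalIntegral.continuous_primitive hint 0
  have hF1 : ∀ u ≤ 1, F u = 0 := by
    exact fun u hu => int_zero D h0 u 0 hu zero_le_one
  set P : ℝ → ℝ := fun u => u^2/2 + u + 1/4 with hP
  have hPpos : ∀ u, 0 ≤ u → 0 < P u := fun u hu => by simp only [hP]; positivity
  set G : ℝ → ℝ := fun u => F u / P u with hG
  set g : ℝ → ℝ := fun u => (D u * P u - F u * (u + 1)) / (P u)^2 with hg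
  have hPd : ∀ u, HasDerivAt P (u+1) u := by
    intro u
    have := (((hasDerivAt_id u).pow 2).div_const 2).add (hasDerivAt_id u) |>.add_const (1/4)
    refine this.congr_deriv ?_
    simp
  have hGd : ∀ u, 0 ≤ u → HasDerivWithinAt G (g u) (Set.Ici u) u := by
    intro u hu
    exact (hFd u).div (hPd u).hasDerivWithinAt (hPpos u hu).ne'
  have hGc : ContinuousOn G (Set.Ici 0) := by
    apply hFc.continuousOn.div
    · exact fun u _ => (hPd u).continuousAt.continuousWithinAt
    · exact fun u hu => (hPpos u hu).ne'
  have hG1 : ∀ u ≤ 1, G u = 0 := fun u hu => by simp [hG, hF1 u hu]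
  set E : ℝ → ℝ := fun u => u * D u - F u - F (u-1) with hEdef
  have hE' : ∀ u, 1 ≤ u → |E u| ≤ ε * u := hE
  have hgeq : ∀ u, 1 ≤ u → u * P u * g u = P (u-1) * (G (u-1) - G u) + E u := by
    intro u hu
    have h1 := (hPpos u (by linarith)).ne'
    have h2 := (hPpos (u-1) (by linarith)).ne'
    have h3 : P u + P (u-1) = u * (u+1) := by simp only [hP]; ring
    have e1 : P (u-1) * G (u-1) = F (u-1) := by simp only [hG]; field_simp
    have e2 : G u * P u = F u := by simp only [hG]; field_simp
    have e3 : P u * g u = D u - G u * (u+1) := by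
      simp only [hg, hG]; field_simp
    have : u * P u * g u = u * (P u * g u) := by ring
    rw [this, e3]
    simp only [hEdef]
    linear_combination -e2 - e1 + G u * h3
  -- increments
  have hinc : ∀ M a b : ℝ, 1 ≤ a → a ≤ b → (∀ v, a ≤ v → v ≤ b → |g v| ≤ M / v^2) →
      |G b - G a| ≤ M * (1/a - 1/b) := by
    intro M a b ha hab hb
    have := image_norm_le_of_norm_deriv_right_le_deriv_boundary' (f := fun u => G u - G a)
      (f' := g) (a := a) (b := b) (B := fun u => M * (1/a - u⁻¹)) (B' := fun u => M / u^2)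
      ((hGc.mono (fun x hx => Set.mem_Ici.2 (by linarith [hx.1]))).sub continuousOn_const)
      (fun x hx => (hGd x (by linarith [hx.1])).sub_const _) (by simp)
      (continuousOn_const.mul (continuousOn_const.sub (continuousOn_id.inv₀
        (fun x hx => by have := hx.1; simp only [id]; linarith))))
      (fun x hx => by
        have hx0 : x ≠ 0 := by have := hx.1; linarith
        refine ((((hasDerivAt_inv hx0).const_sub (1/a)).const_mul M).congr_deriv ?_).hasDerivWithinAt
        field_simp)
      (fun x hx => hb x hx.1 hx.2.le) (x := b) ⟨hab, le_rfl⟩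
    simpa using this
  have hinc2 : ∀ M u : ℝ, 0 ≤ M → 1 ≤ u → (∀ v, 1 ≤ v → v ≤ u → |g v| ≤ M / v^2) →
      |g u| ≤ (M/2 + 2*ε) / u^2 := by
    intro M u hM hu hb
    have hP1 := hPpos u (by linarith)
    have hP2 := hPpos (u-1) (by linarith)
    have key : P (u-1) * |G (u-1) - G u| ≤ M / 2 * (P u / u) := by
      rcases le_total u 2 with h2 | h2
      · have h := hinc M 1 u le_rfl hu hb
        rw [hG1 1 le_rfl] at h
        rw [hG1 (u-1) (by linarith), zero_sub, abs_neg]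
        rw [sub_zero] at h
        calc P (u-1) * |G u| ≤ P (u-1) * (M * (1/1 - 1/u)) := by gcongr
          _ = M * (P (u-1) * (u-1)) / u := by field_simp
          _ ≤ M * (P u / 2) / u := by
            gcongr
            simp only [hP]
            nlinarith [mul_nonneg (sub_nonneg.2 hu) (sub_nonneg.2 h2),
              mul_nonneg (mul_nonneg (sub_nonneg.2 hu) (sub_nonneg.2 h2)) (sub_nonneg.2 hu)]
          _ = _ := by ring
      · have h := hinc M (u-1) u (by linarith) (by linarith)
          (fun v hv hv' => hb v (by linarith) hv')
        rw [abs_sub_comm]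
        have hu1 : 0 < u - 1 := by linarith
        calc P (u-1) * |G u - G (u-1)| ≤ P (u-1) * (M * (1/(u-1) - 1/u)) := by gcongr
          _ = M * (P (u-1) / (u-1)) / u := by field_simp; ring
          _ ≤ M * (P u / 2) / u := by
            have : P (u-1) / (u-1) ≤ P u / 2 := by
              rw [div_le_iff₀ hu1]
              simp only [hP]
              nlinarith [mul_nonneg (sub_nonneg.2 h2) (sub_nonneg.2 h2),
                mul_nonneg (mul_nonneg (sub_nonneg.2 h2) (sub_nonneg.2 h2)) (sub_nonneg.2 h2)]
            gcongr
          _ = _ := by ring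
    have h4 : u * P u * |g u| ≤ M / 2 * (P u / u) + ε * u := by
      have : u * P u * |g u| = |u * P u * g u| := by
        rw [abs_mul, abs_of_pos (by positivity : 0 < u * P u)]
      rw [this, hgeq u hu]
      refine (abs_add_le _ _).trans (add_le_add ?_ (hE' u hu))
      rw [abs_mul, abs_of_pos hP2]; exact key
    have h5 : ε * u ≤ 2 * ε * (P u / u) := by
      rw [mul_div_assoc', le_div_iff₀ (by linarith)]
      simp only [hP]
      nlinarith [mul_nonneg hε (by linarith : (0:ℝ) ≤ u)]
    have h6 : u * P u * |g u| ≤ (M/2 + 2*ε) * (P u / u) := by linarith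
    rw [le_div_iff₀ (by positivity)]
    have h7 : u * P u * |g u| = (P u / u) * (|g u| * u^2) := by field_simp
    rw [h7, mul_comm (M/2+2*ε)] at h6
    exact le_of_mul_le_mul_left h6 (by positivity)
  have hgb : ∀ u, 1 ≤ u → |g u| ≤ 4 * ε / u^2 := by
    intro T hT
    obtain ⟨B, hB⟩ : ∃ B, ∀ u ∈ Set.Icc (0:ℝ) T, |G u| ≤ B := by
      obtain ⟨B, hB⟩ := isCompact_Icc.exists_bound_of_continuousOn
        (hGc.mono (fun x (hx : x ∈ Set.Icc (0:ℝ) T) => hx.1))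
      exact ⟨B, hB⟩
    set S := (fun v => v^2 * |g v|) '' Set.Icc 1 T with hS
    have hbd : BddAbove S := by
      refine ⟨(4 * P T * B + 4 * ε * T) * T^2, ?_⟩
      rintro _ ⟨v, hv, rfl⟩
      have hv1 := hv.1
      have hv2 := hv.2
      have b1 := hB v ⟨by linarith, hv2⟩
      have b2 := hB (v-1) ⟨by linarith, by linarith⟩
      have hB0 : 0 ≤ B := (abs_nonneg _).trans b1
      have hPm : P (v-1) ≤ P T := by simp only [hP]; nlinarith
      have h1 : v * P v * |g v| ≤ P T * (2 * B) + ε * T := by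
        have : v * P v * |g v| = |v * P v * g v| := by
          rw [abs_mul, abs_of_pos (mul_pos (by linarith) (hPpos v (by linarith)))]
        rw [this, hgeq v hv1]
        refine (abs_add_le _ _).trans (add_le_add ?_ ((hE' v hv1).trans (by gcongr)))
        rw [abs_mul, abs_of_pos (hPpos (v-1) (by linarith))]
        have : |G (v-1) - G v| ≤ 2 * B := (abs_sub _ _).trans (by linarith)
        have := hPpos T (by linarith)
        gcongr
      have h2 : 1 ≤ v * P v := by simp only [hP]; nlinarith [mul_nonneg (by linarith : 0 ≤ v) (sq_nonneg v)]
      have h3 : |g v| ≤ v * P v * |g v| := le_mul_of_one_le_left (abs_nonneg _) h2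
      have h4 : |g v| ≤ 4 * P T * B + 4 * ε * T := by
        have := (hPpos T (by linarith)).le
        have := mul_nonneg this hB0
        have := mul_nonneg hε (by linarith : 0 ≤ T)
        linarith
      have : v^2 ≤ T^2 := by gcongr
      calc v^2 * |g v| = |g v| * v^2 := by ring
        _ ≤ _ := by
          apply mul_le_mul h4 this (by positivity) ((abs_nonneg _).trans h4)
    set M := sSup S with hM
    have hMle : ∀ v, 1 ≤ v → v ≤ T → v^2 * |g v| ≤ M := fun v h1 h2 =>
      le_csSup hbd ⟨v, ⟨h1, h2⟩, rfl⟩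
    have hM0 : 0 ≤ M := le_trans (by positivity) (hMle 1 le_rfl hT)
    have hM2 : M ≤ M/2 + 2*ε := by
      apply csSup_le ((Set.nonempty_Icc.2 hT).image _)
      rintro _ ⟨v, hv, rfl⟩
      have hv0 : 0 < v := by linarith [hv.1]
      have := hinc2 M v hM0 hv.1 (fun w hw hw' => by
        rw [le_div_iff₀ (by positivity)]
        have := hMle w hw (hw'.trans hv.2); linarith)
      rw [le_div_iff₀ (by positivity)] at this
      simp only; linarith
    rw [le_div_iff₀ (by positivity)]
    have := hMle T hT le_rfl
    linarith
  have hinc4 : ∀ a b : ℝ, 1 ≤ a → a ≤ b → |G b - G a| ≤ 4 * ε / a := by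
    intro a b ha hab
    have := hinc (4*ε) a b ha hab (fun v hv _ => hgb v (by linarith))
    refine this.trans ?_
    have : 0 ≤ 1 / b := by have : 0 ≤ b := by linarith
                           positivity
    calc 4 * ε * (1/a - 1/b) ≤ 4 * ε * (1/a) := by gcongr; linarith
      _ = _ := by ring
  obtain ⟨c, hc⟩ : ∃ c, ∀ a, 1 ≤ a → |c - G a| ≤ 4 * ε / a := by
    have hcs : CauchySeq (fun n : ℕ => G ((n:ℝ)+1)) := by
      apply cauchySeq_of_le_tendsto_0' (fun n : ℕ => 4 * ε / ((n:ℝ)+1))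
      · intro n m hnm
        rw [dist_comm, Real.dist_eq]
        exact hinc4 _ _ (by simp) (by simpa using hnm)
      · have := (tendsto_one_div_add_atTop_nhds_zero_nat (𝕜 := ℝ)).const_mul (4*ε)
        simpa [div_eq_mul_inv] using this
    obtain ⟨c, hc⟩ := cauchySeq_tendsto_of_complete hcs
    refine ⟨c, fun a ha => ?_⟩
    have h1 : Filter.Tendsto (fun n : ℕ => |G ((n:ℝ)+1) - G a|) Filter.atTop (nhds |c - G a|) :=
      (hc.sub_const _).abs
    refine le_of_tendsto h1 ?_
    filter_upwards [Filter.eventually_ge_atTop ⌈a⌉₊] with n hn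
    exact hinc4 a _ ha (by have := Nat.ceil_le.1 hn; linarith)
  have hc0 : |c| ≤ 4 * ε := by
    have := hc 1 le_rfl
    rw [hG1 1 le_rfl] at this
    simpa using this
  refine ⟨c, fun u hu => ?_⟩
  rcases lt_or_ge u 1 with h1 | h1
  · rw [h0 u h1, zero_sub, abs_neg, abs_mul, abs_of_nonneg hu]
    nlinarith [abs_nonneg c]
  · have hP1 := hPpos u (by linarith)
    have hP2 := hPpos (u-1) (by linarith)
    have e1 : P (u-1) * G (u-1) = F (u-1) := by simp only [hG]; field_simp
    have e2 : P u * G u = F u := by simp only [hG]; field_simp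
    have h3 : P u + P (u-1) = u * (u+1) := by simp only [hP]; ring
    have b1 : P u * |c - G u| ≤ 8 * ε * u := by
      calc P u * |c - G u| ≤ (2 * u^2) * (4 * ε / u) := by
            apply mul_le_mul _ (hc u h1) (abs_nonneg _) (by positivity)
            simp only [hP]; nlinarith
        _ = _ := by field_simp; ring
    have b2 : P (u-1) * |c - G (u-1)| ≤ 4 * ε * u := by
      rcases lt_or_ge u 2 with h2 | h2
      · rw [hG1 (u-1) (by linarith), sub_zero]
        calc P (u-1) * |c| ≤ u * (4 * ε) := by
              apply mul_le_mul _ hc0 (abs_nonneg _) (by positivity)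
              simp only [hP]; nlinarith
          _ = _ := by ring
      · have hu1 : 0 < u - 1 := by linarith
        calc P (u-1) * |c - G (u-1)| ≤ (u * (u-1)) * (4 * ε / (u-1)) := by
              apply mul_le_mul _ (hc _ (by linarith)) (abs_nonneg _) (by positivity)
              simp only [hP]; nlinarith
          _ = _ := by field_simp
    have h5 : u * (D u - c * u) = u * c + E u - P u * (c - G u) - P (u-1) * (c - G (u-1)) := by
      simp only [hEdef]
      linear_combination - c * h3 - e1 - e2
    have h6 : |u * (D u - c * u)| ≤ u * (17 * ε) := by
      rw [h5]
      have t1 := abs_sub (u * c + E u - P u * (c - G u)) (P (u-1) * (c - G (u-1)))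
      have t2 := abs_sub (u * c + E u) (P u * (c - G u))
      have t3 := abs_add_le (u * c) (E u)
      rw [abs_mul (P (u-1)), abs_of_pos hP2] at t1
      rw [abs_mul (P u), abs_of_pos hP1] at t2
      rw [abs_mul u c, abs_of_nonneg hu] at t3
      have := hE' u h1
      have : u * |c| ≤ u * (4 * ε) := by gcongr
      linarith
    rw [abs_mul, abs_of_nonneg hu] at h6
    exact le_of_mul_le_mul_left h6 (by linarith)

theorem om_cont (ω : ℝ → ℝ)
    (hω0 : ∀ u : ℝ, u < 1 → ω u = 0)
    (hω : ∀ u : ℝ, 1 ≤ u → u * ω u = 1 + ∫ t in (1:ℝ)..(u - 1), ω t) (n : ℕ) :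
    ContinuousOn ω (Set.Icc 1 (n+2)) ∧ ∀ u ∈ Set.Icc (1:ℝ) (n+2), 0 ≤ ω u ∧ ω u ≤ 1 := by
  have h12 : ∀ u, 1 ≤ u → u ≤ 2 → ω u = 1 / u := by
    intro u h1 h2
    have := hω u h1
    rw [int_zero ω hω0 _ _ (by linarith) le_rfl, add_zero] at this
    rw [eq_div_iff (by linarith), mul_comm, this]
  induction n with
  | zero =>
    constructor
    · have : ContinuousOn (fun u : ℝ => 1 / u) (Set.Icc 1 ((0:ℕ)+2)) :=
        continuousOn_const.div continuousOn_id (fun x hx => by have := hx.1; intro h; linarith [show x = 0 from h])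
      exact this.congr (fun u hu => h12 u hu.1 (by simpa using hu.2))
    · intro u hu
      rw [h12 u hu.1 (by simpa using hu.2)]
      have : 0 < u := by linarith [hu.1]
      exact ⟨by positivity, by rw [div_le_one this]; exact hu.1⟩
  | succ n ih =>
    obtain ⟨ih1, ih2⟩ := ih
    have hn : (0:ℝ) ≤ n := Nat.cast_nonneg n
    have heq : ∀ u ∈ Set.Icc (1:ℝ) ((n+1:ℕ)+2), ω u =
        (1 + ∫ t in (1:ℝ)..(max (u - 1) 1), ω t) / u := by
      intro u hu
      rw [eq_div_iff (by linarith [hu.1]), mul_comm, hω u hu.1]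
      rcases le_total (u-1) 1 with h | h
      · rw [max_eq_right h, int_zero ω hω0 _ _ h le_rfl, intervalIntegral.integral_same]
      · rw [max_eq_left h]
    have hii : ∀ b ∈ Set.Icc (1:ℝ) (n+2), IntervalIntegrable ω volume 1 b := by
      intro b hb
      apply ContinuousOn.intervalIntegrable
      rw [Set.uIcc_of_le hb.1]
      exact ih1.mono (Set.Icc_subset_Icc_right hb.2)
    constructor
    · refine ContinuousOn.congr (ContinuousOn.div (ContinuousOn.add continuousOn_const ?_)
        continuousOn_id (fun x hx => by have := hx.1; intro h; linarith [show x = 0 from h])) heq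
      have hp : ContinuousOn (fun x => ∫ t in (1:ℝ)..x, ω t) (Set.Icc 1 (n+2)) := by
        have := intervalIntegral.continuousOn_primitive_interval' (hii (n+2) ⟨by linarith, le_rfl⟩)
          (a := 1) (by simp)
        rwa [Set.uIcc_of_le (by linarith)] at this
      refine hp.comp (by fun_prop) ?_
      intro u hu
      have := hu.2
      push_cast at this
      exact ⟨le_max_right _ _, max_le (by linarith) (by linarith)⟩
    · intro u hu
      rw [heq u hu]
      have hu0 : 0 < u := by linarith [hu.1]
      have h2 := hu.2
      push_cast at h2
      set b := max (u-1) 1 with hb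
      have hb1 : 1 ≤ b := le_max_right _ _
      have hb2 : b ≤ n + 2 := max_le (by linarith) (by linarith)
      have hbu : b ≤ u := max_le (by linarith) hu.1
      have i0 : 0 ≤ ∫ t in (1:ℝ)..b, ω t := intervalIntegral.integral_nonneg hb1
        (fun t ht => (ih2 t ⟨ht.1, ht.2.trans hb2⟩).1)
      have i1 : ∫ t in (1:ℝ)..b, ω t ≤ b - 1 := by
        have := intervalIntegral.integral_mono_on hb1 (hii b ⟨hb1, hb2⟩)
          (intervalIntegrable_const (c := (1:ℝ)))
          (fun t ht => (ih2 t ⟨ht.1, ht.2.trans hb2⟩).2)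
        simpa using this
      exact ⟨by positivity, by rw [div_le_one hu0]; linarith⟩

/-- facts about σ(u) = 1 + ∫₀ᵘ ω -/
theorem sig_facts (ω : ℝ → ℝ)
    (hω0 : ∀ u : ℝ, u < 1 → ω u = 0)
    (hω : ∀ u : ℝ, 1 ≤ u → u * ω u = 1 + ∫ t in (1:ℝ)..(u - 1), ω t)
    (σ : ℝ → ℝ) (hσ : σ = fun u => 1 + ∫ t in (0:ℝ)..u, ω t) :
    (∀ u, 0 ≤ ω u ∧ ω u ≤ 1) ∧ (∀ a b, IntervalIntegrable ω volume a b) ∧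
    ContinuousOn ω (Set.Ici 1) ∧ Continuous σ ∧ (∀ u ≤ 1, σ u = 1) ∧
    (∀ u, 1 ≤ u → u * ω u = σ (u-1)) ∧
    (∀ u, 1 ≤ u → HasDerivWithinAt σ (ω u) (Set.Ici u) u) ∧
    (∀ u, 1 < u → HasDerivAt σ (ω u) u) ∧
    (∀ u, 1 ≤ u → u * σ u - (∫ t in (0:ℝ)..u, σ t) - (∫ t in (0:ℝ)..(u-1), σ t) = 0) ∧
    (∀ u, 0 ≤ u → 0 ≤ σ u ∧ σ u ≤ u + 1) := by
  have h1 : ∀ u, 0 ≤ ω u ∧ ω u ≤ 1 := by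
    intro u
    rcases lt_or_ge u 1 with h | h
    · simp [hω0 u h]
    · exact (om_cont ω hω0 hω ⌈u⌉₊).2 u ⟨h, by linarith [Nat.le_ceil u]⟩
  have h3' : ∀ u, 1 ≤ u → ContinuousWithinAt ω (Set.Ici 1) u := by
    intro u hu
    have := (om_cont ω hω0 hω ⌈u⌉₊).1 u ⟨hu, by linarith [Nat.le_ceil u]⟩
    apply this.mono_of_mem_nhdsWithin
    rw [← Set.Ici_inter_Iic]
    exact Filter.inter_mem self_mem_nhdsWithin (mem_nhdsWithin_of_mem_nhds
      (Iic_mem_nhds (by linarith [Nat.le_ceil u])))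
  have h3 : ContinuousOn ω (Set.Ici 1) := fun u hu => h3' u hu
  have h2 : ∀ a b, IntervalIntegrable ω volume a b := by
    have hc : Continuous (fun u => ω (max u 1)) := by
      rw [← continuousOn_univ]
      exact h3.comp (by fun_prop) (fun u _ => Set.mem_Ici.2 (le_max_right _ _))
    have he : ω = (Set.Ici 1).indicator (fun u => ω (max u 1)) := by
      ext u
      rcases lt_or_ge u 1 with h | h
      · rw [Set.indicator_of_notMem (by simpa using h), hω0 u h]
      · rw [Set.indicator_of_mem (by simpa using h), max_eq_left h]
    intro a b
    rw [he, intervalIntegrable_iff]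
    exact (intervalIntegrable_iff.1 (hc.intervalIntegrable a b)).indicator measurableSet_Ici
  have h4 : Continuous σ := by
    rw [hσ]; exact continuous_const.add (intervalIntegral.continuous_primitive h2 0)
  have h5 : ∀ u ≤ 1, σ u = 1 := by
    intro u hu
    rw [hσ]; simp only; rw [int_zero ω hω0 u 0 hu zero_le_one, add_zero]
  have h6 : ∀ u, 1 ≤ u → u * ω u = σ (u-1) := by
    intro u hu
    rw [hω u hu, hσ]; simp only
    rw [← intervalIntegral.integral_add_adjacent_intervals (h2 0 1) (h2 1 (u-1)),
      int_zero ω hω0 1 0 le_rfl zero_le_one, zero_add]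
  have h7 : ∀ u, 1 ≤ u → HasDerivWithinAt σ (ω u) (Set.Ici u) u := by
    intro u hu
    rw [hσ]
    apply HasDerivWithinAt.const_add
    apply intervalIntegral.integral_hasDerivWithinAt_right (h2 0 u) (t := Set.Ioi u)
    · exact ⟨Set.Ioc (u-1) (u+1), mem_nhdsWithin_of_mem_nhds
        (Ioc_mem_nhds (by linarith) (by linarith)), (h2 (u-1) (u+1)).aestronglyMeasurable⟩
    · exact (h3 u hu).mono (fun x hx => Set.mem_Ici.2 (hu.trans (le_of_lt hx)))
  have h8 : ∀ u, 1 < u → HasDerivAt σ (ω u) u := by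
    intro u hu
    rw [hσ]
    apply HasDerivAt.const_add
    apply intervalIntegral.integral_hasDerivAt_right (h2 0 u)
    · exact ⟨Set.Ioc (u-1) (u+1), 
        (Ioc_mem_nhds (by linarith) (by linarith)), (h2 (u-1) (u+1)).aestronglyMeasurable⟩
    · exact (h3 u hu.le).continuousAt (Ici_mem_nhds hu)
  have hi : ∀ u, HasDerivAt (fun u => ∫ t in (0:ℝ)..u, σ t) (σ u) u := fun u =>
    intervalIntegral.integral_hasDerivAt_right (h4.intervalIntegrable _ _)
      h4.stronglyMeasurable.stronglyMeasurableAtFilter h4.continuousAt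
  refine ⟨h1, h2, h3, h4, h5, h6, h7, h8, ?_, ?_⟩
  · intro u hu
    set f : ℝ → ℝ := fun u => u * σ u - (∫ t in (0:ℝ)..u, σ t) - (∫ t in (0:ℝ)..(u-1), σ t) with hf
    have hd : ∀ x ∈ Set.Ico 1 u, HasDerivWithinAt f 0 (Set.Ici x) x := by
      intro x hx
      have hi2 := (hi (x-1)).comp x ((hasDerivAt_id x).sub_const 1)
      have := (((hasDerivWithinAt_id x (Set.Ici x)).mul (h7 x hx.1)).sub
        (hi x).hasDerivWithinAt).sub hi2.hasDerivWithinAt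
      refine this.congr_deriv ?_
      simp only [id]
      linarith [h6 x hx.1]
    have hcf : Continuous f := by
      have hc : Continuous (fun u => ∫ t in (0:ℝ)..u, σ t) :=
        continuous_iff_continuousAt.2 (fun u => (hi u).continuousAt)
      exact ((continuous_id.mul h4).sub hc).sub (hc.comp (continuous_id.sub continuous_const))
    have := constant_of_has_deriv_right_zero hcf.continuousOn hd u ⟨hu, le_rfl⟩
    rw [show u * σ u - (∫ t in (0:ℝ)..u, σ t) - (∫ t in (0:ℝ)..(u-1), σ t) = f u from rfl, this]
    simp only [hf, sub_self, intervalIntegral.integral_same, sub_zero, one_mul]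
    rw [h5 1 le_rfl, intervalIntegral.integral_congr (g := fun _ => (1:ℝ))]
    · simp
    · intro x hx
      rw [Set.uIcc_of_le zero_le_one] at hx
      exact h5 x hx.2
  · intro u hu
    rw [hσ]
    simp only
    have i0 : 0 ≤ ∫ t in (0:ℝ)..u, ω t := intervalIntegral.integral_nonneg hu (fun t _ => (h1 t).1)
    have i1 : ∫ t in (0:ℝ)..u, ω t ≤ u := by
      have := intervalIntegral.integral_mono_on hu (h2 0 u)
        (intervalIntegrable_const (c := (1:ℝ))) (fun t _ => (h1 t).2)
      simpa using this
    constructor <;> linarith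

open ArithmeticFunction in
theorem mertens1 : ∃ K : ℝ, ∀ z : ℝ, 1 ≤ z →
    |∑ d ∈ Finset.Ioc 0 ⌊z⌋₊, vonMangoldt d / d - Real.log z| ≤ K := by
  refine ⟨Real.log 4 + 4 + 1, fun z hz => ?_⟩
  set N := ⌊z⌋₊ with hN
  have hN1 : 1 ≤ N := Nat.one_le_floor_iff _ |>.2 hz
  have hN0 : (0:ℝ) < N := by exact_mod_cast hN1
  have hNz : (N:ℝ) ≤ z := Nat.floor_le (by linarith)
  have hzN : z < N + 1 := Nat.lt_floor_add_one z
  set L := ∑ d ∈ Finset.Ioc 0 N, vonMangoldt d / d with hL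
  have hfac : Real.log (N.factorial) = ∑ d ∈ Finset.Ioc 0 N, vonMangoldt d * ((N / d : ℕ) : ℝ) := by
    have h1 := sum_Ioc_mul_zeta_eq_sum vonMangoldt N
    rw [vonMangoldt_mul_zeta] at h1
    rw [← h1]
    clear h1 hL L hNz hzN hN0 hN1
    clear_value N
    clear hN
    induction N with
    | zero => simp
    | succ n ih =>
      rw [Finset.sum_Ioc_succ_top (by omega), Nat.factorial_succ, Nat.cast_mul,
        Real.log_mul (by positivity) (by positivity), ih, log_apply, add_comm]
  have hu : Real.log (N.factorial) ≤ N * L := by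
    rw [hfac, hL, Finset.mul_sum]
    apply Finset.sum_le_sum
    intro d hd
    have hd0 : (0:ℝ) < d := by exact_mod_cast (Finset.mem_Ioc.1 hd).1
    have := @Nat.cast_div_le ℝ _ _ _ N d
    calc vonMangoldt d * ((N / d : ℕ) : ℝ) ≤ vonMangoldt d * (N / d) := by
          gcongr
      _ = _ := by ring
  have hl : N * L ≤ Real.log (N.factorial) + Chebyshev.psi N := by
    rw [hfac, hL, Finset.mul_sum, Chebyshev.psi, Nat.floor_natCast, ← Finset.sum_add_distrib]
    apply Finset.sum_le_sum
    intro d hd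
    have hd0 : (0:ℝ) < d := by exact_mod_cast (Finset.mem_Ioc.1 hd).1
    have := (Nat.lt_floor_add_one ((N:ℝ)/d)).le
    rw [Nat.floor_div_natCast, Nat.floor_natCast] at this
    calc N * (vonMangoldt d / d) = vonMangoldt d * (N / d) := by ring
      _ ≤ vonMangoldt d * ((N / d : ℕ) + 1) := by
          gcongr
      _ = _ := by ring
  have hpsi := Chebyshev.psi_le_const_mul_self hN0.le
  have hf1 : Real.log (N.factorial) ≤ N * Real.log N := by
    rw [← Real.log_pow]
    apply Real.log_le_log (by positivity)
    exact_mod_cast Nat.factorial_le_pow N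
  have hf2 : N * Real.log N - N ≤ Real.log (N.factorial) := by
    have := Real.pow_div_factorial_le_exp (x := N) hN0.le N
    have := Real.log_le_log (by positivity) this
    rw [Real.log_exp, Real.log_div (by positivity) (by positivity), Real.log_pow] at this
    linarith
  have a1 : L ≤ Real.log N + (Real.log 4 + 4) := by
    apply le_of_mul_le_mul_left _ hN0
    linarith
  have a2 : Real.log N - 1 ≤ L := by
    apply le_of_mul_le_mul_left _ hN0
    linarith
  have a3 : Real.log N ≤ Real.log z := Real.log_le_log hN0 hNz
  have a4 : Real.log z ≤ Real.log N + 1 := by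
    have : Real.log z - Real.log N ≤ z / N - 1 := by
      rw [← Real.log_div (by linarith) hN0.ne']
      exact Real.log_le_sub_one_of_pos (by positivity)
    have : z / N ≤ 2 := by
      rw [div_le_iff₀ hN0]
      have : (1:ℝ) ≤ N := by exact_mod_cast hN1
      linarith
    linarith
  have : 0 < Real.log 4 := Real.log_pos (by norm_num)
  rw [abs_le]; constructor <;> linarith

/-- y-rough -/
def Rgh (y : ℝ) (n : ℕ) : Prop := n = 1 ∨ y < (n.minFac : ℝ)

theorem rgh_iff {y : ℝ} {n : ℕ} (hn : 0 < n) :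
    Rgh y n ↔ ∀ p : ℕ, p.Prime → p ∣ n → y < p := by
  constructor
  · rintro (rfl | h) p hp hpn
    · exact absurd hpn (by simpa using hp.ne_one)
    · exact h.trans_le (by exact_mod_cast Nat.minFac_le_of_dvd hp.two_le hpn)
  · intro h
    by_cases h1 : n = 1
    · exact Or.inl h1
    · exact Or.inr (h _ (Nat.minFac_prime h1) (Nat.minFac_dvd n))

theorem rgh_mul {y : ℝ} {m n : ℕ} (hm : 0 < m) (hn : 0 < n) :
    Rgh y (m*n) ↔ Rgh y m ∧ Rgh y n := by
  rw [rgh_iff hm, rgh_iff hn, rgh_iff (Nat.mul_pos hm hn)]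
  constructor
  · exact fun h => ⟨fun p hp hd => h p hp (hd.mul_right n), fun p hp hd => h p hp (hd.mul_left m)⟩
  · rintro ⟨h1, h2⟩ p hp hd
    exact (hp.dvd_mul.1 hd).elim (h1 p hp) (h2 p hp)

open Classical in
theorem rough_eq (x y : ℝ) : roughHarmonic x y =
    ∑ n ∈ Finset.Ioc 0 ⌊x⌋₊, if Rgh y n then 1 / (n:ℝ) else 0 := by
  rw [roughHarmonic, Finset.sum_filter]
  apply Finset.sum_congr
  · ext; simp [Nat.succ_le_iff]
  · intro n _
    unfold Rgh
    congr

open ArithmeticFunction Classical in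
theorem mertens_rough : ∃ K : ℝ, ∀ y z : ℝ, 2 ≤ y → y ≤ z →
    |(∑ d ∈ Finset.Ioc 0 ⌊z⌋₊, if Rgh y d then vonMangoldt d / d else 0) -
      (Real.log z - Real.log y)| ≤ K := by
  obtain ⟨K, hK⟩ := mertens1
  have hs : Summable (fun n : ℕ => (if n.Prime then 0 else vonMangoldt n) / (n:ℝ)) := by
    have := vonMangoldt.summable_residueClass_non_primes_div (q := 1) 0
    convert! this using 3 with n
    simp [vonMangoldt.residueClass, Set.indicator]
    rw [if_pos (Subsingleton.elim (n : ZMod 1) 0)]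
  set T := ∑' n : ℕ, (if n.Prime then 0 else vonMangoldt n) / (n:ℝ)
  refine ⟨2 * K + T, fun y z hy hyz => ?_⟩
  have h1 := hK y (by linarith)
  have h2 := hK z (by linarith)
  have hfl : ⌊y⌋₊ ≤ ⌊z⌋₊ := Nat.floor_le_floor hyz
  rw [← Finset.sum_Ioc_consecutive _ (Nat.zero_le _) hfl] at h2
  rw [← Finset.sum_Ioc_consecutive _ (Nat.zero_le _) hfl]
  have e0 : (∑ d ∈ Finset.Ioc 0 ⌊y⌋₊, if Rgh y d then vonMangoldt d / (d:ℝ) else 0) = 0 := by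
    apply Finset.sum_eq_zero
    intro d hd
    rw [Finset.mem_Ioc] at hd
    split_ifs with h
    · rcases h with rfl | h
      · simp
      · have : (d:ℝ) ≤ y := (Nat.le_floor_iff (by linarith)).1 hd.2
        have : (d.minFac : ℝ) ≤ d := by exact_mod_cast Nat.minFac_le hd.1
        linarith
    · rfl
  rw [e0, zero_add]
  set A := ∑ d ∈ Finset.Ioc ⌊y⌋₊ ⌊z⌋₊, vonMangoldt d / (d:ℝ) with hA
  set B := ∑ d ∈ Finset.Ioc ⌊y⌋₊ ⌊z⌋₊, if Rgh y d then vonMangoldt d / (d:ℝ) else 0 with hB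
  have nn : ∀ d : ℕ, 0 ≤ vonMangoldt d / (d:ℝ) := fun d =>
    div_nonneg vonMangoldt_nonneg (Nat.cast_nonneg d)
  have b1 : B ≤ A := by
    apply Finset.sum_le_sum
    intro d _
    split_ifs
    · rfl
    · exact nn d
  have b2 : A - B ≤ T := by
    rw [hA, hB, ← Finset.sum_sub_distrib]
    refine le_trans (Finset.sum_le_sum ?_) (hs.sum_le_tsum (Finset.Ioc ⌊y⌋₊ ⌊z⌋₊) ?_)
    · intro d hd
      rw [Finset.mem_Ioc] at hd
      by_cases hp : d.Prime
      · have : Rgh y d := by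
          right
          rw [hp.minFac_eq]
          exact (Nat.floor_lt (by linarith)).1 hd.1
        simp [hp, this]
      · rw [if_neg hp]
        split_ifs
        · simpa using nn d
        · simp
    · intro d _
      split_ifs
      · simp
      · exact nn d
  rw [abs_le] at *
  constructor <;> linarith [h1.1, h1.2, h2.1, h2.2]

open ArithmeticFunction Classical in
theorem mertens_rough0 (y z : ℝ) (hz0 : 0 ≤ z) (hz : z < y) :
    (∑ d ∈ Finset.Ioc 0 ⌊z⌋₊, if Rgh y d then vonMangoldt d / (d:ℝ) else 0) = 0 := by
  apply Finset.sum_eq_zero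
  intro d hd
  rw [Finset.mem_Ioc] at hd
  split_ifs with h
  · rcases h with rfl | h
    · simp
    · have : (d:ℝ) ≤ z := (Nat.le_floor_iff hz0).1 hd.2
      have : (d.minFac : ℝ) ≤ d := by exact_mod_cast Nat.minFac_le hd.1
      linarith
  · rfl

open ArithmeticFunction Classical in
theorem rough_conv (y : ℝ) (N : ℕ) :
    (∑ n ∈ Finset.Ioc 0 N, if Rgh y n then Real.log n / (n:ℝ) else 0) =
    ∑ m ∈ Finset.Ioc 0 N, (if Rgh y m then 1 / (m:ℝ) else 0) *
      ∑ d ∈ Finset.Ioc 0 (N / m), if Rgh y d then vonMangoldt d / (d:ℝ) else 0 := by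
  set f : ArithmeticFunction ℝ := ⟨fun n => if Rgh y n then 1 / (n:ℝ) else 0, by simp⟩ with hf
  set g : ArithmeticFunction ℝ := ⟨fun n => if Rgh y n then vonMangoldt n / (n:ℝ) else 0, by simp⟩
    with hg
  have := sum_Ioc_mul_eq_sum_sum f g N
  refine Eq.trans (Finset.sum_congr rfl ?_) this
  intro n hn
  have hn0 := (Finset.mem_Ioc.1 hn).1
  rw [mul_apply]
  have h1 : ∀ x ∈ n.divisorsAntidiagonal, f x.1 * g x.2 =
      if Rgh y n then vonMangoldt x.2 / (n:ℝ) else 0 := by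
    rintro ⟨a, b⟩ hx
    rw [Nat.mem_divisorsAntidiagonal] at hx
    obtain ⟨rfl, h0⟩ := hx
    have ha : 0 < a := Nat.pos_of_ne_zero (by rintro rfl; simp at h0)
    have hb : 0 < b := Nat.pos_of_ne_zero (by rintro rfl; simp at h0)
    have := rgh_mul (y := y) ha hb
    simp only [hf, hg, coe_mk, this]
    by_cases hA : Rgh y a <;> by_cases hB : Rgh y b <;> simp [hA, hB]
    field_simp
  rw [Finset.sum_congr rfl h1]
  split_ifs with h
  · rw [← Finset.sum_div, ← Nat.map_div_left_divisors]
    simp only [Finset.sum_map]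
    congr 1
    exact (vonMangoldt_sum).symm
  · simp

theorem rough_upper (x y : ℝ) (hx : 1 ≤ x) (hy : 2 ≤ y) :
    roughHarmonic x y * Real.log y ≤ 1 + Real.log (x * y) := by
  classical
  have hy1 := log_le_harmonic_floor y (by linarith)
  have hh := harmonic_floor_le_one_add_log (x*y) (by nlinarith)
  rw [harmonic_eq_sum_Icc] at hy1 hh
  push_cast at hy1 hh
  have hS0 : 0 ≤ roughHarmonic x y := Finset.sum_nonneg (fun _ _ => by positivity)
  refine le_trans (mul_le_mul_of_nonneg_left hy1 hS0) (le_trans ?_ hh)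
  rw [roughHarmonic, Finset.sum_mul_sum, ← Finset.sum_product']
  have hinj : Set.InjOn (fun q : ℕ × ℕ => q.1 * q.2)
      ((Finset.Icc 1 ⌊x⌋₊).filter (fun n => n = 1 ∨ y < (n.minFac : ℝ)) ×ˢ Finset.Icc 1 ⌊y⌋₊ :
        Finset (ℕ × ℕ)) := by
    have hcop : ∀ r m : ℕ, 0 < r → Rgh y r → 0 < m → m ≤ ⌊y⌋₊ → Nat.Coprime m r := by
      intro r m hr0 hr hm hmy
      apply Nat.Coprime.symm
      rw [Nat.coprime_iff_gcd_eq_one] 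
      by_contra h
      obtain ⟨p, hp, hpd⟩ := Nat.exists_prime_and_dvd h
      have h1 := (rgh_iff hr0).1 hr p hp (hpd.trans (Nat.gcd_dvd_left _ _))
      have h2 : p ≤ m := Nat.le_of_dvd hm (hpd.trans (Nat.gcd_dvd_right _ _))
      have := (Nat.le_floor_iff (by linarith)).1 (h2.trans hmy)
      linarith
    rintro ⟨r, m⟩ h ⟨r', m'⟩ h' he
    simp only [Finset.coe_product, Set.mem_prod, Finset.mem_coe, Finset.mem_filter,
      Finset.mem_Icc] at h h' he
    have d1 : m ∣ m' := (hcop r' m h'.1.1.1 h'.1.2 h.2.1 h.2.2).dvd_of_dvd_mul_left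
      (he ▸ Dvd.intro_left r rfl)
    have d2 : m' ∣ m := (hcop r m' h.1.1.1 h.1.2 h'.2.1 h'.2.2).dvd_of_dvd_mul_left
      (he.symm ▸ Dvd.intro_left r' rfl)
    have hm := Nat.dvd_antisymm d1 d2
    subst hm
    have := Nat.eq_of_mul_eq_mul_right h.2.1 he
    rw [this]
  have := Finset.sum_image (f := fun n : ℕ => ((n:ℝ))⁻¹) hinj
  refine le_trans (le_of_eq ?_) (le_trans (le_of_eq this.symm) (Finset.sum_le_sum_of_subset_of_nonneg ?_ ?_))
  · apply Finset.sum_congr rfl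
    intro q _
    push_cast
    rw [mul_inv, one_div]
  · intro n hn
    obtain ⟨⟨r, m⟩, h, rfl⟩ := Finset.mem_image.1 hn
    simp only [Finset.mem_product, Finset.mem_filter, Finset.mem_Icc] at h ⊢
    refine ⟨Nat.mul_pos h.1.1.1 h.2.1, ?_⟩
    apply Nat.le_floor
    push_cast
    have h1 := (Nat.le_floor_iff (by linarith)).1 h.1.1.2
    have h2 := (Nat.le_floor_iff (by linarith)).1 h.2.2
    gcongr
  · intro n _ _
    positivity

theorem s_mono (y : ℝ) (hy : 2 ≤ y) : Monotone (fun u : ℝ => roughHarmonic (y^u) y) := by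
  intro u v huv
  apply Finset.sum_le_sum_of_subset_of_nonneg
  · apply Finset.filter_subset_filter
    apply Finset.Icc_subset_Icc_right
    apply Nat.floor_le_floor
    exact Real.rpow_le_rpow_of_exponent_le (by linarith) huv
  · intro n _ _
    positivity

theorem le_floor_rpow (y : ℝ) (hy : 2 ≤ y) (v : ℝ) (n : ℕ) (hn : 0 < n) :
    n ≤ ⌊y^v⌋₊ ↔ Real.log n / Real.log y ≤ v := by
  have hn' : (0:ℝ) < n := by exact_mod_cast hn
  have hl : 0 < Real.log y := Real.log_pos (by linarith)
  have hy0 : 0 < y := by linarith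
  rw [Nat.le_floor_iff (by positivity), div_le_iff₀ hl, ← Real.log_rpow hy0,
    Real.log_le_log_iff hn' (by positivity)]

open Classical in
theorem s_rep (y : ℝ) (hy : 2 ≤ y) (u v : ℝ) (huv : v ≤ u) : roughHarmonic (y^v) y =
    ∑ n ∈ Finset.Ioc 0 ⌊y^u⌋₊, (if Rgh y n then 1 / (n:ℝ) else 0) *
      (if Real.log n / Real.log y ≤ v then 1 else 0) := by
  rw [rough_eq]
  have hsub : Finset.Ioc 0 ⌊y^v⌋₊ ⊆ Finset.Ioc 0 ⌊y^u⌋₊ :=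
    Finset.Ioc_subset_Ioc_right (Nat.floor_le_floor
      (Real.rpow_le_rpow_of_exponent_le (by linarith) huv))
  rw [← Finset.sum_subset hsub]
  · apply Finset.sum_congr rfl
    intro n hn
    rw [Finset.mem_Ioc] at hn
    rw [if_pos ((le_floor_rpow y hy v n hn.1).1 hn.2), mul_one]
  · intro n hn hn'
    rw [Finset.mem_Ioc] at hn hn'
    have hno : ¬ (Real.log n / Real.log y ≤ v) := fun h =>
      hn' ⟨hn.1, (le_floor_rpow y hy v n hn.1).2 h⟩
    rw [if_neg hno, mul_zero]

open Classical in
theorem s_rc (y : ℝ) (hy : 2 ≤ y) (u : ℝ) :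
    ContinuousWithinAt (fun v : ℝ => roughHarmonic (y^v) y) (Set.Ici u) u := by
  have hev : (fun v : ℝ => roughHarmonic (y^v) y) =ᶠ[nhdsWithin u (Set.Ici u)]
      fun _ => roughHarmonic (y^u) y := by
    have : ∀ n ∈ Finset.Ioc 0 ⌊y^(u+1)⌋₊, ∀ᶠ v in nhdsWithin u (Set.Ici u),
        (if Real.log n / Real.log y ≤ v then (1:ℝ) else 0) =
        (if Real.log n / Real.log y ≤ u then (1:ℝ) else 0) := by
      intro n _
      by_cases h : Real.log n / Real.log y ≤ u
      · filter_upwards [self_mem_nhdsWithin] with v hv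
        rw [if_pos h, if_pos (h.trans hv)]
      · push Not at h
        filter_upwards [mem_nhdsWithin_of_mem_nhds (Iio_mem_nhds h)] with v hv
        rw [if_neg (not_le.2 h), if_neg (not_le.2 hv)]
    filter_upwards [(Finset.eventually_all _).2 this,
      mem_nhdsWithin_of_mem_nhds (Iio_mem_nhds (show u < u+1 by linarith))] with v hv hv1
    rw [s_rep y hy (u+1) v (le_of_lt hv1), s_rep y hy (u+1) u (by linarith)]
    exact Finset.sum_congr rfl (fun n hn => by rw [hv n hn])
  exact (continuousWithinAt_const).congr_of_eventuallyEq hev rfl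

theorem int_step (l u : ℝ) (hl : 0 ≤ l) (hu : l ≤ u) :
    IntervalIntegrable (fun v : ℝ => if l ≤ v then (1:ℝ) else 0) volume 0 u ∧
    ∫ v in (0:ℝ)..u, (if l ≤ v then (1:ℝ) else 0) = u - l := by
  have hm : Monotone (fun v : ℝ => if l ≤ v then (1:ℝ) else 0) := by
    intro a b hab
    simp only
    split_ifs with h1 h2 h2
    · rfl
    · exact absurd (h1.trans hab) h2
    · norm_num
    · rfl
  refine ⟨hm.intervalIntegrable, ?_⟩
  rw [← intervalIntegral.integral_add_adjacent_intervals (b := l) hm.intervalIntegrable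
    hm.intervalIntegrable]
  have e1 : ∫ v in (0:ℝ)..l, (if l ≤ v then (1:ℝ) else 0) = 0 := by
    apply intervalIntegral.integral_zero_ae
    filter_upwards [(Set.finite_singleton l).countable.ae_notMem volume] with v hv hv2
    rw [Set.uIoc_of_le hl] at hv2
    exact if_neg (not_le.2 (lt_of_le_of_ne hv2.2 hv))
  have e2 : ∫ v in l..u, (if l ≤ v then (1:ℝ) else 0) = ∫ v in l..u, (1:ℝ) := by
    apply intervalIntegral.integral_congr
    intro v hv
    rw [Set.uIcc_of_le hu] at hv
    exact if_pos hv.1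
  rw [e1, e2]; simp

open Classical in
theorem s_int (y : ℝ) (hy : 2 ≤ y) (u : ℝ) (hu : 0 ≤ u) :
    ∫ v in (0:ℝ)..u, roughHarmonic (y^v) y =
    ∑ n ∈ Finset.Ioc 0 ⌊y^u⌋₊, (if Rgh y n then 1 / (n:ℝ) else 0) *
      (u - Real.log n / Real.log y) := by
  have hl : 0 < Real.log y := Real.log_pos (by linarith)
  have h1 : ∀ n ∈ Finset.Ioc 0 ⌊y^u⌋₊, 0 ≤ Real.log n / Real.log y ∧ 
      Real.log n / Real.log y ≤ u := by
    intro n hn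
    rw [Finset.mem_Ioc] at hn
    exact ⟨div_nonneg (Real.log_natCast_nonneg n) hl.le, (le_floor_rpow y hy u n hn.1).1 hn.2⟩
  rw [intervalIntegral.integral_congr (g := fun v => ∑ n ∈ Finset.Ioc 0 ⌊y^u⌋₊,
    (if Rgh y n then 1 / (n:ℝ) else 0) * (if Real.log n / Real.log y ≤ v then 1 else 0))]
  · rw [intervalIntegral.integral_finsetSum]
    · apply Finset.sum_congr rfl
      intro n hn
      rw [intervalIntegral.integral_const_mul, (int_step _ u (h1 n hn).1 (h1 n hn).2).2]
    · intro n hn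
      exact (int_step _ u (h1 n hn).1 (h1 n hn).2).1.const_mul _
  · intro v hv
    rw [Set.uIcc_of_le hu] at hv
    exact s_rep y hy u v hv.2

open Classical ArithmeticFunction in
theorem s_eq : ∃ K : ℝ, 0 ≤ K ∧ ∀ y : ℝ, 2 ≤ y → ∀ u : ℝ, 1 ≤ u →
    |u * roughHarmonic (y^u) y - (∫ v in (0:ℝ)..u, roughHarmonic (y^v) y) -
      ∫ v in (0:ℝ)..(u-1), roughHarmonic (y^v) y| ≤ K / Real.log y * u := by
  obtain ⟨K, hK⟩ := mertens_rough
  have hK0 : 0 ≤ K := (abs_nonneg _).trans (hK 2 2 le_rfl le_rfl)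
  have hl2 : 0 < Real.log 2 := Real.log_pos (by norm_num)
  refine ⟨K * (1 + 1 / Real.log 2), by positivity, fun y hy u hu => ?_⟩
  have hl : 0 < Real.log y := Real.log_pos (by linarith)
  have hy0 : 0 < y := by linarith
  have hl' : Real.log 2 ≤ Real.log y := Real.log_le_log (by norm_num) hy
  set x := y^u with hx
  have hx0 : 0 < x := by positivity
  have hx1 : y^(u-1) = x / y := by rw [Real.rpow_sub_one hy0.ne']
  have hlx : Real.log x = u * Real.log y := Real.log_rpow hy0 u
  have hS := rough_upper (x/y) y (by rw [← hx1]; exact Real.one_le_rpow (by linarith) (by linarith)) hy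
  rw [div_mul_cancel₀ _ hy0.ne', hlx] at hS
  have e1 : u * roughHarmonic x y - (∫ v in (0:ℝ)..u, roughHarmonic (y^v) y) =
      (∑ m ∈ Finset.Ioc 0 ⌊x⌋₊, (if Rgh y m then 1 / (m:ℝ) else 0) *
      ∑ d ∈ Finset.Ioc 0 ⌊x / m⌋₊, if Rgh y d then vonMangoldt d / (d:ℝ) else 0) / Real.log y := by
    have hc := rough_conv y ⌊x⌋₊
    simp_rw [← Nat.floor_div_natCast] at hc
    rw [← hc, s_int y hy u (by linarith), rough_eq, Finset.mul_sum, ← Finset.sum_sub_distrib,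
      Finset.sum_div]
    apply Finset.sum_congr rfl
    intro n _
    split_ifs
    · ring
    · simp
  have hsub : Finset.Ioc 0 ⌊x/y⌋₊ ⊆ Finset.Ioc 0 ⌊x⌋₊ :=
    Finset.Ioc_subset_Ioc_right (Nat.floor_le_floor (div_le_self hx0.le (by linarith)))
  have e2 : (∑ m ∈ Finset.Ioc 0 ⌊x⌋₊, (if Rgh y m then 1 / (m:ℝ) else 0) *
      ∑ d ∈ Finset.Ioc 0 ⌊x / m⌋₊, if Rgh y d then vonMangoldt d / (d:ℝ) else 0) =
      ∑ m ∈ Finset.Ioc 0 ⌊x/y⌋₊, (if Rgh y m then 1 / (m:ℝ) else 0) *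
      ∑ d ∈ Finset.Ioc 0 ⌊x / m⌋₊, if Rgh y d then vonMangoldt d / (d:ℝ) else 0 := by
    symm
    apply Finset.sum_subset hsub
    intro m hm hm'
    rw [Finset.mem_Ioc] at hm hm'
    have hm0 : (0:ℝ) < m := by exact_mod_cast hm.1
    have h1 : ⌊x/y⌋₊ < m := by
      by_contra h
      exact hm' ⟨hm.1, not_lt.1 h⟩
    have h2 := (Nat.floor_lt (by positivity)).1 h1
    rw [mertens_rough0, mul_zero]
    · positivity
    · rw [div_lt_iff₀ hm0]; rw [div_lt_iff₀ hy0] at h2; linarith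
  rw [e1, e2, s_int y hy (u-1) (by linarith), hx1, Finset.sum_div, ← Finset.sum_sub_distrib]
  calc _ ≤ ∑ m ∈ Finset.Ioc 0 ⌊x/y⌋₊, (if Rgh y m then 1 / (m:ℝ) else 0) * (K / Real.log y) := by
        refine (Finset.abs_sum_le_sum_abs _ _).trans (Finset.sum_le_sum ?_)
        intro m hm
        rw [Finset.mem_Ioc] at hm
        have hm0 : (0:ℝ) < m := by exact_mod_cast hm.1
        have hmx : y ≤ x / m := by
          have := (Nat.le_floor_iff (by positivity)).1 hm.2
          rw [le_div_iff₀ hy0] at this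
          rw [le_div_iff₀ hm0]; linarith
        have hk := hK y (x/m) hy hmx
        rw [Real.log_div hx0.ne' hm0.ne', hlx] at hk
        split_ifs
        · rw [mul_div_assoc, ← mul_sub, abs_mul, abs_of_pos (by positivity : 0 < 1 / (m:ℝ))]
          gcongr
          rw [le_div_iff₀ hl, ← abs_of_pos hl, ← abs_mul, abs_of_pos hl]
          refine le_trans (le_of_eq ?_) hk
          congr 1
          field_simp
          ring
        · simp
    _ = roughHarmonic (x/y) y * (K / Real.log y) := by rw [rough_eq, Finset.sum_mul]
    _ ≤ ((1 + 1 / Real.log 2) * u) * (K / Real.log y) := by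
        gcongr
        refine le_of_mul_le_mul_right (hS.trans ?_) hl
        have : 1 ≤ 1 / Real.log 2 * u * Real.log y := by
          have : 1 ≤ Real.log y / Real.log 2 := (one_le_div hl2).2 hl'
          calc (1:ℝ) ≤ u * (Real.log y / Real.log 2) := by nlinarith
            _ = _ := by ring
        nlinarith
    _ = _ := by ring

open Classical Filter Topology in
theorem sieve_lim (Q : Finset ℕ) (hQ : ∀ p ∈ Q, p.Prime) :
    Tendsto (fun x : ℝ => (∑ n ∈ Finset.Ioc 0 ⌊x⌋₊, if ∀ p ∈ Q, ¬ p ∣ n then 1 / (n:ℝ) else 0)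
      / Real.log x) atTop (𝓝 (∏ p ∈ Q, (1 - 1 / (p:ℝ)))) := by
  induction Q using Finset.induction_on with
  | empty =>
    simp only [Finset.notMem_empty, false_imp_iff, implies_true, if_true, Finset.prod_empty]
    have he : ∀ x : ℝ, ∑ n ∈ Finset.Ioc 0 ⌊x⌋₊, 1 / (n:ℝ) = harmonic ⌊x⌋₊ := by
      intro x
      rw [harmonic_eq_sum_Icc]
      push_cast
      apply Finset.sum_congr
      · ext; simp [Nat.succ_le_iff]
      · intro n _; rw [one_div]
    simp_rw [he]
    have hlim : Tendsto (fun x : ℝ => 1 / Real.log x + 1) atTop (𝓝 (0 + 1)) :=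
      (tendsto_const_nhds.div_atTop Real.tendsto_log_atTop).add_const 1
    rw [zero_add] at hlim
    refine tendsto_of_tendsto_of_tendsto_of_le_of_le' tendsto_const_nhds hlim ?_ ?_
    · filter_upwards [eventually_gt_atTop 1] with x hx
      rw [one_le_div (Real.log_pos hx)]
      exact log_le_harmonic_floor x (by linarith)
    · filter_upwards [eventually_gt_atTop 1] with x hx
      have hl := Real.log_pos hx
      rw [div_le_iff₀ hl, add_mul, one_div_mul_cancel hl.ne', one_mul]
      exact harmonic_floor_le_one_add_log x hx.le
  | insert p Q hp ih =>
    have hpp := hQ p (Finset.mem_insert_self p Q)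
    have hp0 : (0:ℝ) < p := by exact_mod_cast hpp.pos
    have hQ' : ∀ q ∈ Q, q.Prime := fun q hq => hQ q (Finset.mem_insert_of_mem hq)
    have ih := ih hQ'
    rw [Finset.prod_insert hp]
    set A : ℝ → ℝ := fun x => ∑ n ∈ Finset.Ioc 0 ⌊x⌋₊, if ∀ p ∈ Q, ¬ p ∣ n then 1 / (n:ℝ) else 0
      with hA
    have hrec : ∀ x : ℝ, (∑ n ∈ Finset.Ioc 0 ⌊x⌋₊, if ∀ q ∈ insert p Q, ¬ q ∣ n then 1 / (n:ℝ) else 0)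
        = A x - 1 / p * A (x / p) := by
      intro x
      rw [eq_sub_iff_add_eq']
      have h1 : 1 / p * A (x/p) = ∑ n ∈ Finset.Ioc 0 ⌊x⌋₊,
          if p ∣ n ∧ ∀ q ∈ Q, ¬ q ∣ n then 1 / (n:ℝ) else 0 := by
        simp only [hA]
        rw [Nat.floor_div_natCast, Finset.mul_sum]
        simp_rw [ite_and]
        rw [← Finset.sum_filter (fun n => p ∣ n)]
        apply Finset.sum_nbij' (fun m => p * m) (fun n => n / p)
        · intro m hm
          simp only [Finset.mem_Ioc, Finset.mem_filter] at hm ⊢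
          refine ⟨⟨Nat.mul_pos hpp.pos hm.1, ?_⟩, Dvd.intro _ rfl⟩
          rw [mul_comm]; exact (Nat.le_div_iff_mul_le hpp.pos).1 hm.2
        · intro n hn
          simp only [Finset.mem_Ioc, Finset.mem_filter] at hn ⊢
          exact ⟨Nat.div_pos (Nat.le_of_dvd hn.1.1 hn.2) hpp.pos, Nat.div_le_div_right hn.1.2⟩
        · intro m _
          exact Nat.mul_div_cancel_left m hpp.pos
        · intro n hn
          exact Nat.mul_div_cancel' (Finset.mem_filter.1 hn).2
        · intro m hm
          have : (∀ q ∈ Q, ¬ q ∣ p * m) ↔ (∀ q ∈ Q, ¬ q ∣ m) := by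
            refine forall₂_congr (fun q hq => not_congr ?_)
            rw [(hQ' q hq).dvd_mul]
            have : ¬ q ∣ p := fun h => hp ((Nat.prime_dvd_prime_iff_eq (hQ' q hq) hpp).1 h ▸ hq)
            simp [this]
          simp only [this]
          split_ifs
          · push_cast
            rw [one_div_mul_one_div]
          · simp
      rw [h1, ← Finset.sum_add_distrib]
      apply Finset.sum_congr rfl
      intro n _
      by_cases a : p ∣ n <;> by_cases b : (∀ q ∈ Q, ¬ q ∣ n) <;> simp [a, b]
    simp_rw [hrec]
    have hdiv : Tendsto (fun x : ℝ => x / p) atTop atTop := tendsto_id.atTop_div_const hp0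
    have h2 := ih.comp hdiv
    have h3 : Tendsto (fun x : ℝ => 1 - Real.log p / Real.log x) atTop (𝓝 (1 - 0)) :=
      (tendsto_const_nhds.div_atTop Real.tendsto_log_atTop).const_sub 1
    have h4 := ih.sub ((h2.mul h3).const_mul (1 / (p:ℝ)))
    have e : ∏ q ∈ Q, (1 - 1 / (q:ℝ)) - 1 / (p:ℝ) * (∏ q ∈ Q, (1 - 1 / (q:ℝ)) * (1 - 0))
      = (1 - 1 / (p:ℝ)) * ∏ q ∈ Q, (1 - 1 / (q:ℝ)) := by simp only [sub_zero, mul_one]; ring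
    have e' : ∏ q ∈ Q, (1 - 1 / (q:ℝ)) - 1 / (p:ℝ) * ((∏ q ∈ Q, (1 - 1 / (q:ℝ))) * (1 - 0))
      = (1 - 1 / (p:ℝ)) * ∏ q ∈ Q, (1 - 1 / (q:ℝ)) := by ring
    rw [e'] at h4
    refine h4.congr' ?_
    filter_upwards [eventually_gt_atTop (p:ℝ)] with x hx
    have hp1 : (1:ℝ) < p := by exact_mod_cast hpp.one_lt
    have l1 : 0 < Real.log x := Real.log_pos (by linarith)
    have l2 : 0 < Real.log (x / p) := Real.log_pos ((one_lt_div hp0).2 hx)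
    have l3 : 1 - Real.log p / Real.log x = Real.log (x/p) / Real.log x := by
      rw [Real.log_div (by linarith) hp0.ne']; field_simp
    simp only [Function.comp]
    rw [l3]
    rw [show (∑ n ∈ Finset.Ioc 0 ⌊x⌋₊, if ∀ p ∈ Q, ¬ p ∣ n then 1 / (n:ℝ) else 0) = A x from rfl,
      show (∑ n ∈ Finset.Ioc 0 ⌊x/p⌋₊, if ∀ p ∈ Q, ¬ p ∣ n then 1 / (n:ℝ) else 0) = A (x/p) from rfl]
    field_simp

open Classical Filter Topology in
theorem s_lim (y : ℝ) (hy : 2 ≤ y) :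
    Tendsto (fun u : ℝ => roughHarmonic (y^u) y / u) atTop (𝓝 (primeProd y * Real.log y)) := by
  have h := sieve_lim ((Finset.range (⌊y⌋₊ + 1)).filter Nat.Prime)
    (fun p hp => (Finset.mem_filter.1 hp).2)
  have hl : 0 < Real.log y := Real.log_pos (by linarith)
  have hy0 : 0 < y := by linarith
  have ht : Tendsto (fun u : ℝ => y^u) atTop atTop := tendsto_rpow_atTop_of_base_gt_one y (by linarith)
  have h2 := (h.comp ht).mul_const (Real.log y)
  refine h2.congr' ?_
  filter_upwards [eventually_gt_atTop 0] with u hu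
  simp only [Function.comp]
  rw [Real.log_rpow hy0]
  have : (∑ n ∈ Finset.Ioc 0 ⌊y^u⌋₊, if ∀ p ∈ (Finset.range (⌊y⌋₊ + 1)).filter Nat.Prime, ¬ p ∣ n
      then 1 / (n:ℝ) else 0) = roughHarmonic (y^u) y := by
    rw [rough_eq]
    apply Finset.sum_congr rfl
    intro n hn
    have hn0 := (Finset.mem_Ioc.1 hn).1
    have : (∀ p ∈ (Finset.range (⌊y⌋₊ + 1)).filter Nat.Prime, ¬ p ∣ n) ↔ Rgh y n := by
      rw [rgh_iff hn0]
      constructor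
      · intro h p hp hd
        by_contra hlt
        refine h p (Finset.mem_filter.2 ⟨?_, hp⟩) hd
        rw [Finset.mem_range, Nat.lt_succ_iff]
        exact Nat.le_floor (not_lt.1 hlt)
      · intro h p hp hd
        obtain ⟨h1, h2⟩ := Finset.mem_filter.1 hp
        have := h p h2 hd
        rw [Finset.mem_range, Nat.lt_succ_iff, Nat.le_floor_iff hy0.le] at h1
        linarith
    simp only [this]
  calc _ = roughHarmonic (y^u) y / (u * Real.log y) * Real.log y := by
        congr 2
        rw [← this]
        apply Finset.sum_congr rfl
        intros
        congr
    _ = _ := by field_simp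

/-- (1 - e^{-t})/t extended continuously -/
noncomputable def phi (t : ℝ) : ℝ := dslope Real.exp 0 (-t)

theorem phi_mul (t : ℝ) : t * phi t = 1 - Real.exp (-t) := by
  have := sub_smul_dslope Real.exp 0 (-t)
  rw [phi]
  simp only [smul_eq_mul, sub_zero, Real.exp_zero] at this
  linarith

theorem phi_cont : Continuous phi := by
  have : Continuous (dslope Real.exp 0) := by
    rw [← continuousOn_univ, continuousOn_dslope Filter.univ_mem]
    exact ⟨Real.continuous_exp.continuousOn, Real.differentiable_exp 0⟩
  exact this.comp continuous_neg

theorem exp_sub_pow (n : ℕ) (hn : 0 < n) (t : ℝ) (ht0 : 0 ≤ t) (htn : t ≤ n) :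
    |(1 - t/n)^n - Real.exp (-t)| ≤ t^2 * Real.exp (-t) / n := by
  have hn0 : (0:ℝ) < n := by exact_mod_cast hn
  have ha0 : 0 ≤ t/n := by positivity
  have ha1 : t/n ≤ 1 := (div_le_one hn0).2 htn
  have hpow : (Real.exp (-(t/n)))^n = Real.exp (-t) := by
    rw [← Real.exp_nat_mul]; congr 1; field_simp
  have h1 : (1 - t/n)^n ≤ Real.exp (-t) := by
    rw [← hpow]
    apply pow_le_pow_left₀ (by linarith)
    have := Real.add_one_le_exp (-(t/n)); linarith
  have h2 : Real.exp (-(t/n)) * (1 - (t/n)^2) ≤ 1 - t/n := by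
    have h3 := Real.add_one_le_exp (t/n)
    have h4 : Real.exp (-(t/n)) * Real.exp (t/n) = 1 := by rw [← Real.exp_add]; simp
    have h5 := Real.exp_pos (-(t/n))
    have : Real.exp (-(t/n)) * (t/n + 1) ≤ 1 := by
      calc _ ≤ Real.exp (-(t/n)) * Real.exp (t/n) := by gcongr
        _ = 1 := h4
    calc Real.exp (-(t/n)) * (1 - (t/n)^2) = (Real.exp (-(t/n)) * (t/n + 1)) * (1 - t/n) := by ring
      _ ≤ 1 * (1 - t/n) := by gcongr
      _ = _ := by ring
  have h6 : Real.exp (-t) * (1 - (t/n)^2)^n ≤ (1 - t/n)^n := by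
    rw [← hpow, ← mul_pow]
    apply pow_le_pow_left₀ _ h2
    apply mul_nonneg (Real.exp_pos _).le
    nlinarith
  have h7 : 1 - t^2/n ≤ (1 - (t/n)^2)^n := by
    have := one_add_mul_le_pow (a := -(t/n)^2) (by nlinarith) n
    refine le_trans (le_of_eq ?_) (this.trans (le_of_eq ?_))
    · field_simp; ring
    · ring_nf
  have h8 := mul_le_mul_of_nonneg_left h7 (Real.exp_pos (-t)).le
  have h9 : Real.exp (-t) * (1 - t^2/n) = Real.exp (-t) - t^2 * Real.exp (-t)/n := by ring
  have h10 : 0 ≤ t^2 * Real.exp (-t)/n := by positivity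
  rw [abs_le]; constructor <;> linarith

theorem harm_int (n : ℕ) (hn : 0 < n) :
    ∫ t in (0:ℝ)..n, (1/(n:ℝ)) * ∑ k ∈ Finset.range n, (1 - t/n)^k = harmonic n := by
  have hn0 : (0:ℝ) < n := by exact_mod_cast hn
  rw [intervalIntegral.integral_eq_sub_of_hasDerivAt
    (f := fun t : ℝ => -∑ k ∈ Finset.range n, (1 - t/n)^(k+1) / ((k:ℝ)+1))]
  · rw [div_self hn0.ne', harmonic]
    push_cast
    simp
  · intro t _
    have : ∀ k ∈ Finset.range n, HasDerivAt (fun t : ℝ => (1 - t/n)^(k+1) / ((k:ℝ)+1))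
        (-(1/(n:ℝ)) * (1 - t/n)^k) t := by
      intro k _
      have h := ((((hasDerivAt_id t).div_const (n:ℝ)).const_sub 1).pow (k+1)).div_const ((k:ℝ)+1)
      refine h.congr_deriv ?_
      simp
      have : (k:ℝ) + 1 ≠ 0 := by positivity
      field_simp
    have h2 := (HasDerivAt.fun_sum this).neg
    refine h2.congr_deriv ?_
    rw [← Finset.mul_sum]; ring
  · apply Continuous.intervalIntegrable; fun_prop

open Filter Topology in
theorem gam_lim : Tendsto (fun n : ℕ => Real.log n - ∫ t in (0:ℝ)..n, phi t) atTop
    (𝓝 (-Real.eulerMascheroniConstant)) := by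
  have hb : ∀ n : ℕ, 0 < n → |(∫ t in (0:ℝ)..n, phi t) - harmonic n| ≤ 1 / (n:ℝ) := by
    intro n hn
    have hn0 : (0:ℝ) < n := by exact_mod_cast hn
    rw [← harm_int n hn, ← intervalIntegral.integral_sub (phi_cont.intervalIntegrable _ _)
      (by apply Continuous.intervalIntegrable; fun_prop)]
    have hg : ∫ t in (0:ℝ)..n, t * Real.exp (-t) / n = (1 - (n+1) * Real.exp (-n)) / n := by
      rw [intervalIntegral.integral_eq_sub_of_hasDerivAt
        (f := fun t : ℝ => -(t+1) * Real.exp (-t) / n)]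
      · simp; ring
      · intro t _
        have h := (((hasDerivAt_id t).add_const 1).neg.mul
          ((hasDerivAt_id t).neg.exp)).div_const (n:ℝ)
        refine h.congr_deriv ?_
        simp only [id, Pi.neg_apply]
        ring
      · apply Continuous.intervalIntegrable; fun_prop
    have := intervalIntegral.norm_integral_le_of_norm_le (a := 0) (b := n) (μ := volume)
      (f := fun t => phi t - (1/(n:ℝ)) * ∑ k ∈ Finset.range n, (1 - t/n)^k)
      (g := fun t => t * Real.exp (-t) / n) hn0.le ?_ 
      (by apply Continuous.intervalIntegrable; fun_prop)
    · rw [hg] at this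
      refine this.trans ?_
      gcongr
      have : 0 ≤ ((n:ℝ)+1) * Real.exp (-n) := by positivity
      linarith
    · refine Eventually.of_forall (fun t ht => ?_)
      have h1 := exp_sub_pow n hn t ht.1.le ht.2
      have h2 := geom_sum_mul (1 - t/n) n
      have h3 : t * (phi t - (1/(n:ℝ)) * ∑ k ∈ Finset.range n, (1 - t/n)^k) =
          (1 - t/n)^n - Real.exp (-t) := by
        rw [mul_sub, phi_mul]
        linear_combination h2
      rw [← h3, abs_mul, abs_of_pos ht.1] at h1
      apply le_of_mul_le_mul_left (h1.trans (le_of_eq _)) ht.1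
      ring
  have h0 : Tendsto (fun n : ℕ => (∫ t in (0:ℝ)..n, phi t) - harmonic n) atTop (𝓝 0) := by
    apply squeeze_zero_norm' _ tendsto_one_div_atTop_nhds_zero_nat
    filter_upwards [eventually_gt_atTop 0] with n hn
    exact hb n hn
  have := (h0.add Real.tendsto_harmonic_sub_log).neg
  rw [zero_add] at this
  refine this.congr (fun n => ?_)
  ring

theorem lin_exp_int (t : ℝ) (ht : 0 < t) :
    IntegrableOn (fun u : ℝ => (u + 1) * Real.exp (-t * u)) (Set.Ioi 0) := by
  have h1 := integrableOn_rpow_mul_exp_neg_mul_rpow (s := 1) (p := 1) (b := t)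
    (by norm_num) (by norm_num) ht
  have h2 := exp_neg_integrableOn_Ioi 0 ht
  refine (h1.add h2).congr_fun (fun u _ => ?_) measurableSet_Ioi
  simp only [Pi.add_apply, Real.rpow_one]
  ring

section laplace
variable (ω σ : ℝ → ℝ)

theorem lap_sig_int (hc : Continuous σ) (hb : ∀ u, 0 ≤ u → 0 ≤ σ u ∧ σ u ≤ u + 1)
    (t : ℝ) (ht : 0 < t) :
    IntegrableOn (fun u : ℝ => Real.exp (-t * u) * σ u) (Set.Ioi 0) := by
  refine (lin_exp_int t ht).mono' (by apply Continuous.aestronglyMeasurable; fun_prop) ?_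
  refine (ae_restrict_iff' measurableSet_Ioi).2 (Filter.Eventually.of_forall fun u hu => ?_)
  obtain ⟨h1, h2⟩ := hb u (le_of_lt hu)
  rw [Real.norm_eq_abs, abs_of_nonneg (by positivity), mul_comm]
  gcongr

theorem om_meas (hc : ContinuousOn ω (Set.Ici 1)) (f : ℝ → ℝ) (hf : Continuous f) :
    AEStronglyMeasurable (fun u => f u * ω u) (volume.restrict (Set.Ioi 1)) := by
  apply ContinuousOn.aestronglyMeasurable _ measurableSet_Ioi
  exact hf.continuousOn.mul (hc.mono Set.Ioi_subset_Ici_self)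

theorem lap_om_int (hc : ContinuousOn ω (Set.Ici 1)) (hb : ∀ u, 0 ≤ ω u ∧ ω u ≤ 1)
    (t : ℝ) (ht : 0 < t) :
    IntegrableOn (fun u : ℝ => Real.exp (-t * u) * ω u) (Set.Ioi 1) := by
  refine (exp_neg_integrableOn_Ioi 1 ht).mono' (om_meas ω hc _ (by fun_prop)) ?_
  refine Filter.Eventually.of_forall fun u => ?_
  obtain ⟨h1, h2⟩ := hb u
  rw [Real.norm_eq_abs, abs_of_nonneg (by positivity)]
  exact mul_le_of_le_one_right (Real.exp_pos _).le h2

theorem lap_shift (t : ℝ) :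
    ∫ u in Set.Ioi (1:ℝ), Real.exp (-t * u) * σ (u - 1) =
      Real.exp (-t) * ∫ u in Set.Ioi (0:ℝ), Real.exp (-t * u) * σ u := by
  have h := (measurePreserving_add_right volume (1:ℝ)).setIntegral_preimage_emb
    (MeasurableEquiv.addRight (1:ℝ)).measurableEmbedding
    (fun u => Real.exp (-t * u) * σ (u - 1)) (Set.Ioi 1)
  rw [← h, ← integral_const_mul]
  have : (fun x : ℝ => x + 1) ⁻¹' Set.Ioi 1 = Set.Ioi 0 := by ext; simp
  rw [this]
  congr 1
  ext u
  rw [add_sub_cancel_right, ← mul_assoc, ← Real.exp_add]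
  congr 2; ring

theorem lap_deriv (hc : ContinuousOn ω (Set.Ici 1)) (hb : ∀ u, 0 ≤ ω u ∧ ω u ≤ 1)
    (hom : ∀ u, 1 ≤ u → u * ω u = σ (u - 1)) (t : ℝ) (ht : 0 < t) :
    HasDerivAt (fun t : ℝ => ∫ u in Set.Ioi (1:ℝ), Real.exp (-t * u) * ω u)
      (-(Real.exp (-t) * ∫ u in Set.Ioi (0:ℝ), Real.exp (-t * u) * σ u)) t := by
  have h := (hasDerivAt_integral_of_dominated_loc_of_deriv_le (μ := volume.restrict (Set.Ioi (1:ℝ)))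
    (F := fun (t u : ℝ) => Real.exp (-t * u) * ω u)
    (F' := fun (t u : ℝ) => (-u * Real.exp (-t * u)) * ω u)
    (bound := fun u => (u + 1) * Real.exp (-(t/2) * u)) (s := Set.Ioi (t/2)) (x₀ := t)
    (Ioi_mem_nhds (by linarith))
    (Filter.Eventually.of_forall fun s => om_meas ω hc _ (by fun_prop))
    (lap_om_int ω hc hb t ht) (om_meas ω hc _ (by fun_prop)) ?_
    ((lin_exp_int (t/2) (by linarith)).mono_set (Set.Ioi_subset_Ioi zero_le_one)) ?_).2
  · refine h.congr_deriv ?_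
    rw [← lap_shift, ← integral_neg]
    refine setIntegral_congr_fun measurableSet_Ioi (fun u hu => ?_)
    rw [← hom u (le_of_lt hu)]; ring
  · refine (ae_restrict_iff' measurableSet_Ioi).2 (Filter.Eventually.of_forall fun u hu s hs => ?_)
    have hu1 : (1:ℝ) < u := hu
    have hs1 : t/2 < s := hs
    obtain ⟨h1, h2⟩ := hb u
    rw [Real.norm_eq_abs, abs_mul, abs_mul, abs_neg, abs_of_pos (by linarith : 0 < u),
      abs_of_pos (Real.exp_pos _), abs_of_nonneg h1]
    calc u * Real.exp (-s * u) * ω u ≤ (u * Real.exp (-s * u)) * 1 := by gcongr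
      _ ≤ (u + 1) * Real.exp (-(t/2) * u) := by
        rw [mul_one]; gcongr; linarith
  · refine Filter.Eventually.of_forall fun u s _ => ?_
    have := (((hasDerivAt_id s).neg.mul_const u).exp).mul_const (ω u)
    refine this.congr_deriv ?_
    simp only [id, Pi.neg_apply]
    ring

theorem lap_rel (hc : ContinuousOn ω (Set.Ici 1)) (hb : ∀ u, 0 ≤ ω u ∧ ω u ≤ 1)
    (hsc : Continuous σ) (hsb : ∀ u, 0 ≤ u → 0 ≤ σ u ∧ σ u ≤ u + 1)
    (hs1 : ∀ u ≤ 1, σ u = 1) (hd : ∀ u, 1 < u → HasDerivAt σ (ω u) u)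
    (t : ℝ) (ht : 0 < t) :
    t * ∫ u in Set.Ioi (0:ℝ), Real.exp (-t * u) * σ u =
      1 + ∫ u in Set.Ioi (1:ℝ), Real.exp (-t * u) * ω u := by
  have hS := lap_sig_int σ hsc hsb t ht
  have hS1 := hS.mono_set (Set.Ioi_subset_Ioi (zero_le_one (α := ℝ)))
  have hW := lap_om_int ω hc hb t ht
  have hder : ∀ u ∈ Set.Ioi (1:ℝ), HasDerivAt (fun u => Real.exp (-t * u) * σ u)
      (Real.exp (-t * u) * ω u - t * (Real.exp (-t * u) * σ u)) u := by
    intro u hu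
    have := (((hasDerivAt_id u).const_mul (-t)).exp).mul (hd u hu)
    refine this.congr_deriv ?_
    simp only [id]; ring
  have hf' := hW.sub (hS1.const_mul t)
  have h0 := tendsto_zero_of_hasDerivAt_of_integrableOn_Ioi hder hf' hS1
  have h1 := integral_Ioi_of_hasDerivAt_of_tendsto
    (by apply Continuous.continuousWithinAt; fun_prop) hder hf' h0
  rw [integral_sub hW (hS1.const_mul t), integral_const_mul, hs1 1 le_rfl] at h1
  have h2 : ∫ u in Set.Ioc (0:ℝ) 1, Real.exp (-t * u) * σ u = (1 - Real.exp (-t)) / t := by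
    rw [setIntegral_congr_fun (g := fun u => Real.exp (-t * u)) measurableSet_Ioc
      (fun u hu => by simp only; rw [hs1 u hu.2, mul_one]),
      ← intervalIntegral.integral_of_le zero_le_one,
      intervalIntegral.integral_eq_sub_of_hasDerivAt (f := fun u => - Real.exp (-t * u) / t)]
    · simp; ring
    · intro u _
      have := (((hasDerivAt_id u).const_mul (-t)).exp).neg.div_const t
      refine this.congr_deriv ?_
      simp only [id]; field_simp
    · apply Continuous.intervalIntegrable; fun_prop
  have h3 := setIntegral_union (Set.Ioc_disjoint_Ioi le_rfl) measurableSet_Ioi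
    (hS.mono_set (fun x (hx : x ∈ Set.Ioc (0:ℝ) 1) => hx.1)) hS1
  rw [Set.Ioc_union_Ioi_eq_Ioi zero_le_one] at h3
  rw [h3, h2, mul_add, mul_div_cancel₀ _ ht.ne']
  rw [mul_one, mul_one] at h1
  linarith

open Filter Topology in
theorem lap_zero (hsc : Continuous σ) (hsb : ∀ u, 0 ≤ u → 0 ≤ σ u ∧ σ u ≤ u + 1) (l : ℝ)
    (hl : Tendsto (fun u => σ u / u) atTop (𝓝 l)) :
    Tendsto (fun n : ℕ => (1/((n:ℝ)+1))^2 * ∫ u in Set.Ioi (0:ℝ),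
      Real.exp (-(1/((n:ℝ)+1)) * u) * σ u) atTop (𝓝 l) := by
  have key : ∀ n : ℕ, (1/((n:ℝ)+1))^2 * (∫ u in Set.Ioi (0:ℝ),
      Real.exp (-(1/((n:ℝ)+1)) * u) * σ u) =
      ∫ v in Set.Ioi (0:ℝ), Real.exp (-1 * v) * (σ (((n:ℝ)+1) * v) / ((n:ℝ)+1)) := by
    intro n
    have hn : (0:ℝ) < (n:ℝ)+1 := by positivity
    have := integral_comp_mul_left_Ioi
      (fun u => Real.exp (-(1/((n:ℝ)+1)) * u) * σ u) 0 hn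
    rw [mul_zero, smul_eq_mul] at this
    have h2 : (∫ u in Set.Ioi (0:ℝ), Real.exp (-(1/((n:ℝ)+1)) * u) * σ u) =
      ((n:ℝ)+1) * ∫ x in Set.Ioi (0:ℝ),
        Real.exp (-(1/((n:ℝ)+1)) * (((n:ℝ)+1) * x)) * σ (((n:ℝ)+1) * x) := by
      rw [this]; field_simp
    rw [h2, ← mul_assoc, ← integral_const_mul]
    congr 1; ext v
    have : -(1/((n:ℝ)+1)) * (((n:ℝ)+1) * v) = -1 * v := by field_simp
    rw [this]; field_simp
  simp_rw [key]
  have hlim : ∫ v in Set.Ioi (0:ℝ), Real.exp (-1 * v) * (l * v) = l := by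
    have := Real.Gamma_eq_integral (s := 2) (by norm_num)
    rw [Real.Gamma_two] at this
    calc _ = l * ∫ v in Set.Ioi (0:ℝ), Real.exp (-v) * v ^ ((2:ℝ)-1) := by
          rw [← integral_const_mul]
          congr 1; ext v
          norm_num; ring
      _ = l := by rw [← this, mul_one]
  rw [← hlim]
  apply tendsto_integral_of_dominated_convergence (fun v => (v + 1) * Real.exp (-1 * v))
  · intro n; apply Continuous.aestronglyMeasurable; fun_prop
  · exact lin_exp_int 1 one_pos
  · intro n
    refine (ae_restrict_iff' measurableSet_Ioi).2 (Eventually.of_forall fun v hv => ?_)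
    have hv0 : (0:ℝ) < v := hv
    have hn : (0:ℝ) < (n:ℝ)+1 := by positivity
    have hn1 : (1:ℝ) ≤ (n:ℝ)+1 := by simp
    obtain ⟨h1, h2⟩ := hsb (((n:ℝ)+1) * v) (by positivity)
    rw [Real.norm_eq_abs, abs_of_nonneg (by positivity), mul_comm]
    gcongr
    rw [div_le_iff₀ hn]
    nlinarith
  · refine (ae_restrict_iff' measurableSet_Ioi).2 (Eventually.of_forall fun v hv => ?_)
    have hv0 : (0:ℝ) < v := hv
    apply Tendsto.const_mul
    have ha : Tendsto (fun n : ℕ => ((n:ℝ)+1) * v) atTop atTop :=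
      Tendsto.atTop_mul_const hv0 (tendsto_atTop_add_const_right _ _ tendsto_natCast_atTop_atTop)
    refine ((hl.comp ha).mul_const v).congr (fun n => ?_)
    have hn : (0:ℝ) < (n:ℝ)+1 := by positivity
    simp only [Function.comp]
    field_simp

open Filter Topology in
theorem lim_val (hc : ContinuousOn ω (Set.Ici 1)) (hb : ∀ u, 0 ≤ ω u ∧ ω u ≤ 1)
    (hsc : Continuous σ) (hsb : ∀ u, 0 ≤ u → 0 ≤ σ u ∧ σ u ≤ u + 1)
    (hs1 : ∀ u ≤ 1, σ u = 1) (hd : ∀ u, 1 < u → HasDerivAt σ (ω u) u)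
    (hom : ∀ u, 1 ≤ u → u * ω u = σ (u - 1)) (l : ℝ)
    (hl : Tendsto (fun u => σ u / u) atTop (𝓝 l)) :
    l = Real.exp (-Real.eulerMascheroniConstant) := by
  obtain ⟨W, hW⟩ : ∃ W : ℝ → ℝ, W = fun t : ℝ => ∫ u in Set.Ioi (1:ℝ), Real.exp (-t * u) * ω u :=
    ⟨_, rfl⟩
  obtain ⟨S, hS⟩ : ∃ S : ℝ → ℝ, S = fun t : ℝ => ∫ u in Set.Ioi (0:ℝ), Real.exp (-t * u) * σ u :=
    ⟨_, rfl⟩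
  obtain ⟨J, hJ⟩ : ∃ J : ℝ → ℝ, J = fun t : ℝ => ∫ u in (0:ℝ)..t, phi u := ⟨_, rfl⟩
  have hWd : ∀ t, 0 < t → HasDerivAt W (-(Real.exp (-t) * S t)) t := by
    intro t ht; rw [hW, hS]; exact lap_deriv ω σ hc hb hom t ht
  have hrel : ∀ t, 0 < t → t * S t = 1 + W t := by
    intro t ht; rw [hW, hS]; exact lap_rel ω σ hc hb hsc hsb hs1 hd t ht
  have hJd : ∀ t, HasDerivAt J (phi t) t := by
    intro t; rw [hJ]; exact phi_cont.integral_hasStrictDerivAt 0 t |>.hasDerivAt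
  have hz : Tendsto (fun n : ℕ => (1/((n:ℝ)+1))^2 * S (1/((n:ℝ)+1))) atTop (𝓝 l) := by
    rw [hS]; exact lap_zero σ hsc hsb l hl
  have hWinf : Tendsto (fun n : ℕ => W n) atTop (𝓝 0) := by
    apply squeeze_zero_norm' _ tendsto_one_div_atTop_nhds_zero_nat
    filter_upwards [eventually_gt_atTop 0] with n hn
    have hn0 : (0:ℝ) < n := by exact_mod_cast hn
    have hi := integral_exp_mul_Ioi (a := -(n:ℝ)) (by linarith) 1
    have h1 : ‖W n‖ ≤ ∫ u in Set.Ioi (1:ℝ), Real.exp (-(n:ℝ) * u) := by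
      rw [hW]
      apply norm_integral_le_of_norm_le (exp_neg_integrableOn_Ioi 1 hn0)
      refine Eventually.of_forall fun u => ?_
      obtain ⟨h1, h2⟩ := hb u
      rw [Real.norm_eq_abs, abs_of_nonneg (by positivity)]
      exact mul_le_of_le_one_right (Real.exp_pos _).le h2
    rw [hi, neg_div_neg_eq] at h1
    refine h1.trans ?_
    gcongr
    rw [Real.exp_le_one_iff]; linarith
  have hAd : ∀ t, 0 < t → HasDerivAt (fun t => t * (1 + W t) * Real.exp (-J t)) 0 t := by
    intro t ht
    have := ((hasDerivAt_id t).mul ((hWd t ht).const_add 1)).mul (hJd t).neg.exp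
    refine this.congr_deriv ?_
    have h1 := hrel t ht
    have h2 := phi_mul t
    simp only [id, Pi.mul_apply, Pi.neg_apply]
    rw [← h1]
    linear_combination (-(t * S t) * Real.exp (-J t)) * h2
  have hconst : ∀ t, 0 < t → t * (1 + W t) * Real.exp (-J t) = 1 * (1 + W 1) * Real.exp (-J 1) := by
    intro t ht
    refine isOpen_Ioi.is_const_of_deriv_eq_zero (𝕜 := ℝ) (s := Set.Ioi 0) isPreconnected_Ioi
      (f := fun t => t * (1 + W t) * Real.exp (-J t))
      (fun x hx => (hAd x hx).differentiableAt.differentiableWithinAt)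
      (fun x hx => (hAd x hx).deriv) ht (Set.mem_Ioi.2 one_pos)
  generalize 1 * (1 + W 1) * Real.exp (-J 1) = c at hconst
  have hc1 : c = Real.exp (-Real.eulerMascheroniConstant) := by
    have h1 := (Real.continuous_exp.tendsto _).comp gam_lim
    have h2 := (hWinf.const_add 1).mul h1
    rw [add_zero, one_mul] at h2
    refine tendsto_nhds_unique (tendsto_const_nhds.congr' ?_) h2
    filter_upwards [eventually_gt_atTop 0] with n hn
    have hn0 : (0:ℝ) < n := by exact_mod_cast hn
    rw [← hconst n hn0, hJ]
    simp only [Function.comp]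
    rw [sub_eq_add_neg, Real.exp_add, Real.exp_log hn0]; ring
  have hc2 : c = l := by
    have hJ0 : Tendsto (fun n : ℕ => Real.exp (-J (1/((n:ℝ)+1)))) atTop (𝓝 1) := by
      have hcont : ContinuousAt (fun t => Real.exp (-J t)) 0 := ((hJd 0).continuousAt.neg).rexp
      have h0 : Real.exp (-J 0) = 1 := by rw [hJ]; simp
      have := hcont.tendsto.comp tendsto_one_div_add_atTop_nhds_zero_nat
      rw [h0] at this
      exact this
    have h2 := hz.mul hJ0
    rw [mul_one] at h2
    refine tendsto_nhds_unique (tendsto_const_nhds.congr (fun n => ?_)) h2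
    have hn : (0:ℝ) < 1/((n:ℝ)+1) := by positivity
    rw [← hconst _ hn, ← hrel _ hn]; ring
  rw [← hc2, hc1]
end laplace

theorem s_zero (y : ℝ) (hy : 2 ≤ y) (u : ℝ) (hu0 : 0 ≤ u) (hu : u < 1) :
    roughHarmonic (y^u) y = 1 := by
  have h1 : 1 ≤ y^u := Real.one_le_rpow (by linarith) hu0
  have h2 : y^u < y := by
    conv_rhs => rw [← Real.rpow_one y]
    exact Real.rpow_lt_rpow_of_exponent_lt (by linarith) hu
  rw [roughHarmonic]
  have : (Finset.Icc 1 ⌊y^u⌋₊).filter (fun n => n = 1 ∨ y < (n.minFac : ℝ)) = {1} := by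
    ext n
    simp only [Finset.mem_filter, Finset.mem_Icc, Finset.mem_singleton]
    constructor
    · rintro ⟨⟨ha, hb⟩, h | h⟩
      · exact h
      · exfalso
        have h3 : (n:ℝ) ≤ y^u := (Nat.le_floor_iff (by linarith)).1 hb
        have h4 : (n.minFac : ℝ) ≤ n := by exact_mod_cast Nat.minFac_le ha
        linarith
    · rintro rfl
      exact ⟨⟨le_rfl, (Nat.le_floor_iff (by linarith)).2 (by simpa using h1)⟩, Or.inl rfl⟩
  rw [this]; simp

/-- The right-continuous error, cut off to the left of zero. -/
theorem main_D (ω : ℝ → ℝ)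
    (hω0 : ∀ u : ℝ, u < 1 → ω u = 0)
    (hω : ∀ u : ℝ, 1 ≤ u → u * ω u = 1 + ∫ t in (1:ℝ)..(u - 1), ω t) (σ : ℝ → ℝ)
    (hσ : σ = fun u => 1 + ∫ t in (0:ℝ)..u, ω t) :
    ∃ K : ℝ, 0 ≤ K ∧ ∀ y : ℝ, 2 ≤ y → ∃ c : ℝ, ∀ u : ℝ, 0 ≤ u →
      |roughHarmonic (y^u) y - σ u - c * u| ≤ 17 * (K / Real.log y) := by
  obtain ⟨hb, hi, hc, hsc, hs1, hom, _, hd, hse, hsb⟩ := sig_facts ω hω0 hω σ hσ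
  obtain ⟨K, hK0, hK⟩ := s_eq
  refine ⟨K, hK0, fun y hy => ?_⟩
  have hlog : 0 < Real.log y := Real.log_pos (by linarith)
  have hmax : Continuous (fun u : ℝ => max u 0) := by fun_prop
  have hmono : Monotone (fun u : ℝ => roughHarmonic (y^(max u 0)) y) :=
    fun a b hab => s_mono y hy (max_le_max hab le_rfl)
  have hint : ∀ a b, IntervalIntegrable (fun u : ℝ => roughHarmonic (y^(max u 0)) y) volume a b :=
    fun a b => hmono.intervalIntegrable
  have heq : ∀ u : ℝ, 0 ≤ u → ∫ v in (0:ℝ)..u, (roughHarmonic (y^(max v 0)) y - σ v) =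
      (∫ v in (0:ℝ)..u, roughHarmonic (y^v) y) - ∫ v in (0:ℝ)..u, σ v := by
    intro u hu
    rw [intervalIntegral.integral_sub (hint _ _) (hsc.intervalIntegrable _ _)]
    congr 1
    apply intervalIntegral.integral_congr
    intro v hv
    rw [Set.uIcc_of_le hu] at hv
    simp only [max_eq_left hv.1]
  have hA : ∀ u, ContinuousWithinAt (fun u => roughHarmonic (y^(max u 0)) y - σ u)
      (Set.Ici u) u := by
    intro u
    refine ContinuousWithinAt.sub ?_ hsc.continuousWithinAt
    exact (s_rc y hy (max u 0)).comp (f := fun u : ℝ => max u 0) hmax.continuousWithinAt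
      (fun v hv => Set.mem_Ici.2 (max_le_max (Set.mem_Ici.1 hv) le_rfl))
  have hB : ∀ u < 1, (fun u => roughHarmonic (y^(max u 0)) y - σ u) u = 0 := by
    intro u hu
    simp only
    rw [s_zero y hy _ (le_max_right _ _) (max_lt hu one_pos), hs1 u hu.le, sub_self]
  obtain ⟨c, hcc⟩ := stab (fun u => roughHarmonic (y^(max u 0)) y - σ u) (K / Real.log y)
    (by positivity) (fun a b => (hint a b).sub (hsc.intervalIntegrable _ _)) hA hB (by
    intro u hu
    have h1 := hK y hy u hu
    have h2 := hse u hu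
    rw [heq u (by linarith), heq (u-1) (by linarith)]
    simp only [max_eq_left (by linarith : (0:ℝ) ≤ u)]
    refine le_trans (le_of_eq ?_) h1
    congr 1
    linear_combination -h2)
  refine ⟨c, fun u hu => ?_⟩
  have := hcc u hu
  simpa only [max_eq_left hu] using this

open Filter Topology in
theorem lin_lim (f : ℝ → ℝ) (M c : ℝ) (h : ∀ u, 0 ≤ u → |f u - c * u| ≤ M) :
    Tendsto (fun u => f u / u) atTop (𝓝 c) := by
  have h1 : Tendsto (fun u : ℝ => (f u - c * u) / u) atTop (𝓝 0) := by
    have h2 : Tendsto (fun u : ℝ => M / u) atTop (𝓝 0) := tendsto_const_nhds.div_atTop tendsto_id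
    apply squeeze_zero_norm' _ h2
    filter_upwards [eventually_gt_atTop 0] with u hu
    rw [norm_div, Real.norm_eq_abs, Real.norm_eq_abs, abs_of_pos hu]
    gcongr
    exact h u hu.le
  have h3 := h1.add_const c
  rw [zero_add] at h3
  refine h3.congr' ?_
  filter_upwards [eventually_gt_atTop 0] with u hu
  field_simp
  ring

theorem rough_harmonic_sum (ω : ℝ → ℝ)
    (hω0 : ∀ u : ℝ, u < 1 → ω u = 0)
    (hω : ∀ u : ℝ, 1 ≤ u → u * ω u = 1 + ∫ t in (1:ℝ)..(u - 1), ω t) :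
    ∃ C : ℝ, ∀ x y : ℝ, 1 ≤ x → 2 ≤ y →
      |roughHarmonic x y - 1 - Real.log x * primeProd y -
          ∫ v in (0:ℝ)..(Real.log x / Real.log y),
            (ω v - Real.exp (-Real.eulerMascheroniConstant))| ≤ C / Real.log y := by
  obtain ⟨σ, hσ⟩ : ∃ σ : ℝ → ℝ, σ = fun u => 1 + ∫ t in (0:ℝ)..u, ω t := ⟨_, rfl⟩
  obtain ⟨hb, hi, hc, hsc, hs1, hom, _, hd, hse, hsb⟩ := sig_facts ω hω0 hω σ hσ
  obtain ⟨K, hK0, hK⟩ := main_D ω hω0 hω σ hσ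
  refine ⟨17 * K, fun x y hx hy => ?_⟩
  obtain ⟨c, hcc⟩ := hK y hy
  have hlog : 0 < Real.log y := Real.log_pos (by linarith)
  have hl1 := (s_lim y hy).sub (lin_lim (fun u => roughHarmonic (y^u) y - σ u) _ c hcc)
  have hl := lim_val ω σ hc hb hsc hsb hs1 hd hom _ (hl1.congr (fun u => by ring))
  have hu0 : 0 ≤ Real.log x / Real.log y := div_nonneg (Real.log_nonneg hx) hlog.le
  have hxu : y ^ (Real.log x / Real.log y) = x := by
    rw [Real.rpow_def_of_pos (by linarith), mul_div_cancel₀ _ hlog.ne', Real.exp_log (by linarith)]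
  have h1 := hcc _ hu0
  rw [hxu] at h1
  rw [intervalIntegral.integral_sub (hi _ _) intervalIntegrable_const, ← hl]
  have h2 : σ (Real.log x / Real.log y) = 1 + ∫ t in (0:ℝ)..(Real.log x / Real.log y), ω t := by
    rw [hσ]
  rw [intervalIntegral.integral_const, smul_eq_mul, sub_zero]
  refine le_trans (le_of_eq ?_) (h1.trans (le_of_eq (by ring)))
  congr 1
  rw [h2]
  field_simp
  ring
end

section
/- Suppose θ : ℕ → ℝ∪{∞} satisfies θ(1) ≥ 2 and θ(n) ≥ P^+(n) for all n ≥ 2. Then the series L = Σ_{n ∈ B_θ} (τ(n)/n) ∏_{p ≤ θ(n), p prime} (1 − 1/p)² converges to a value L ∈ [0,1], and Σ_{n ∈ B_θ, n ≤ x} τ(n) = (1 − L) x log x + o(x log x) as x → ∞; that is, for every ε > 0 there exists x₀ such that |Σ_{n ∈ B_θ, n ≤ x} τ(n) − (1−L) x log x| ≤ ε x log x for all x ≥ x₀. In particular, L = 1 if and only if Σ_{n ∈ B_θ, n ≤ x} τ(n) = o(x log x). -/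
open Real MeasureTheory
open scoped Classical

/-- The set `B_θ` for `θ : ℕ → ℝ ∪ {∞}` (i.e. `EReal`-valued): `1 ∈ B_θ`, and
`n = p₁^{α₁}⋯p_k^{α_k}` (with `p₁ < ⋯ < p_k`) belongs to `B_θ` iff
`p_i ≤ θ(p₁^{α₁}⋯p_{i-1}^{α_{i-1}})` for all `i`. -/
def BsetE (θ : ℕ → EReal) : Set ℕ :=
  {n | 0 < n ∧ ∀ p : ℕ, p.Prime → p ∣ n →
    (((p : ℝ) : EReal)) ≤ θ (∏ q ∈ n.primeFactors.filter (· < p), q ^ n.factorization q)}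

/-- `∏_{p ≤ y, p prime} (1 - 1/p)²`, as an (unconditionally convergent) infinite product,
so that it equals `0` when `y = ∞`. -/
noncomputable def ePrimeProdSq (y : EReal) : ℝ :=
  ∏' p : {p : ℕ // p.Prime ∧ ((p : ℝ) : EReal) ≤ y}, (1 - 1 / ((p : ℕ) : ℝ)) ^ 2

/-- The general term `τ(n)/n ∏_{p ≤ θ(n)} (1-1/p)²` of the series defining `L`. -/
noncomputable def Lterm (θ : ℕ → EReal) (n : ℕ) : ℝ :=
  ((n.divisors.card : ℝ) / n) * ePrimeProdSq (θ n)

/-- `L = ∑_{n ∈ B_θ} τ(n)/n ∏_{p ≤ θ(n)} (1-1/p)²`. -/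
noncomputable def Lconst (θ : ℕ → EReal) : ℝ :=
  ∑' n : BsetE θ, Lterm θ n

/-- `T x = ∑_{n ∈ B_θ, n ≤ x} τ(n)`. -/
noncomputable def Tθ (θ : ℕ → EReal) (x : ℝ) : ℝ :=
  ∑ n ∈ (Finset.Icc 1 ⌊x⌋₊).filter (fun n => n ∈ BsetE θ), (n.divisors.card : ℝ)


def rough (k a : ℕ) : Prop := ∀ p : ℕ, p.Prime → p ∣ a → k < p

noncomputable def RS (k N : ℕ) : Finset ℕ := (Finset.Icc 1 N).filter (rough k)

noncomputable def Pk (k : ℕ) : ℝ := ∏ p ∈ (Finset.range (k+1)).filter Nat.Prime, (1 - 1/(p:ℝ))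

lemma mem_RS {k N a : ℕ} : a ∈ RS k N ↔ (1 ≤ a ∧ a ≤ N) ∧ rough k a := by
  simp [RS]

lemma rough_mul {k a b : ℕ} : rough k (a*b) ↔ rough k a ∧ rough k b := by
  constructor
  · intro h
    exact ⟨fun p hp hd => h p hp (hd.mul_right b), fun p hp hd => h p hp (hd.mul_left a)⟩
  · rintro ⟨h1, h2⟩ p hp hd
    rcases (Nat.Prime.dvd_mul hp).1 hd with h | h
    · exact h1 p hp h
    · exact h2 p hp h

lemma rough_one (k : ℕ) : rough k 1 := by
  intro p hp hd
  exact absurd (Nat.dvd_one.1 hd) hp.one_lt.ne'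

lemma hyper (F : ℕ → ℕ → ℝ) (N : ℕ) :
    ∑ n ∈ Finset.Icc 1 N, ∑ d ∈ n.divisorsAntidiagonal, F d.1 d.2
      = ∑ a ∈ Finset.Icc 1 N, ∑ b ∈ Finset.Icc 1 (N / a), F a b := by
  rw [Finset.sum_sigma', Finset.sum_sigma']
  refine Finset.sum_bij' (fun x _ => ⟨x.2.1, x.2.2⟩) (fun y _ => ⟨y.1 * y.2, (y.1, y.2)⟩) ?_ ?_ ?_ ?_ ?_
  · rintro ⟨n, a, b⟩ h
    simp only [Finset.mem_sigma, Finset.mem_Icc, Nat.mem_divisorsAntidiagonal] at h ⊢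
    obtain ⟨⟨h1, h2⟩, h3, h4⟩ := h
    have ha : 0 < a := Nat.pos_of_ne_zero (by rintro rfl; simp at h3; omega)
    have hb : 0 < b := Nat.pos_of_ne_zero (by rintro rfl; simp at h3; omega)
    refine ⟨⟨ha, ?_⟩, hb, ?_⟩
    · nlinarith
    · rw [Nat.le_div_iff_mul_le ha]; nlinarith
  · rintro ⟨a, b⟩ h
    simp only [Finset.mem_sigma, Finset.mem_Icc, Nat.mem_divisorsAntidiagonal] at h ⊢
    obtain ⟨⟨h1, h2⟩, h3, h4⟩ := h
    rw [Nat.le_div_iff_mul_le (by omega)] at h4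
    have : 0 < a * b := by positivity
    refine ⟨⟨this, by nlinarith⟩, trivial, this.ne'⟩
  · rintro ⟨n, a, b⟩ h
    simp only [Finset.mem_sigma, Finset.mem_Icc, Nat.mem_divisorsAntidiagonal] at h ⊢
    obtain ⟨⟨h1, h2⟩, h3, h4⟩ := h
    subst h3; rfl
  · rintro ⟨a, b⟩ h
    rfl
  · rintro ⟨n, a, b⟩ h
    rfl

lemma hyper_swap (F : ℕ → ℕ → ℝ) (N : ℕ) :
    ∑ a ∈ Finset.Icc 1 N, ∑ b ∈ Finset.Icc 1 (N / a), F a b =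
    ∑ a ∈ Finset.Icc 1 N, ∑ b ∈ Finset.Icc 1 (N / a), F b a := by
  rw [← hyper, ← hyper (fun a b => F b a)]
  refine Finset.sum_congr rfl fun n _ => ?_
  rw [← Nat.map_swap_divisorsAntidiagonal, Finset.sum_map]
  simp

/-- rough version -/
lemma hyperR (F : ℕ → ℕ → ℝ) (k N : ℕ) :
    ∑ n ∈ RS k N, ∑ d ∈ n.divisorsAntidiagonal, F d.1 d.2
      = ∑ a ∈ RS k N, ∑ b ∈ RS k (N / a), F a b := by
  have h := hyper (fun a b => if rough k a then (if rough k b then F a b else 0) else 0) N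
  unfold RS
  rw [Finset.sum_filter, Finset.sum_filter]
  simp_rw [Finset.sum_filter]
  convert h using 2 with n hn a ha
  · split_ifs with hr
    · refine Finset.sum_congr rfl fun d hd => ?_
      rw [← (Nat.mem_divisorsAntidiagonal.1 hd).1, rough_mul] at hr
      simp [hr.1, hr.2]
    · symm
      refine Finset.sum_eq_zero fun d hd => ?_
      rw [← (Nat.mem_divisorsAntidiagonal.1 hd).1, rough_mul] at hr
      split_ifs <;> simp_all
  · split_ifs <;> simp

lemma hyperR_swap (F : ℕ → ℕ → ℝ) (k N : ℕ) :
    ∑ a ∈ RS k N, ∑ b ∈ RS k (N / a), F a b = ∑ a ∈ RS k N, ∑ b ∈ RS k (N / a), F b a := by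
  rw [← hyperR, ← hyperR (fun a b => F b a)]
  refine Finset.sum_congr rfl fun n _ => ?_
  rw [← Nat.map_swap_divisorsAntidiagonal, Finset.sum_map]
  simp

lemma rough_succ_not {k : ℕ} (hp : ¬ (k+1).Prime) (a : ℕ) : rough (k+1) a ↔ rough k a := by
  constructor
  · intro h p hpp hd
    have := h p hpp hd; omega
  · intro h p hpp hd
    have h1 := h p hpp hd
    have : p ≠ k + 1 := by rintro rfl; exact hp hpp
    omega

lemma rough_succ {k : ℕ} (hp : (k+1).Prime) (a : ℕ) : rough (k+1) a ↔ rough k a ∧ ¬ (k+1) ∣ a := by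
  constructor
  · intro h
    refine ⟨fun p hpp hd => ?_, fun hd => ?_⟩
    · have := h p hpp hd; omega
    · have := h _ hp hd; omega
  · rintro ⟨h, hn⟩ p hpp hd
    have h1 := h p hpp hd
    have : p ≠ k + 1 := by rintro rfl; exact hn hd
    omega

lemma rough_prime {k : ℕ} (hp : (k+1).Prime) : rough k (k+1) := by
  intro p hpp hd
  rw [(Nat.prime_dvd_prime_iff_eq hpp hp).1 hd]; omega

lemma Pk_succ {k : ℕ} (hp : (k+1).Prime) : Pk (k+1) = Pk k * (1 - 1/((k+1 : ℕ):ℝ)) := by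
  unfold Pk
  rw [Finset.range_add_one (n := k+1), Finset.filter_insert, if_pos hp, Finset.prod_insert (by simp), mul_comm]

lemma Pk_succ_not {k : ℕ} (hp : ¬ (k+1).Prime) : Pk (k+1) = Pk k := by
  unfold Pk
  rw [Finset.range_add_one (n := k+1), Finset.filter_insert, if_neg hp]

lemma Pk_zero : Pk 0 = 1 := by
  unfold Pk
  simp [Finset.filter_singleton, Nat.not_prime_zero]

lemma Pk_pos (k : ℕ) : 0 < Pk k := by
  unfold Pk
  refine Finset.prod_pos fun p hp => ?_
  have : 1 < p := (Finset.mem_filter.1 hp).2.one_lt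
  have : (1:ℝ) < p := by exact_mod_cast this
  have : 1 / (p:ℝ) < 1 := by rw [div_lt_one] <;> linarith
  linarith

lemma RS_zero (N : ℕ) : RS 0 N = Finset.Icc 1 N := by
  unfold RS
  rw [Finset.filter_true_of_mem]
  intro a _ p hp _
  exact hp.pos

lemma RS_succ_not {k : ℕ} (hp : ¬ (k+1).Prime) (N : ℕ) : RS (k+1) N = RS k N := by
  unfold RS
  exact Finset.filter_congr fun a _ => rough_succ_not hp a

lemma RS_step {k : ℕ} (hp : (k+1).Prime) (N : ℕ) (f : ℕ → ℝ) :
    ∑ a ∈ RS (k+1) N, f a = ∑ a ∈ RS k N, f a - ∑ b ∈ RS k (N/(k+1)), f ((k+1)*b) := by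
  have h1 : RS (k+1) N = (RS k N).filter (fun a => ¬ (k+1) ∣ a) := by
    ext a
    simp only [mem_RS, Finset.mem_filter, rough_succ hp]
    tauto
  have h2 : ∑ b ∈ RS k (N/(k+1)), f ((k+1)*b) = ∑ a ∈ (RS k N).filter (fun a => (k+1) ∣ a), f a := by
    refine Finset.sum_bij (fun b _ => (k+1)*b) ?_ ?_ ?_ ?_
    · intro b hb
      rw [mem_RS] at hb
      rw [Finset.mem_filter, mem_RS, rough_mul]
      obtain ⟨⟨h1, h2⟩, h3⟩ := hb
      rw [Nat.le_div_iff_mul_le (by omega)] at h2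
      exact ⟨⟨⟨by nlinarith, by linarith⟩, rough_prime hp, h3⟩, dvd_mul_right _ _⟩
    · intro a _ b _ h
      exact Nat.eq_of_mul_eq_mul_left (by omega) h
    · intro a ha
      rw [Finset.mem_filter, mem_RS] at ha
      obtain ⟨⟨⟨h1, h2⟩, h3⟩, c, rfl⟩ := ha
      refine ⟨c, ?_, rfl⟩
      rw [mem_RS]
      rw [Nat.le_div_iff_mul_le (by omega)]
      exact ⟨⟨Nat.pos_of_ne_zero (by rintro rfl; simp at h1), by linarith⟩, (rough_mul.1 h3).2⟩
    · intro _ _; rfl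
  rw [h1, h2, ← Finset.sum_filter_add_sum_filter_not (RS k N) (fun a => (k+1) ∣ a)]
  ring

lemma countR (k : ℕ) : ∃ K : ℝ, 0 ≤ K ∧ ∀ x : ℝ, 0 ≤ x → |((RS k ⌊x⌋₊).card : ℝ) - Pk k * x| ≤ K := by
  induction k with
  | zero =>
    refine ⟨1, by norm_num, fun x hx => ?_⟩
    rw [RS_zero, Pk_zero]
    simp only [Nat.card_Icc, Nat.add_sub_cancel, one_mul]
    rw [abs_le]
    constructor <;> linarith [Nat.floor_le hx, Nat.lt_floor_add_one x]
  | succ k ih =>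
    obtain ⟨K, hK, ih⟩ := ih
    by_cases hp : (k+1).Prime
    · refine ⟨2*K, by positivity, fun x hx => ?_⟩
      have h := RS_step hp ⌊x⌋₊ (fun _ => 1)
      simp only [Finset.sum_const, nsmul_eq_mul, mul_one] at h
      rw [h, Pk_succ hp, ← Nat.floor_div_natCast]
      have h1 := abs_le.1 (ih x hx)
      have h2 := abs_le.1 (ih (x / ((k+1:ℕ):ℝ)) (by positivity))
      have : Pk k * (1 - 1/((k+1 : ℕ):ℝ)) * x = Pk k * x - Pk k * (x / ((k+1:ℕ):ℝ)) := by ring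
      rw [this, abs_le]
      constructor <;> linarith
    · refine ⟨K, hK, ?_⟩
      simpa only [RS_succ_not hp, Pk_succ_not hp] using ih

lemma harmR (k : ℕ) : ∃ K : ℝ, 0 ≤ K ∧ ∀ x : ℝ, 1 ≤ x →
    |∑ a ∈ RS k ⌊x⌋₊, 1/(a:ℝ) - Pk k * Real.log x| ≤ K := by
  induction k with
  | zero =>
    refine ⟨1, by norm_num, fun x hx => ?_⟩
    rw [RS_zero, Pk_zero]
    have h1 := log_le_harmonic_floor x (by linarith)
    have h2 := harmonic_floor_le_one_add_log x hx
    have h3 : ((harmonic ⌊x⌋₊ : ℚ) : ℝ) = ∑ a ∈ Finset.Icc 1 ⌊x⌋₊, 1/(a:ℝ) := by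
      rw [harmonic_eq_sum_Icc]; push_cast; simp
    rw [h3] at h1 h2
    rw [abs_le]
    constructor <;> linarith
  | succ k ih =>
    obtain ⟨K, hK, ih⟩ := ih
    by_cases hp : (k+1).Prime
    · have hq0 : (0:ℝ) < ((k+1:ℕ):ℝ) := by positivity
      have hq1 : (1:ℝ) ≤ ((k+1:ℕ):ℝ) := by exact_mod_cast hp.one_lt.le
      set q : ℝ := ((k+1:ℕ):ℝ) with hq
      have hlq : 0 ≤ Real.log q := Real.log_nonneg hq1
      have hP := Pk_pos k
      refine ⟨2*K + 2 * (Pk k * Real.log q), by positivity, fun x hx => ?_⟩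
      have h := RS_step hp ⌊x⌋₊ (fun a => 1/(a:ℝ))
      have e1 : ∑ b ∈ RS k (⌊x⌋₊/(k+1)), 1/(((k+1)*b : ℕ):ℝ) =
          (1/q) * ∑ b ∈ RS k ⌊x/q⌋₊, 1/(b:ℝ) := by
        rw [hq, Nat.floor_div_natCast, Finset.mul_sum]
        refine Finset.sum_congr rfl fun b _ => ?_
        push_cast
        field_simp
      rw [h, Pk_succ hp, e1, ← hq]
      have h1 := abs_le.1 (ih x hx)
      have h2 : |∑ b ∈ RS k ⌊x/q⌋₊, 1/(b:ℝ) - Pk k * Real.log (x/q)| ≤ K + Pk k * Real.log q := by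
        by_cases hxq : 1 ≤ x/q
        · have := ih _ hxq
          have : 0 ≤ Pk k * Real.log q := by positivity
          linarith
        · push Not at hxq
          have : ⌊x/q⌋₊ = 0 := Nat.floor_eq_zero.2 hxq
          rw [this]
          have : RS k 0 = ∅ := by ext a; simp [mem_RS]; omega
          rw [this, Real.log_div (by linarith) (by linarith)]
          have h5 : Real.log x ≤ Real.log q := Real.log_le_log (by linarith) (by rw [div_lt_one hq0] at hxq; linarith)
          have h6 : 0 ≤ Real.log x := Real.log_nonneg hx
          simp only [Finset.sum_empty]
          rw [abs_le]; constructor <;> nlinarith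
      rw [Real.log_div (by linarith) (by linarith)] at h2
      set S1 := ∑ a ∈ RS k ⌊x⌋₊, 1/(a:ℝ)
      set S2 := ∑ b ∈ RS k ⌊x/q⌋₊, 1/(b:ℝ)
      have e : S1 - 1/q * S2 - Pk k * (1 - 1/q) * Real.log x =
        (S1 - Pk k * Real.log x) - (1/q) * (S2 - Pk k * (Real.log x - Real.log q)) + (1/q) * (Pk k * Real.log q) := by ring
      rw [e]
      have hq2 : 1/q ≤ 1 := by rw [div_le_one hq0]; exact hq1
      have hq3 : 0 ≤ 1/q := by positivity
      have h3 : |(1/q) * (S2 - Pk k * (Real.log x - Real.log q))| ≤ K + Pk k * Real.log q := by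
        rw [abs_mul, abs_of_nonneg hq3]
        calc _ ≤ 1 * |S2 - Pk k * (Real.log x - Real.log q)| := by gcongr
          _ ≤ _ := by linarith
      have h4 : (1/q) * (Pk k * Real.log q) ≤ Pk k * Real.log q := by
        have : 0 ≤ Pk k * Real.log q := by positivity
        nlinarith
      have h5 : 0 ≤ (1/q) * (Pk k * Real.log q) := by positivity
      have h3 := abs_le.1 h3
      rw [abs_le]; constructor <;> linarith [h3.1, h3.2, h1.1, h1.2]
    · refine ⟨K, hK, ?_⟩
      simpa only [RS_succ_not hp, Pk_succ_not hp] using ih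

noncomputable def SR (k N : ℕ) : ℝ := ∑ r ∈ RS k N, (r.divisors.card : ℝ)

lemma SR_eq (k N : ℕ) : SR k N = ∑ a ∈ RS k N, ((RS k (N/a)).card : ℝ) := by
  have h := hyperR (fun _ _ => 1) k N
  simp only [Finset.sum_const, nsmul_eq_mul, mul_one] at h
  rw [← h]
  unfold SR
  refine Finset.sum_congr rfl fun n _ => ?_
  rw [← Nat.map_div_right_divisors, Finset.card_map]

lemma SR_asymp (k : ℕ) : ∃ K : ℝ, 0 ≤ K ∧ ∀ x : ℝ, 1 ≤ x →
    |SR k ⌊x⌋₊ - Pk k ^ 2 * (x * Real.log x)| ≤ K * x := by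
  obtain ⟨K1, hK1, h1⟩ := countR k
  obtain ⟨K2, hK2, h2⟩ := harmR k
  have hP := Pk_pos k
  refine ⟨K1 + Pk k * K2, by positivity, fun x hx => ?_⟩
  have hx0 : 0 < x := by linarith
  have e : SR k ⌊x⌋₊ - Pk k ^ 2 * (x * Real.log x) =
     ∑ a ∈ RS k ⌊x⌋₊, (((RS k ⌊x / a⌋₊).card : ℝ) - Pk k * (x / a)) +
     Pk k * x * (∑ a ∈ RS k ⌊x⌋₊, 1/(a:ℝ) - Pk k * Real.log x) := by
    rw [SR_eq, Finset.sum_sub_distrib, mul_sub, Finset.mul_sum]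
    have : ∀ a : ℕ, Pk k * (x/a) = Pk k * x * (1/(a:ℝ)) := fun a => by ring
    simp_rw [this, Nat.floor_div_natCast]
    ring
  rw [e]
  refine (abs_add_le _ _).trans ?_
  have b1 : |∑ a ∈ RS k ⌊x⌋₊, (((RS k ⌊x / a⌋₊).card : ℝ) - Pk k * (x / a))| ≤ K1 * x := by
    refine (Finset.abs_sum_le_sum_abs _ _).trans ?_
    refine (Finset.sum_le_sum (fun (a:ℕ) _ => h1 (x/a) (div_nonneg hx0.le (Nat.cast_nonneg a)))).trans ?_
    rw [Finset.sum_const, nsmul_eq_mul, mul_comm]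
    gcongr
    have : (RS k ⌊x⌋₊).card ≤ ⌊x⌋₊ := by
      unfold RS
      refine (Finset.card_filter_le _ _).trans ?_
      simp
    refine le_trans (by exact_mod_cast this) (Nat.floor_le (by linarith))
  have b2 : |Pk k * x * (∑ a ∈ RS k ⌊x⌋₊, 1/(a:ℝ) - Pk k * Real.log x)| ≤ Pk k * K2 * x := by
    rw [abs_mul, abs_of_nonneg (show 0 ≤ Pk k * x by positivity)]
    have := h2 x hx
    calc _ ≤ Pk k * x * K2 := by gcongr
      _ = _ := by ring
  linarith


open ArithmeticFunction in
lemma psi_nat (N : ℕ) : ∑ d ∈ Finset.Icc 1 N, vonMangoldt d ≤ 6 * (N:ℝ) := by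
  have h := Chebyshev.psi_le_const_mul_self (x := (N:ℝ)) (by positivity)
  rw [Chebyshev.psi, Nat.floor_natCast] at h
  have h4 : Real.log 4 ≤ 2 := by
    have : Real.log 4 = 2 * Real.log 2 := by
      rw [show (4:ℝ) = 2^2 by norm_num, Real.log_pow]; norm_num
    have := Real.log_two_lt_d9
    linarith
  have e : Finset.Icc 1 N = Finset.Ioc 0 N := by ext; simp; omega
  rw [e]
  refine h.trans ?_
  gcongr; linarith

open ArithmeticFunction in
lemma log_eq_antidiag (n : ℕ) : Real.log n = ∑ d ∈ n.divisorsAntidiagonal, vonMangoldt d.2 := by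
  rw [← vonMangoldt_sum, ← Nat.map_div_left_divisors, Finset.sum_map]
  rfl

open ArithmeticFunction in
lemma mertens1_s17 (N : ℕ) (hN : 1 ≤ N) :
    ∑ p ∈ (Finset.range (N+1)).filter Nat.Prime, Real.log p / p ≤ Real.log N + 6 := by
  have hN0 : (0:ℝ) < N := by exact_mod_cast hN
  have h1 := hyper (fun _ d => vonMangoldt d) N
  rw [hyper_swap] at h1
  simp_rw [← log_eq_antidiag] at h1
  simp only [Finset.sum_const, Nat.card_Icc, Nat.add_sub_cancel, nsmul_eq_mul] at h1
  have h2 : ∑ n ∈ Finset.Icc 1 N, Real.log n ≤ N * Real.log N := by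
    refine (Finset.sum_le_card_nsmul _ _ (Real.log N) ?_).trans ?_
    · intro n hn
      rw [Finset.mem_Icc] at hn
      exact Real.log_le_log (by exact_mod_cast hn.1) (by exact_mod_cast hn.2)
    · simp
  have h3 : N * ∑ d ∈ Finset.Icc 1 N, vonMangoldt d / d ≤
      ∑ d ∈ Finset.Icc 1 N, ((N/d : ℕ):ℝ) * vonMangoldt d + ∑ d ∈ Finset.Icc 1 N, vonMangoldt d := by
    rw [Finset.mul_sum, ← Finset.sum_add_distrib]
    refine Finset.sum_le_sum fun d hd => ?_
    have hd0 : (0:ℝ) < d := by exact_mod_cast (Finset.mem_Icc.1 hd).1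
    have hΛ : 0 ≤ vonMangoldt d := vonMangoldt_nonneg
    have : (N:ℝ)/d ≤ ((N/d : ℕ):ℝ) + 1 := by
      rw [← Nat.floor_div_eq_div (K := ℝ)]
      exact (Nat.lt_floor_add_one _).le
    calc (N:ℝ) * (vonMangoldt d / d) = (N/d) * vonMangoldt d := by ring
      _ ≤ (((N/d : ℕ):ℝ) + 1) * vonMangoldt d := by gcongr
      _ = _ := by ring
  have h4 := psi_nat N
  have h5 : ∑ d ∈ Finset.Icc 1 N, vonMangoldt d / d ≤ Real.log N + 6 := by
    have : N * ∑ d ∈ Finset.Icc 1 N, vonMangoldt d / d ≤ N * (Real.log N + 6) := by linarith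
    exact le_of_mul_le_mul_left this hN0
  refine le_trans ?_ h5
  have : ∑ p ∈ (Finset.range (N+1)).filter Nat.Prime, Real.log p / p =
    ∑ p ∈ (Finset.range (N+1)).filter Nat.Prime, vonMangoldt p / p :=
    Finset.sum_congr rfl fun p hp => by rw [vonMangoldt_apply_prime (Finset.mem_filter.1 hp).2]
  rw [this]
  refine Finset.sum_le_sum_of_subset_of_nonneg ?_ ?_
  · intro p hp
    simp only [Finset.mem_filter, Finset.mem_range] at hp
    have := hp.2.one_lt
    simp; omega
  · intro d _ _
    exact div_nonneg vonMangoldt_nonneg (by positivity)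

noncomputable def AR (k N : ℕ) : ℝ := ∑ a ∈ RS k N, 1/(a:ℝ)

lemma AR_nonneg (k N : ℕ) : 0 ≤ AR k N := Finset.sum_nonneg fun _ _ => by positivity

lemma AR_mono (k : ℕ) {M N : ℕ} (h : M ≤ N) : AR k M ≤ AR k N := by
  refine Finset.sum_le_sum_of_subset_of_nonneg ?_ (fun _ _ _ => by positivity)
  intro a; simp only [mem_RS]; rintro ⟨⟨h1, h2⟩, h3⟩; exact ⟨⟨h1, by omega⟩, h3⟩

open ArithmeticFunction in
lemma log_sum_le (k M : ℕ) : ∑ b ∈ RS k M, Real.log b ≤ 6 * M * AR k M := by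
  simp_rw [log_eq_antidiag]
  rw [hyperR (fun _ d => vonMangoldt d), AR, Finset.mul_sum]
  refine Finset.sum_le_sum fun c hc => ?_
  calc ∑ b ∈ RS k (M / c), vonMangoldt b ≤ ∑ b ∈ Finset.Icc 1 (M/c), vonMangoldt b :=
        Finset.sum_le_sum_of_subset_of_nonneg (Finset.filter_subset _ _) (fun _ _ _ => vonMangoldt_nonneg)
    _ ≤ 6 * ((M/c : ℕ):ℝ) := psi_nat _
    _ ≤ 6 * (M/c) := by gcongr; exact Nat.cast_div_le
    _ = _ := by ring

lemma SR_log_le (k N : ℕ) (hN : 1 ≤ N) : SR k N * Real.log N ≤ 13 * N * AR k N ^ 2 := by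
  have e : SR k N * Real.log N = ∑ a ∈ RS k N, ∑ b ∈ RS k (N/a), Real.log N := by
    rw [SR_eq, Finset.sum_mul]; simp
  have hb : ∑ a ∈ RS k N, ∑ b ∈ RS k (N/a), Real.log b ≤ 6 * N * AR k N ^ 2 := by
    calc _ ≤ ∑ a ∈ RS k N, 6 * N * AR k N * (1/(a:ℝ)) := by
          refine Finset.sum_le_sum fun a _ => ?_
          refine (log_sum_le k (N/a)).trans ?_
          have h1 : ((N/a : ℕ):ℝ) ≤ N/a := Nat.cast_div_le
          have h2 := AR_mono k (Nat.div_le_self N a)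
          have h3 := AR_nonneg k (N/a)
          calc 6 * ((N/a : ℕ):ℝ) * AR k (N/a) ≤ 6 * (N/a) * AR k N := by gcongr
            _ = _ := by ring
      _ = _ := by rw [← Finset.mul_sum, ← AR]; ring
  have ha : ∑ a ∈ RS k N, ∑ b ∈ RS k (N/a), Real.log a ≤ 6 * N * AR k N ^ 2 := by
    rw [hyperR_swap (fun a _ => Real.log a)]; exact hb
  have hc : ∑ a ∈ RS k N, ∑ b ∈ RS k (N/a), (N:ℝ)/(a*b) ≤ N * AR k N ^ 2 := by
    calc _ ≤ ∑ a ∈ RS k N, N * AR k N * (1/(a:ℝ)) := by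
          refine Finset.sum_le_sum fun a _ => ?_
          have h2 := AR_mono k (Nat.div_le_self N a)
          have : ∑ b ∈ RS k (N/a), (N:ℝ)/(a*b) = N * AR k (N/a) * (1/(a:ℝ)) := by
            rw [AR, Finset.mul_sum, Finset.sum_mul]
            refine Finset.sum_congr rfl fun b _ => ?_
            ring
          rw [this]; gcongr
      _ = _ := by rw [← Finset.mul_sum, ← AR]; ring
  rw [e]
  have : ∑ a ∈ RS k N, ∑ b ∈ RS k (N/a), Real.log N ≤
     ∑ a ∈ RS k N, ∑ b ∈ RS k (N/a), (Real.log a + Real.log b + (N:ℝ)/(a*b)) := by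
    refine Finset.sum_le_sum fun a ha => Finset.sum_le_sum fun b hb => ?_
    have ha0 : (0:ℝ) < a := by exact_mod_cast (mem_RS.1 ha).1.1
    have hb0 : (0:ℝ) < b := by exact_mod_cast (mem_RS.1 hb).1.1
    have hN0 : (0:ℝ) < N := by exact_mod_cast hN
    have h := Real.log_le_sub_one_of_pos (show 0 < (N:ℝ)/(a*b) by positivity)
    rw [Real.log_div (by positivity) (by positivity), Real.log_mul (by positivity) (by positivity)] at h
    linarith
  refine this.trans ?_
  simp_rw [Finset.sum_add_distrib]
  linarith

/-! ### Rankin -/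

lemma summ_pow {s : ℝ} (hs : 1 < s) : Summable (fun n : ℕ => (n:ℝ)^(-s)) := by
  rw [Real.summable_nat_rpow]; linarith

lemma zeta_bound {s : ℝ} (hs : 1 < s) : ∑' n : ℕ, (n:ℝ)^(-s) ≤ 1 + 1/(s-1) := by
  rw [(summ_pow hs).tsum_eq_zero_add]
  have h := ZetaAsymptotics.zeta_limit_aux1 hs
  have h2 : 0 ≤ ZetaAsymptotics.termTSum s := tsum_nonneg fun n => ZetaAsymptotics.term_nonneg _ _
  have h3 : ∑' n : ℕ, ((n+1 : ℕ):ℝ)^(-s) = ∑' n : ℕ, 1 / (n + 1 : ℝ) ^ s := by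
    congr 1; ext n
    rw [Real.rpow_neg (by positivity)]; push_cast; simp
  have h4 : ((0:ℕ):ℝ)^(-s) = 0 := by
    rw [Nat.cast_zero, Real.zero_rpow (by linarith)]
  rw [h3, h4]
  nlinarith

noncomputable def GR (k : ℕ) (s : ℝ) : ℝ := ∑' a : ℕ, if rough k a then (a:ℝ)^(-s) else 0

lemma summ_GR (k : ℕ) {s : ℝ} (hs : 1 < s) : Summable (fun a : ℕ => if rough k a then (a:ℝ)^(-s) else 0) := by
  refine Summable.of_nonneg_of_le (fun a => ?_) (fun a => ?_) (summ_pow hs)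
  · split_ifs <;> positivity
  · split_ifs
    · rfl
    · positivity

lemma GR_eq (k : ℕ) {s : ℝ} (hs : 1 < s) :
    GR k s = (∑' n : ℕ, (n:ℝ)^(-s)) * ∏ p ∈ (Finset.range (k+1)).filter Nat.Prime, (1 - (p:ℝ)^(-s)) := by
  induction k with
  | zero =>
    have : (Finset.range (0+1)).filter Nat.Prime = ∅ := by
      ext p; simp; rintro rfl; exact Nat.not_prime_zero
    rw [this, Finset.prod_empty, mul_one, GR]
    congr 1; ext a
    rw [if_pos]
    intro p hp _; exact hp.pos
  | succ k ih =>
    rw [Finset.range_add_one (n := k+1), Finset.filter_insert]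
    by_cases hp : (k+1).Prime
    · rw [if_pos hp, Finset.prod_insert (by simp), mul_left_comm, ← ih]
      have hinj : Function.Injective (fun b : ℕ => (k+1) * b) := fun a b h =>
        Nat.eq_of_mul_eq_mul_left (by omega) h
      have h1 : ∑' a : ℕ, (if rough k a ∧ (k+1) ∣ a then (a:ℝ)^(-s) else 0) = ((k+1:ℕ):ℝ)^(-s) * GR k s := by
        rw [← hinj.tsum_eq, GR, ← tsum_mul_left]
        · congr 1; ext b
          by_cases hb : rough k b
          · rw [if_pos hb, if_pos ⟨rough_mul.2 ⟨rough_prime hp, hb⟩, dvd_mul_right _ _⟩]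
            rw [Nat.cast_mul, Real.mul_rpow (by positivity) (by positivity)]
          · rw [if_neg hb, if_neg (fun h => hb (rough_mul.1 h.1).2), mul_zero]
        · intro a ha
          rw [Function.mem_support] at ha
          have : rough k a ∧ (k+1) ∣ a := by
            by_contra h; exact ha (if_neg h)
          obtain ⟨c, rfl⟩ := this.2
          exact ⟨c, rfl⟩
      have hs1 : Summable (fun a : ℕ => if rough k a ∧ (k+1) ∣ a then (a:ℝ)^(-s) else 0) := by
        refine Summable.of_nonneg_of_le (fun a => ?_) (fun a => ?_) (summ_pow hs)
        · split_ifs <;> positivity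
        · split_ifs
          · rfl
          · positivity
      have h2 : GR k s = GR (k+1) s + ((k+1:ℕ):ℝ)^(-s) * GR k s := by
        rw [← h1, GR, GR, ← (summ_GR (k+1) hs).tsum_add hs1]
        congr 1; ext a
        rw [rough_succ hp]
        by_cases h : rough k a <;> by_cases h' : (k+1) ∣ a <;> simp [h, h']
      linarith
    · rw [if_neg hp, ← ih, GR, GR]
      congr 1; ext a; rw [rough_succ_not hp]

lemma factor_bound {p : ℕ} (hp : p.Prime) {l : ℝ} (hl : 0 < l) :
    1 - (p:ℝ)^(-(1 + 1/l)) ≤ (1 - 1/(p:ℝ)) * Real.exp (2 * (Real.log p / p) / l) := by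
  have hp2 : (2:ℝ) ≤ p := by exact_mod_cast hp.two_le
  have hp0 : (0:ℝ) < p := by linarith
  have e : (p:ℝ)^(-(1 + 1/l)) = 1/p * Real.exp (-(Real.log p / l)) := by
    rw [Real.rpow_def_of_pos hp0]
    have : Real.log p * -(1 + 1/l) = -Real.log p + -(Real.log p / l) := by field_simp; ring
    rw [this, Real.exp_add, Real.exp_neg, Real.exp_log hp0]; simp
  have h1 := Real.add_one_le_exp (-(Real.log p / l))
  have h2 := Real.add_one_le_exp (2 * (Real.log p / p) / l)
  have hlog : 0 ≤ Real.log p := Real.log_nonneg (by linarith)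
  have h3 : 1/(p:ℝ) ≤ 1/2 := by gcongr
  have h0 : 0 < 1/(p:ℝ) := by positivity
  rw [e]
  set t := Real.log p / l with ht
  have ht0 : 0 ≤ t := by positivity
  have e2 : 2 * (Real.log p / p) / l = 2 * (1/(p:ℝ)) * t := by rw [ht]; field_simp
  rw [e2] at h2 ⊢
  set u := 1/(p:ℝ)
  have h4 : u * (1 - t) ≤ u * Real.exp (-t) := by gcongr; linarith
  have h5 : (1-u) * (2*u*t+1) ≤ (1-u) * Real.exp (2*u*t) := by
    have : 0 ≤ 1 - u := by linarith
    gcongr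
  have h6 : 0 ≤ u * t := by positivity
  nlinarith

lemma AR_bound : ∃ C : ℝ, 0 < C ∧ ∀ k N : ℕ, 2 ≤ N → k ≤ N → AR k N ≤ C * Real.log N * Pk k := by
  have hl2 : 0 < Real.log 2 := Real.log_pos (by norm_num)
  refine ⟨Real.exp 1 * (1 + 1/Real.log 2) * Real.exp (2 * (1 + 6/Real.log 2)), by positivity, ?_⟩
  intro k N hN hk
  have hN' : (2:ℝ) ≤ N := by exact_mod_cast hN
  have hll : Real.log 2 ≤ Real.log N := Real.log_le_log (by norm_num) hN'
  set l := Real.log N with hl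
  have hl0 : 0 < l := by linarith
  have hs : 1 < 1 + 1/l := by have : 0 < 1/l := by positivity
                              linarith
  have s1 : AR k N ≤ Real.exp 1 * GR k (1 + 1/l) := by
    rw [GR, ← tsum_mul_left]
    have h1 : ∑ a ∈ RS k N, (Real.exp 1 * if rough k a then (a:ℝ)^(-(1+1/l)) else 0) ≤
        ∑' a : ℕ, (Real.exp 1 * if rough k a then (a:ℝ)^(-(1+1/l)) else 0) := by
      refine Summable.sum_le_tsum _ (fun a _ => ?_) ((summ_GR k hs).mul_left _)
      split_ifs <;> positivity
    refine le_trans (Finset.sum_le_sum fun a ha => ?_) h1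
    obtain ⟨⟨ha1, ha2⟩, ha3⟩ := mem_RS.1 ha
    rw [if_pos ha3]
    have ha0 : (0:ℝ) < a := by exact_mod_cast ha1
    have h2 : Real.log a ≤ l := Real.log_le_log ha0 (by exact_mod_cast ha2)
    rw [Real.rpow_def_of_pos ha0, ← Real.exp_add]
    have h3 : 1/(a:ℝ) = Real.exp (-Real.log a) := by rw [Real.exp_neg, Real.exp_log ha0]; simp
    rw [h3, Real.exp_le_exp]
    have : Real.log a / l ≤ 1 := by rw [div_le_one hl0]; exact h2
    have e : Real.log a * -(1+1/l) = -Real.log a - Real.log a / l := by field_simp; ring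
    rw [e]; linarith
  have hfac : ∀ p ∈ (Finset.range (k+1)).filter Nat.Prime, 0 ≤ 1 - (p:ℝ)^(-(1+1/l)) := by
    intro p hp
    have : (1:ℝ) ≤ p := by exact_mod_cast (Finset.mem_filter.1 hp).2.one_lt.le
    have := Real.rpow_le_one_of_one_le_of_nonpos this (show -(1+1/l) ≤ 0 by linarith)
    linarith
  have hprod := Finset.prod_nonneg hfac
  have s2 : ∏ p ∈ (Finset.range (k+1)).filter Nat.Prime, (1 - (p:ℝ)^(-(1+1/l))) ≤
      Pk k * Real.exp (2 * (1 + 6/Real.log 2)) := by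
    calc _ ≤ ∏ p ∈ (Finset.range (k+1)).filter Nat.Prime,
            ((1 - 1/(p:ℝ)) * Real.exp (2 * (Real.log p / p) / l)) := by
          refine Finset.prod_le_prod hfac (fun p hp => factor_bound (Finset.mem_filter.1 hp).2 hl0)
      _ = Pk k * Real.exp ((2/l) * ∑ p ∈ (Finset.range (k+1)).filter Nat.Prime, Real.log p / p) := by
          rw [Finset.prod_mul_distrib, ← Real.exp_sum, Finset.mul_sum, Pk]
          congr 2
          refine Finset.sum_congr rfl fun p _ => by ring
      _ ≤ _ := by
          have hP := Pk_pos k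
          refine mul_le_mul_of_nonneg_left (Real.exp_le_exp.2 ?_) hP.le
          have h1 : ∑ p ∈ (Finset.range (k+1)).filter Nat.Prime, Real.log p / p ≤ l + 6 := by
            refine le_trans ?_ (mertens1_s17 N (by omega))
            refine Finset.sum_le_sum_of_subset_of_nonneg ?_ (fun p _ _ => ?_)
            · intro p; simp only [Finset.mem_filter, Finset.mem_range]; rintro ⟨h, h'⟩; exact ⟨by omega, h'⟩
            · exact div_nonneg (Real.log_natCast_nonneg p) (by positivity)
          calc (2/l) * ∑ p ∈ (Finset.range (k+1)).filter Nat.Prime, Real.log p / p ≤ (2/l) * (l+6) := by gcongr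
            _ = 2 * (1 + 6/l) := by field_simp
            _ ≤ _ := by gcongr
  rw [GR_eq k hs] at s1
  have s3 := zeta_bound hs
  have s4 : 1 + 1/(1+1/l-1) ≤ (1 + 1/Real.log 2) * l := by
    have : 1 + 1/(1+1/l-1) = 1 + l := by rw [add_sub_cancel_left, one_div_one_div]
    rw [this]
    have : 1 ≤ 1/Real.log 2 * l := by
      rw [one_div, inv_mul_eq_div, one_le_div hl2]; exact hll
    linarith
  have hP := Pk_pos k
  have hz : 0 ≤ ∑' n : ℕ, (n:ℝ)^(-(1+1/l)) := tsum_nonneg fun n => by positivity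
  calc AR k N ≤ _ := s1
    _ ≤ Real.exp 1 * (((1 + 1/Real.log 2) * l) * (Pk k * Real.exp (2 * (1 + 6/Real.log 2)))) := by
        gcongr
        exact s3.trans s4
    _ = _ := by ring

noncomputable def ER (k N : ℕ) : ℝ := ∑ r ∈ (RS k N).filter (fun r => r ≠ 1), (r.divisors.card : ℝ)

lemma ER_le_SR (k N : ℕ) : ER k N ≤ SR k N :=
  Finset.sum_le_sum_of_subset_of_nonneg (Finset.filter_subset _ _) (fun _ _ _ => by positivity)

lemma SR_eq_ER (k N : ℕ) (hN : 1 ≤ N) : SR k N = 1 + ER k N := by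
  have h1 : 1 ∈ RS k N := mem_RS.2 ⟨⟨le_rfl, hN⟩, rough_one k⟩
  unfold SR ER
  rw [Finset.filter_ne', ← Finset.add_sum_erase _ _ h1]
  simp

lemma ER_bound : ∃ C : ℝ, 0 < C ∧ ∀ k N : ℕ, 1 ≤ N → ER k N ≤ C * (N * Real.log N) * Pk k ^ 2 := by
  obtain ⟨C, hC, h⟩ := AR_bound
  refine ⟨13 * C^2, by positivity, fun k N hN => ?_⟩
  have hP := Pk_pos k
  have hlog0 := Real.log_natCast_nonneg N
  by_cases hk : k < N
  · by_cases hN2 : 2 ≤ N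
    · have h1 := h k N hN2 hk.le
      have h2 := SR_log_le k N hN
      have hl : 0 < Real.log N := Real.log_pos (by exact_mod_cast hN2)
      refine (ER_le_SR k N).trans ?_
      have h3 : AR k N ^ 2 ≤ (C * Real.log N * Pk k)^2 := by
        have := AR_nonneg k N
        gcongr
      have : SR k N * Real.log N ≤ (13 * C^2 * (N * Real.log N) * Pk k ^ 2) * Real.log N := by
        calc _ ≤ 13 * N * AR k N ^ 2 := h2
          _ ≤ 13 * N * (C * Real.log N * Pk k)^2 := by gcongr
          _ = _ := by ring
      exact le_of_mul_le_mul_right this hl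
    · have : N = 1 := by omega
      subst this
      have : ER k 1 = 0 := by
        unfold ER
        refine Finset.sum_eq_zero fun r hr => ?_
        simp only [Finset.mem_filter, mem_RS] at hr
        omega
      rw [this]; positivity
  · have : ER k N = 0 := by
      unfold ER
      refine Finset.sum_eq_zero fun r hr => ?_
      simp only [Finset.mem_filter, mem_RS] at hr
      obtain ⟨⟨⟨h1, h2⟩, h3⟩, h4⟩ := hr
      have h5 := h3 _ (Nat.minFac_prime h4) (Nat.minFac_dvd r)
      have := Nat.minFac_le (n := r) (by omega)
      omega
    rw [this]; positivity


def trunc (m p : ℕ) : ℕ := ∏ q ∈ m.primeFactors.filter (· < p), q ^ m.factorization q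

def roughE (y : EReal) (r : ℕ) : Prop := ∀ p : ℕ, p.Prime → p ∣ r → ¬ (((p:ℝ):EReal) ≤ y)

lemma trunc_mul {n r p : ℕ} (hn : n ≠ 0) (hr : r ≠ 0)
    (h : ∀ q : ℕ, q.Prime → q ∣ r → p ≤ q) : trunc (n*r) p = trunc n p := by
  unfold trunc
  have e : (n*r).primeFactors.filter (· < p) = n.primeFactors.filter (· < p) := by
    ext q
    simp only [Finset.mem_filter, Nat.primeFactors_mul hn hr, Finset.mem_union]
    constructor
    · rintro ⟨h1 | h1, h2⟩
      · exact ⟨h1, h2⟩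
      · have := h q (Nat.prime_of_mem_primeFactors h1) (Nat.dvd_of_mem_primeFactors h1); omega
    · rintro ⟨h1, h2⟩; exact ⟨Or.inl h1, h2⟩
  rw [e]
  refine Finset.prod_congr rfl fun q hq => ?_
  rw [Finset.mem_filter] at hq
  have hq1 := Nat.prime_of_mem_primeFactors hq.1
  have : ¬ q ∣ r := fun hd => by have := h q hq1 hd; omega
  rw [Nat.factorization_mul hn hr, Finsupp.add_apply, Nat.factorization_eq_zero_of_not_dvd this, add_zero]

lemma trunc_all {n p : ℕ} (hn : n ≠ 0) (h : ∀ q : ℕ, q.Prime → q ∣ n → q < p) : trunc n p = n := by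
  unfold trunc
  rw [Finset.filter_true_of_mem (fun q hq =>
    h q (Nat.prime_of_mem_primeFactors hq) (Nat.dvd_of_mem_primeFactors hq))]
  exact Nat.prod_factorization_pow_eq_self hn

lemma mem_B {θ : ℕ → EReal} {n : ℕ} : n ∈ BsetE θ ↔ 0 < n ∧ ∀ p : ℕ, p.Prime → p ∣ n →
    ((p : ℝ) : EReal) ≤ θ (trunc n p) := Iff.rfl

lemma decomp_exists (θ : ℕ → EReal) {m : ℕ} (hm : 0 < m) :
    ∃ n r, n * r = m ∧ n ∈ BsetE θ ∧ roughE (θ n) r := by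
  by_cases hB : m ∈ BsetE θ
  · refine ⟨m, 1, mul_one m, hB, fun p hp hd => absurd (Nat.dvd_one.1 hd) hp.one_lt.ne'⟩
  have hex : ∃ p : ℕ, p.Prime ∧ p ∣ m ∧ ¬ (((p : ℝ) : EReal) ≤ θ (trunc m p)) := by
    rw [mem_B] at hB
    push Not at hB
    obtain ⟨p, h1, h2, h3⟩ := hB hm
    exact ⟨p, h1, h2, not_le.2 h3⟩
  obtain ⟨hp, hpd, hpθ⟩ := Nat.find_spec hex
  have hmin := fun q => Nat.find_min hex (m := q)
  set p := Nat.find hex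
  set r := ∏ q ∈ m.primeFactors.filter (fun q => ¬ q < p), q ^ m.factorization q with hr
  have hmul : trunc m p * r = m := by
    rw [trunc, hr, Finset.prod_filter_mul_prod_filter_not]
    exact Nat.prod_factorization_pow_eq_self hm.ne'
  have hn0 : trunc m p ≠ 0 := fun h => by rw [h, zero_mul] at hmul; omega
  have hr0 : r ≠ 0 := fun h => by rw [h, mul_zero] at hmul; omega
  have hrp : ∀ q : ℕ, q.Prime → q ∣ r → p ≤ q := by
    intro q hq hd
    rw [hr, Prime.dvd_finsetProd_iff hq.prime] at hd
    obtain ⟨a, ha, hqa⟩ := hd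
    rw [Finset.mem_filter] at ha
    have := (Nat.prime_dvd_prime_iff_eq hq (Nat.prime_of_mem_primeFactors ha.1)).1 (hq.dvd_of_dvd_pow hqa)
    omega
  have hnp : ∀ q : ℕ, q.Prime → q ∣ trunc m p → q < p := by
    intro q hq hd
    rw [trunc, Prime.dvd_finsetProd_iff hq.prime] at hd
    obtain ⟨a, ha, hqa⟩ := hd
    rw [Finset.mem_filter] at ha
    have := (Nat.prime_dvd_prime_iff_eq hq (Nat.prime_of_mem_primeFactors ha.1)).1 (hq.dvd_of_dvd_pow hqa)
    omega
  refine ⟨trunc m p, r, hmul, mem_B.2 ⟨Nat.pos_of_ne_zero hn0, fun q hq hd => ?_⟩, fun q hq hd hle => ?_⟩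
  · have h1 := hnp q hq hd
    have h2 := hmin q h1
    have h3 : q ∣ m := hmul ▸ hd.mul_right r
    have h4 : ((q : ℝ) : EReal) ≤ θ (trunc m q) := by
      by_contra h; exact h2 ⟨hq, h3, h⟩
    have h5 : trunc m q = trunc (trunc m p) q := by
      conv_lhs => rw [← hmul]
      exact trunc_mul hn0 hr0 (fun a ha hd => h1.le.trans (hrp a ha hd))
    rwa [← h5]
  · apply hpθ
    refine le_trans ?_ hle
    have := hrp q hq hd
    exact_mod_cast this

section
variable {θ : ℕ → EReal} (hθP : ∀ n : ℕ, 2 ≤ n → ∀ p : ℕ, p.Prime → p ∣ n → (((p : ℝ) : EReal)) ≤ θ n)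

lemma lt_of_rough (hθP : ∀ n : ℕ, 2 ≤ n → ∀ p : ℕ, p.Prime → p ∣ n → (((p : ℝ) : EReal)) ≤ θ n)
    {n r q p : ℕ} (hn : 0 < n) (hr : roughE (θ n) r) (hq : q.Prime) (hqn : q ∣ n)
    (hp : p.Prime) (hpr : p ∣ r) : q < p := by
  have hn2 : 2 ≤ n := hq.two_le.trans (Nat.le_of_dvd hn hqn)
  have h1 := hθP n hn2 q hq hqn
  have h2 := hr p hp hpr
  by_contra h
  push Not at h
  apply h2
  refine le_trans ?_ h1
  exact_mod_cast h

lemma decomp_key (hθP : ∀ n : ℕ, 2 ≤ n → ∀ p : ℕ, p.Prime → p ∣ n → (((p : ℝ) : EReal)) ≤ θ n)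
    {n r n' r' : ℕ} (hn : n ∈ BsetE θ) (hn' : n' ∈ BsetE θ) (hr : roughE (θ n) r)
    (hr' : roughE (θ n') r') (h0 : r ≠ 0) (h0' : r' ≠ 0) (h : n * r = n' * r') (h1 : r ≠ 1) :
    trunc (n*r) r.minFac = n ∧ ¬ r.minFac ∣ n' := by
  have hp := Nat.minFac_prime h1
  have hpd := Nat.minFac_dvd r
  have hn0 : n ≠ 0 := (mem_B.1 hn).1.ne'
  have e1 : trunc (n*r) r.minFac = n := by
    rw [trunc_mul hn0 h0 (fun q hq hd => Nat.minFac_le_of_dvd hq.two_le hd)]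
    exact trunc_all hn0 (fun q hq hd => lt_of_rough hθP (mem_B.1 hn).1 hr hq hd hp hpd)
  refine ⟨e1, fun hd => ?_⟩
  have h2 := (mem_B.1 hn').2 _ hp hd
  rw [← trunc_mul (mem_B.1 hn').1.ne' h0' (fun q hq hd' =>
    (lt_of_rough hθP (mem_B.1 hn').1 hr' hp hd hq hd').le), ← h, e1] at h2
  exact hr _ hp hpd h2

lemma decomp_unique (hθP : ∀ n : ℕ, 2 ≤ n → ∀ p : ℕ, p.Prime → p ∣ n → (((p : ℝ) : EReal)) ≤ θ n)
    {n r n' r' : ℕ} (hn : n ∈ BsetE θ) (hn' : n' ∈ BsetE θ) (hr : roughE (θ n) r)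
    (hr' : roughE (θ n') r') (h0 : r ≠ 0) (h0' : r' ≠ 0) (h : n * r = n' * r') : n = n' := by
  by_cases h1 : r = 1
  · by_cases h1' : r' = 1
    · subst h1 h1'; simpa using h
    · obtain ⟨_, h3⟩ := decomp_key hθP hn' hn hr' hr h0' h0 h.symm h1'
      exfalso; apply h3
      rw [h1, mul_one] at h
      rw [h]; exact (Nat.minFac_dvd r').mul_left n'
  · obtain ⟨e, h3⟩ := decomp_key hθP hn hn' hr hr' h0 h0' h h1
    have hp := Nat.minFac_prime h1
    have hd : r.minFac ∣ r' := by
      have : r.minFac ∣ n' * r' := h ▸ (Nat.minFac_dvd r).mul_left n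
      exact (hp.dvd_mul.1 this).resolve_left h3
    have h1' : r' ≠ 1 := by rintro rfl; exact hp.one_lt.ne' (Nat.dvd_one.1 hd)
    obtain ⟨e', h3'⟩ := decomp_key hθP hn' hn hr' hr h0' h0 h.symm h1'
    have hp' := Nat.minFac_prime h1'
    have hd' : r'.minFac ∣ r := by
      have : r'.minFac ∣ n * r := h ▸ (Nat.minFac_dvd r').mul_left n'
      exact (hp'.dvd_mul.1 this).resolve_left h3'
    have heq : r.minFac = r'.minFac :=
      le_antisymm (Nat.minFac_le_of_dvd hp'.two_le hd') (Nat.minFac_le_of_dvd hp.two_le hd)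
    rw [← e, ← e', h, heq]

lemma decomp_sum (hθP : ∀ n : ℕ, 2 ≤ n → ∀ p : ℕ, p.Prime → p ∣ n → (((p : ℝ) : EReal)) ≤ θ n) (N : ℕ) :
    ∑ m ∈ Finset.Icc 1 N, (m.divisors.card : ℝ) =
    ∑ n ∈ (Finset.Icc 1 N).filter (fun n => n ∈ BsetE θ), (n.divisors.card : ℝ) *
      ∑ r ∈ (Finset.Icc 1 (N/n)).filter (roughE (θ n)), (r.divisors.card : ℝ) := by
  simp_rw [Finset.mul_sum]
  rw [Finset.sum_sigma']
  symm
  refine Finset.sum_bij (fun x _ => x.1 * x.2) ?_ ?_ ?_ ?_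
  · rintro ⟨n, r⟩ hx
    simp only [Finset.mem_sigma, Finset.mem_filter, Finset.mem_Icc] at hx ⊢
    obtain ⟨⟨⟨h1, h2⟩, h3⟩, ⟨h4, h5⟩, h6⟩ := hx
    rw [Nat.le_div_iff_mul_le (by omega)] at h5
    exact ⟨Nat.mul_pos h1 h4, by linarith⟩
  · rintro ⟨n, r⟩ hx ⟨n', r'⟩ hx' h
    simp only [Finset.mem_sigma, Finset.mem_filter, Finset.mem_Icc] at hx hx' h
    obtain ⟨⟨⟨h1, h2⟩, h3⟩, ⟨h4, h5⟩, h6⟩ := hx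
    obtain ⟨⟨⟨h1', h2'⟩, h3'⟩, ⟨h4', h5'⟩, h6'⟩ := hx'
    have := decomp_unique hθP h3 h3' h6 h6' (by omega) (by omega) h
    subst this
    have := Nat.eq_of_mul_eq_mul_left (by omega) h
    subst this
    rfl
  · intro m hm
    rw [Finset.mem_Icc] at hm
    obtain ⟨n, r, hmul, hB, hr⟩ := decomp_exists θ (show 0 < m by omega)
    have hn0 := (mem_B.1 hB).1
    have hr0 : 0 < r := Nat.pos_of_ne_zero (by rintro rfl; simp at hmul; omega)
    refine ⟨⟨n, r⟩, ?_, hmul⟩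
    simp only [Finset.mem_sigma, Finset.mem_filter, Finset.mem_Icc]
    rw [Nat.le_div_iff_mul_le hn0]
    refine ⟨⟨⟨hn0, by nlinarith⟩, hB⟩, ⟨hr0, by linarith⟩, hr⟩
  · rintro ⟨n, r⟩ hx
    simp only [Finset.mem_sigma, Finset.mem_filter, Finset.mem_Icc] at hx ⊢
    obtain ⟨⟨⟨h1, h2⟩, h3⟩, ⟨h4, h5⟩, h6⟩ := hx
    have hc : Nat.Coprime n r := by
      refine Nat.Coprime.symm (Nat.coprime_of_dvd ?_)
      intro p hp hpr hpn
      exact (lt_of_rough hθP h1 h6 hp hpn hp hpr).ne rfl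
    rw [hc.card_divisors_mul]; push_cast; rfl
end

noncomputable def EE (y : EReal) (M : ℕ) : ℝ :=
  ∑ r ∈ (Finset.Icc 1 M).filter (fun r => roughE y r ∧ r ≠ 1), (r.divisors.card : ℝ)

lemma roughE_one (y : EReal) : roughE y 1 := fun p hp hd => absurd (Nat.dvd_one.1 hd) hp.one_lt.ne'

lemma EE_nonneg (y : EReal) (M : ℕ) : 0 ≤ EE y M := Finset.sum_nonneg fun _ _ => by positivity

lemma sum_rough_eq (y : EReal) (M : ℕ) (hM : 1 ≤ M) :
    ∑ r ∈ (Finset.Icc 1 M).filter (roughE y), (r.divisors.card : ℝ) = 1 + EE y M := by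
  have h1 : 1 ∈ (Finset.Icc 1 M).filter (roughE y) := by
    simp [roughE_one, hM]
  unfold EE
  rw [← Finset.filter_filter, Finset.filter_ne', ← Finset.add_sum_erase _ _ h1]
  simp

lemma T_identity {θ : ℕ → EReal} (hθP : ∀ n : ℕ, 2 ≤ n → ∀ p : ℕ, p.Prime → p ∣ n → (((p : ℝ) : EReal)) ≤ θ n) (x : ℝ) :
    SR 0 ⌊x⌋₊ = Tθ θ x + ∑ n ∈ (Finset.Icc 1 ⌊x⌋₊).filter (fun n => n ∈ BsetE θ),
      (n.divisors.card : ℝ) * EE (θ n) (⌊x⌋₊/n) := by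
  rw [SR, RS_zero, decomp_sum hθP, Tθ, ← Finset.sum_add_distrib]
  refine Finset.sum_congr rfl fun n hn => ?_
  simp only [Finset.mem_filter, Finset.mem_Icc] at hn
  rw [sum_rough_eq _ _ (Nat.div_pos hn.1.2 hn.1.1)]
  ring

lemma EReal_cases (y : EReal) : y = ⊤ ∨ ∃ k : ℕ, ∀ p : ℕ, p.Prime → (((p:ℝ):EReal) ≤ y ↔ p ≤ k) := by
  induction y using EReal.rec with
  | bot =>
    right
    refine ⟨0, fun p hp => ?_⟩
    have h0 := hp.pos
    have h1 : ¬ (((p:ℝ):EReal) ≤ ⊥) := by rw [le_bot_iff]; exact EReal.coe_ne_bot _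
    exact ⟨fun h => absurd h h1, fun h => by omega⟩
  | coe y =>
    right
    refine ⟨⌊y⌋₊, fun p hp => ?_⟩
    rw [EReal.coe_le_coe_iff, Nat.le_floor_iff' hp.pos.ne']
  | top => left; rfl

lemma prodSq_eq {y : EReal} {k : ℕ} (h : ∀ p : ℕ, p.Prime → (((p:ℝ):EReal) ≤ y ↔ p ≤ k)) :
    ePrimeProdSq y = Pk k ^ 2 := by
  have hs : {p : ℕ | p.Prime ∧ ((p : ℝ) : EReal) ≤ y} = ↑((Finset.range (k+1)).filter Nat.Prime) := by
    ext p
    simp only [Set.mem_ofPred_eq, Finset.coe_filter, Finset.mem_range]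
    constructor
    · rintro ⟨h1, h2⟩; exact ⟨by have := (h p h1).1 h2; omega, h1⟩
    · rintro ⟨h1, h2⟩; exact ⟨h2, (h p h2).2 (by omega)⟩
  have h1 : ePrimeProdSq y = ∏' p : {p : ℕ | p.Prime ∧ ((p : ℝ) : EReal) ≤ y}, (1 - 1 / ((p : ℕ) : ℝ)) ^ 2 := rfl
  rw [h1, tprod_congr_set_coe (fun p : ℕ => (1 - 1/(p:ℝ))^2) hs]
  rw [Pk, ← Finset.prod_pow]
  exact Finset.tprod_subtype' _ (fun p : ℕ => (1 - 1/(p:ℝ))^2)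

lemma roughE_iff {y : EReal} {k : ℕ} (h : ∀ p : ℕ, p.Prime → (((p:ℝ):EReal) ≤ y ↔ p ≤ k)) (r : ℕ) :
    roughE y r ↔ rough k r := by
  unfold roughE rough
  refine forall_congr' fun p => forall_congr' fun hp => forall_congr' fun _ => ?_
  rw [h p hp, not_le]

lemma EE_eq {y : EReal} {k : ℕ} (h : ∀ p : ℕ, p.Prime → (((p:ℝ):EReal) ≤ y ↔ p ≤ k)) (M : ℕ) :
    EE y M = ER k M := by
  unfold EE ER RS
  rw [Finset.filter_filter]
  congr 1
  refine Finset.filter_congr fun r _ => ?_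
  rw [roughE_iff h]

lemma EE_top (M : ℕ) : EE ⊤ M = 0 := by
  unfold EE
  refine Finset.sum_eq_zero fun r hr => ?_
  simp only [Finset.mem_filter] at hr
  exact absurd le_top (hr.2.1 _ (Nat.minFac_prime hr.2.2) (Nat.minFac_dvd r))

lemma prodSq_top : ePrimeProdSq ⊤ = 0 := by
  have hf : ∀ p : Nat.Primes, 0 ≤ 1/((p:ℕ):ℝ) ∧ 1/((p:ℕ):ℝ) ≤ 1 := fun p => by
    have : (1:ℝ) ≤ (p:ℕ) := by exact_mod_cast p.2.one_lt.le
    exact ⟨by positivity, by rw [div_le_one (by linarith)]; exact this⟩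
  have hns : ¬ Summable (fun p : Nat.Primes => 1/((p:ℕ):ℝ)) := by
    intro h
    exact Nat.Primes.not_summable_one_div h
  have key : HasProd (fun p : Nat.Primes => (1 - 1/((p:ℕ):ℝ))^2) 0 := by
    have ht : Filter.Tendsto (fun s : Finset Nat.Primes => ∑ p ∈ s, 1/((p:ℕ):ℝ)) Filter.atTop Filter.atTop := by
      refine Filter.tendsto_atTop_atTop_of_monotone (Finset.sum_mono_set_of_nonneg fun p => (hf p).1) fun b => ?_
      by_contra hb
      push Not at hb
      exact hns (summable_of_sum_le (fun p => (hf p).1) (fun u => (hb u).le))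
    have ht2 : Filter.Tendsto (fun s : Finset Nat.Primes => Real.exp (-∑ p ∈ s, 1/((p:ℕ):ℝ))) Filter.atTop (nhds 0) :=
      Real.tendsto_exp_neg_atTop_nhds_zero.comp ht
    refine squeeze_zero (fun s => Finset.prod_nonneg fun p _ => sq_nonneg _) (fun s => ?_) ht2
    rw [← Finset.sum_neg_distrib, Real.exp_sum]
    refine Finset.prod_le_prod (fun p _ => sq_nonneg _) (fun p _ => ?_)
    have h1 := Real.add_one_le_exp (-(1/((p:ℕ):ℝ)))
    have := hf p
    nlinarith
  have e : ePrimeProdSq ⊤ = ∏' p : Nat.Primes, (1 - 1/((p:ℕ):ℝ))^2 := by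
    unfold ePrimeProdSq
    have hs : {p : ℕ | p.Prime ∧ ((p : ℝ) : EReal) ≤ ⊤} = {p : ℕ | p.Prime} := by ext; simp
    exact tprod_congr_set_coe (fun p : ℕ => (1 - 1/(p:ℝ))^2) hs
  rw [e, key.tprod_eq]

lemma prodSq_nonneg (y : EReal) : 0 ≤ ePrimeProdSq y := by
  rcases EReal_cases y with rfl | ⟨k, hk⟩
  · rw [prodSq_top]
  · rw [prodSq_eq hk]; positivity

lemma EE_bound : ∃ C : ℝ, 0 < C ∧ ∀ (y : EReal) (M : ℕ), 1 ≤ M → EE y M ≤ C * (M * Real.log M) * ePrimeProdSq y := by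
  obtain ⟨C, hC, h⟩ := ER_bound
  refine ⟨C, hC, fun y M hM => ?_⟩
  rcases EReal_cases y with rfl | ⟨k, hk⟩
  · rw [prodSq_top, EE_top]; simp
  · rw [prodSq_eq hk, EE_eq hk]; exact h k M hM

lemma SR_lim (k n : ℕ) (hn : 1 ≤ n) :
    Filter.Tendsto (fun x : ℝ => SR k (⌊x⌋₊/n) / (x * Real.log x)) Filter.atTop (nhds (Pk k ^ 2 / n)) := by
  obtain ⟨K, hK, h⟩ := SR_asymp k
  have hn1 : (1:ℝ) ≤ n := by exact_mod_cast hn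
  have hn0 : (0:ℝ) < n := by linarith
  have hlim : Filter.Tendsto (fun x : ℝ => (K + Pk k ^ 2 * Real.log n) * (Real.log x)⁻¹) Filter.atTop (nhds 0) := by
    have := (Real.tendsto_log_atTop.inv_tendsto_atTop).const_mul (K + Pk k ^ 2 * Real.log n)
    simpa using this
  rw [tendsto_iff_norm_sub_tendsto_zero]
  refine squeeze_zero' (Filter.Eventually.of_forall fun x => norm_nonneg _) ?_ hlim
  filter_upwards [Filter.eventually_ge_atTop (n:ℝ), Filter.eventually_ge_atTop 2] with x hxn hx2
  have hx0 : 0 < x := by linarith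
  have hl : 0 < Real.log x := Real.log_pos (by linarith)
  have hln : 0 ≤ Real.log n := Real.log_natCast_nonneg n
  have h1 := h (x/n) (by rw [one_le_div hn0]; exact hxn)
  rw [Nat.floor_div_natCast, Real.log_div (by positivity) (by positivity)] at h1
  have h1 := abs_le.1 h1
  have hxn' : x / n ≤ x := div_le_self hx0.le hn1
  have hKx : K * (x/n) ≤ K * x := by gcongr
  have hPx : Pk k ^ 2 * (x/n * Real.log n) ≤ Pk k ^ 2 * (x * Real.log n) := by gcongr
  have hPx0 : 0 ≤ Pk k ^ 2 * (x/n * Real.log n) := by positivity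
  have e : SR k (⌊x⌋₊/n) / (x * Real.log x) - Pk k ^ 2 / n =
    (SR k (⌊x⌋₊/n) - Pk k ^ 2 * (x/n * Real.log x)) / (x * Real.log x) := by
    field_simp
  rw [e, Real.norm_eq_abs, abs_div, abs_of_pos (show 0 < x * Real.log x by positivity),
    div_le_iff₀ (by positivity)]
  have e2 : (K + Pk k ^ 2 * Real.log n) * (Real.log x)⁻¹ * (x * Real.log x) = K * x + Pk k ^ 2 * (x * Real.log n) := by
    field_simp
  rw [e2, abs_le]
  constructor <;> nlinarith

lemma tendsto_xlog : Filter.Tendsto (fun x : ℝ => (x * Real.log x)) Filter.atTop Filter.atTop :=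
  Filter.tendsto_id.atTop_mul_atTop₀ Real.tendsto_log_atTop

lemma EE_lim (y : EReal) (n : ℕ) (hn : 1 ≤ n) :
    Filter.Tendsto (fun x : ℝ => EE y (⌊x⌋₊/n) / (x * Real.log x)) Filter.atTop (nhds (ePrimeProdSq y / n)) := by
  rcases EReal_cases y with rfl | ⟨k, hk⟩
  · simp_rw [prodSq_top, EE_top]; simp
  · rw [prodSq_eq hk]
    simp_rw [EE_eq hk]
    have h1 := (SR_lim k n hn).sub tendsto_xlog.inv_tendsto_atTop
    rw [sub_zero] at h1
    refine h1.congr' ?_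
    filter_upwards [Filter.eventually_ge_atTop (n:ℝ)] with x hxn
    have : n ≤ ⌊x⌋₊ := Nat.le_floor hxn
    rw [SR_eq_ER k _ (Nat.div_pos this hn)]
    simp only [Pi.inv_apply]
    ring


noncomputable def fterm (θ : ℕ → EReal) (x : ℝ) (n : ℕ) : ℝ :=
  (n.divisors.card : ℝ) * EE (θ n) (⌊x⌋₊/n) / (x * Real.log x)

lemma Lterm_nonneg (θ : ℕ → EReal) (n : ℕ) : 0 ≤ Lterm θ n := by
  unfold Lterm
  have := prodSq_nonneg (θ n)
  positivity

lemma fterm_nonneg (θ : ℕ → EReal) {x : ℝ} (hx : 1 ≤ x) (n : ℕ) : 0 ≤ fterm θ x n := by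
  unfold fterm
  have := EE_nonneg (θ n) (⌊x⌋₊/n)
  have := Real.log_nonneg hx
  positivity

lemma EE_zero (y : EReal) : EE y 0 = 0 := by simp [EE]

lemma fterm_lim (θ : ℕ → EReal) (n : ℕ) (hn : 1 ≤ n) :
    Filter.Tendsto (fun x : ℝ => fterm θ x n) Filter.atTop (nhds (Lterm θ n)) := by
  have h := (EE_lim (θ n) n hn).const_mul (n.divisors.card : ℝ)
  have e : (n.divisors.card : ℝ) * (ePrimeProdSq (θ n) / n) = Lterm θ n := by unfold Lterm; ring
  rw [e] at h
  refine h.congr fun x => ?_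
  unfold fterm; ring

lemma fterm_bound : ∃ C : ℝ, 0 < C ∧ ∀ (θ : ℕ → EReal) (x : ℝ) (n : ℕ), 2 ≤ x → 1 ≤ n →
    fterm θ x n ≤ C * Lterm θ n := by
  obtain ⟨C, hC, h⟩ := EE_bound
  refine ⟨C, hC, fun θ x n hx hn => ?_⟩
  have hl : 0 < Real.log x := Real.log_pos (by linarith)
  have hn0 : (0:ℝ) < n := by exact_mod_cast hn
  have hP := prodSq_nonneg (θ n)
  unfold fterm
  rw [div_le_iff₀ (by positivity)]
  by_cases hM : 1 ≤ ⌊x⌋₊/n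
  · have h1 := h (θ n) (⌊x⌋₊/n) hM
    have h2 : ((⌊x⌋₊/n : ℕ):ℝ) ≤ x / n := by
      refine Nat.cast_div_le.trans ?_
      gcongr
      exact Nat.floor_le (by linarith)
    have h3 : Real.log ((⌊x⌋₊/n : ℕ):ℝ) ≤ Real.log x := by
      refine Real.log_le_log (by exact_mod_cast hM) (h2.trans (div_le_self (by linarith) (by exact_mod_cast hn)))
    have h4 := Real.log_natCast_nonneg (⌊x⌋₊/n)
    calc (n.divisors.card : ℝ) * EE (θ n) (⌊x⌋₊/n)
        ≤ (n.divisors.card : ℝ) * (C * (((⌊x⌋₊/n : ℕ):ℝ) * Real.log ((⌊x⌋₊/n : ℕ):ℝ)) * ePrimeProdSq (θ n)) := by gcongr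
      _ ≤ (n.divisors.card : ℝ) * (C * ((x/n) * Real.log x) * ePrimeProdSq (θ n)) := by gcongr
      _ = _ := by unfold Lterm; ring
  · have : ⌊x⌋₊/n = 0 := Nat.lt_one_iff.1 (not_le.1 hM)
    rw [this, EE_zero, mul_zero]
    have := Lterm_nonneg θ n
    positivity

lemma tsum_fterm (θ : ℕ → EReal) (x : ℝ) :
    ∑' n : BsetE θ, fterm θ x n = ∑ n ∈ (Finset.Icc 1 ⌊x⌋₊).filter (fun n => n ∈ BsetE θ), fterm θ x n := by
  rw [tsum_subtype (BsetE θ) (fterm θ x), tsum_eq_sum (s := Finset.Icc 1 ⌊x⌋₊), Finset.sum_filter]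
  · rfl
  · intro n hn
    by_cases hB : n ∈ BsetE θ
    · rw [Set.indicator_of_mem hB]
      have h1 := (mem_B.1 hB).1
      have : ⌊x⌋₊/n = 0 := Nat.div_eq_of_lt (by simp only [Finset.mem_Icc] at hn; omega)
      simp [fterm, this, EE_zero]
    · exact Set.indicator_of_notMem hB _

lemma T_eq {θ : ℕ → EReal} (hθP : ∀ n : ℕ, 2 ≤ n → ∀ p : ℕ, p.Prime → p ∣ n → (((p : ℝ) : EReal)) ≤ θ n) (x : ℝ) :
    SR 0 ⌊x⌋₊ / (x * Real.log x) = Tθ θ x / (x * Real.log x) + ∑' n : BsetE θ, fterm θ x n := by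
  rw [tsum_fterm, T_identity hθP, add_div, Finset.sum_div]
  rfl

lemma SR0_lim : Filter.Tendsto (fun x : ℝ => SR 0 ⌊x⌋₊ / (x * Real.log x)) Filter.atTop (nhds 1) := by
  have := SR_lim 0 1 le_rfl
  simpa [Pk_zero] using this

lemma finsum_le_one {θ : ℕ → EReal} (hθP : ∀ n : ℕ, 2 ≤ n → ∀ p : ℕ, p.Prime → p ∣ n → (((p : ℝ) : EReal)) ≤ θ n)
    (u : Finset (BsetE θ)) : ∑ n ∈ u, Lterm θ n ≤ 1 := by
  have h1 : Filter.Tendsto (fun x : ℝ => ∑ n ∈ u, fterm θ x n) Filter.atTop (nhds (∑ n ∈ u, Lterm θ n)) :=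
    tendsto_finsetSum _ fun n _ => fterm_lim θ n (mem_B.1 n.2).1
  refine le_of_tendsto_of_tendsto h1 SR0_lim ?_
  filter_upwards [Filter.eventually_ge_atTop 2] with x hx
  have hl : 0 < Real.log x := Real.log_pos (by linarith)
  rw [T_eq hθP]
  have hT : 0 ≤ Tθ θ x / (x * Real.log x) := by
    have : 0 ≤ Tθ θ x := Finset.sum_nonneg fun _ _ => by positivity
    positivity
  have hs : Summable (fun n : BsetE θ => fterm θ x n) := by
    refine summable_of_hasFiniteSupport ?_
    refine Set.Finite.subset ((Set.finite_Icc 0 ⌊x⌋₊).preimage (f := fun n : BsetE θ => (n:ℕ)) Subtype.val_injective.injOn) ?_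
    intro n hn
    rw [Function.mem_support] at hn
    simp only [Set.mem_preimage, Set.mem_Icc, zero_le, true_and]
    by_contra hlt
    push Not at hlt
    apply hn
    simp [fterm, Nat.div_eq_of_lt hlt, EE_zero]
  have := hs.sum_le_tsum u (fun n _ => fterm_nonneg θ (by linarith) n)
  linarith

theorem thmL (θ : ℕ → EReal)
    (hθ1 : ((2 : ℝ) : EReal) ≤ θ 1)
    (hθP : ∀ n : ℕ, 2 ≤ n → ∀ p : ℕ, p.Prime → p ∣ n → (((p : ℝ) : EReal)) ≤ θ n) :
    Summable (fun n : BsetE θ => Lterm θ n) ∧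
    Lconst θ ∈ Set.Icc (0:ℝ) 1 ∧
    (∀ ε : ℝ, 0 < ε → ∃ x₀ : ℝ, ∀ x : ℝ, x₀ ≤ x →
      |Tθ θ x - (1 - Lconst θ) * x * Real.log x| ≤ ε * x * Real.log x) ∧
    (Lconst θ = 1 ↔ ∀ ε : ℝ, 0 < ε → ∃ x₀ : ℝ, ∀ x : ℝ, x₀ ≤ x →
      |Tθ θ x| ≤ ε * x * Real.log x) := by
  have hfin := finsum_le_one hθP
  have hsum : Summable (fun n : BsetE θ => Lterm θ n) :=
    summable_of_sum_le (fun n => Lterm_nonneg θ n) hfin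
  have hL0 : 0 ≤ Lconst θ := tsum_nonneg fun n => Lterm_nonneg θ n
  have hL1 : Lconst θ ≤ 1 := hsum.tsum_le_of_sum_le hfin
  have hlim : Filter.Tendsto (fun x : ℝ => Tθ θ x / (x * Real.log x)) Filter.atTop (nhds (1 - Lconst θ)) := by
    obtain ⟨C, hC, hb⟩ := fterm_bound
    have h1 : Filter.Tendsto (fun x : ℝ => ∑' n : BsetE θ, fterm θ x n) Filter.atTop (nhds (Lconst θ)) := by
      refine tendsto_tsum_of_dominated_convergence (hsum.mul_left C)
        (fun n => fterm_lim θ n (mem_B.1 n.2).1) ?_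
      filter_upwards [Filter.eventually_ge_atTop 2] with x hx n
      rw [Real.norm_eq_abs, abs_of_nonneg (fterm_nonneg θ (by linarith) n)]
      exact hb θ x n hx (mem_B.1 n.2).1
    refine (SR0_lim.sub h1).congr fun x => ?_
    rw [T_eq hθP]; ring
  have h3 : ∀ ε : ℝ, 0 < ε → ∃ x₀ : ℝ, ∀ x : ℝ, x₀ ≤ x →
      |Tθ θ x - (1 - Lconst θ) * x * Real.log x| ≤ ε * x * Real.log x := by
    intro ε hε
    obtain ⟨x₀, hx₀⟩ := (Metric.tendsto_atTop.1 hlim) ε hε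
    refine ⟨max x₀ 2, fun x hx => ?_⟩
    have hx2 : 2 ≤ x := le_trans (le_max_right _ _) hx
    have h := hx₀ x (le_trans (le_max_left _ _) hx)
    have hpos : 0 < x * Real.log x := mul_pos (by linarith) (Real.log_pos (by linarith))
    rw [Real.dist_eq] at h
    have e : Tθ θ x - (1 - Lconst θ) * x * Real.log x =
        (Tθ θ x / (x * Real.log x) - (1 - Lconst θ)) * (x * Real.log x) := by
      have h5 := div_mul_cancel₀ (Tθ θ x) hpos.ne'
      linear_combination -h5
    rw [e, abs_mul, abs_of_pos hpos, mul_assoc]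
    exact mul_le_mul_of_nonneg_right h.le hpos.le
  refine ⟨hsum, ⟨hL0, hL1⟩, h3, ?_, ?_⟩
  · intro hL ε hε
    obtain ⟨x₀, hx₀⟩ := h3 ε hε
    refine ⟨x₀, fun x hx => ?_⟩
    simpa [hL] using hx₀ x hx
  · intro h
    have h0 : Filter.Tendsto (fun x : ℝ => Tθ θ x / (x * Real.log x)) Filter.atTop (nhds 0) := by
      rw [Metric.tendsto_atTop]
      intro ε hε
      obtain ⟨x₀, hx₀⟩ := h (ε/2) (by positivity)
      refine ⟨max x₀ 2, fun x hx => ?_⟩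
      have hx2 : 2 ≤ x := le_trans (le_max_right _ _) hx
      have h := hx₀ x (le_trans (le_max_left _ _) hx)
      have hpos : 0 < x * Real.log x := mul_pos (by linarith) (Real.log_pos (by linarith))
      rw [Real.dist_eq, sub_zero, abs_div, abs_of_pos hpos, div_lt_iff₀ hpos]
      rw [mul_assoc] at h
      nlinarith
    have := tendsto_nhds_unique hlim h0
    linarith
end
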